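/- Let H be a finite group with normal subgroup Q which is similar to a 3-centralizer in a group of type F₂, and write Z = Z(Q). Let r be an element of H of order 2 whose image in H/Q lies in O₂(H/Q) but not in the center Z(O₂(H/Q)), and let ρ ∈ C_Q(r) ∖ Z. Then |C_H(ρ)| = 2⁸·3¹⁰; the centralizer C_H(ρ) splits over ⟨ρ⟩, indeed C_H(ρ) = ⟨ρ⟩ × C for some subgroup C; and the largest normal 3-subgroup O₃(C_H(ρ)/⟨ρ⟩) of C_H(ρ)/⟨ρ⟩ is extraspecial of order 3⁷ with C_{C_H(ρ)/⟨ρ⟩}(O₃(C_H(ρ)/⟨ρ⟩)) equal to its center. -/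

import Mathlib

/-- `O_p(X)`: the largest normal `p`-subgroup of the group `X` (for finite `X` this is the
`p`-core), defined as the join of all normal `p`-subgroups. -/
def Op (p : ℕ) (X : Type*) [Group X] : Subgroup X :=
  sSup {P : Subgroup X | P.Normal ∧ IsPGroup p P}

theorem map_conjAut_eq_of_normal {X : Type*} [Group X] (g : X) {P : Subgroup X}
    (hP : P.Normal) : Subgroup.map (MulAut.conj g).toMonoidHom P = P := by
  ext x
  simp only [Subgroup.mem_map, MulEquiv.coe_toMonoidHom, MulAut.conj_apply]
  constructor
  · rintro ⟨y, hy, rfl⟩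
    exact hP.conj_mem y hy g
  · intro hx
    refine ⟨g⁻¹ * x * g, by simpa using hP.conj_mem x hx g⁻¹, by group⟩

instance Op.normal (p : ℕ) (X : Type*) [Group X] : (Op p X).Normal := by
  constructor
  intro n hn g
  have key : Subgroup.map (MulAut.conj g).toMonoidHom (Op p X) = Op p X := by
    unfold Op
    rw [(Subgroup.gc_map_comap _).l_sSup]
    apply le_antisymm
    · refine iSup_le fun P => iSup_le fun hP => ?_
      rw [map_conjAut_eq_of_normal g hP.1]
      exact le_sSup hP
    · refine sSup_le fun P hP => ?_
      refine le_trans (le_of_eq (map_conjAut_eq_of_normal g hP.1).symm) ?_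
      exact le_iSup₂_of_le P hP le_rfl
  rw [← key]
  exact Subgroup.mem_map.mpr ⟨n, hn, by simp⟩

/-- A finite `p`-group is extraspecial if its center, derived subgroup and Frattini subgroup
coincide and have order `p`. -/
def IsExtraspecial (p : ℕ) (P : Type*) [Group P] : Prop :=
  IsPGroup p P ∧ Subgroup.center P = commutator P ∧ Subgroup.center P = frattini P ∧
    Nat.card (Subgroup.center P) = p

/-- The symplectic group `Sp₄(GF(3))`. -/
abbrev Sp43 := Matrix.symplecticGroup (Fin 2) (ZMod 3)

/-- `PSp₄(3) ≅ Ω₆⁻(2)`, the quotient of `Sp₄(GF(3))` by its center. -/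
abbrev PSp43 := Sp43 ⧸ Subgroup.center Sp43

/-- A finite group `H` with a normal subgroup `Q` is similar to a 3-centralizer in a group of
type `M(23)` or `F₂` (Definitions 1.1 and 1.2 of the paper): `Q = F*(H) = O₃(H) ≅ 3^{1+8}_+`
with `Z(Q) = Z(H)`, `O₂(H/Q) ≅ 2^{1+6}_-` with `F*(H/Q) = O₂(H/Q)`, and `(H/Q)/O₂(H/Q)` is
isomorphic to `PSp₄(3)` (type `F₂`) or to the centralizer of a 3-central element of `PSp₄(3)`
(type `M(23)`). -/
structure SimilarToM23orF2Centralizer (H : Type*) [Group H] [Finite H]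
    (Q : Subgroup H) [Q.Normal] : Prop where
  extraspecial : IsExtraspecial 3 Q
  card_eq : Nat.card Q = 3 ^ 9
  exponent3 : ∀ x ∈ Q, x ^ 3 = 1
  centralizer_eq : Subgroup.centralizer (Q : Set H) = Subgroup.center H
  center_le : Subgroup.center H ≤ Q
  O2_extraspecial : IsExtraspecial 2 (Op 2 (H ⧸ Q))
  O2_card : Nat.card (Op 2 (H ⧸ Q)) = 2 ^ 7
  O2_minusType : ∀ A : Subgroup (H ⧸ Q), A ≤ Op 2 (H ⧸ Q) → (∀ x ∈ A, x ^ 2 = 1) →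
    Nat.card A ≤ 2 ^ 3
  O2_selfCentralizing :
    Subgroup.centralizer ((Op 2 (H ⧸ Q)) : Set (H ⧸ Q)) ≤ Op 2 (H ⧸ Q)
  quotient_iso :
    Nonempty (((H ⧸ Q) ⧸ Op 2 (H ⧸ Q)) ≃* PSp43) ∨
    ∃ (z : PSp43) (S : Sylow 3 PSp43), orderOf z = 3 ∧ z ∈ (S : Subgroup PSp43) ∧
      z ∈ Subgroup.centralizer ((S : Subgroup PSp43) : Set PSp43) ∧
      Nonempty (((H ⧸ Q) ⧸ Op 2 (H ⧸ Q)) ≃* Subgroup.centralizer {z})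

/-- A finite group `H` with a normal subgroup `Q` is similar to a 3-centralizer in a group of
type `F₂` (Definition 1.2 of the paper). -/
structure SimilarToF2Centralizer (H : Type*) [Group H] [Finite H]
    (Q : Subgroup H) [Q.Normal] : Prop where
  extraspecial : IsExtraspecial 3 Q
  card_eq : Nat.card Q = 3 ^ 9
  exponent3 : ∀ x ∈ Q, x ^ 3 = 1
  centralizer_eq : Subgroup.centralizer (Q : Set H) = Subgroup.center H
  center_le : Subgroup.center H ≤ Q
  O2_extraspecial : IsExtraspecial 2 (Op 2 (H ⧸ Q))
  O2_card : Nat.card (Op 2 (H ⧸ Q)) = 2 ^ 7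
  O2_minusType : ∀ A : Subgroup (H ⧸ Q), A ≤ Op 2 (H ⧸ Q) → (∀ x ∈ A, x ^ 2 = 1) →
    Nat.card A ≤ 2 ^ 3
  O2_selfCentralizing :
    Subgroup.centralizer ((Op 2 (H ⧸ Q)) : Set (H ⧸ Q)) ≤ Op 2 (H ⧸ Q)
  quotient_iso : Nonempty (((H ⧸ Q) ⧸ Op 2 (H ⧸ Q)) ≃* PSp43)

/-- `⟨ρ⟩` is a central (hence normal) subgroup of `C_G(ρ)`. -/
instance zpowers_subgroupOf_centralizer_normal {G : Type*} [Group G] (ρ : G) :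
    ((Subgroup.zpowers ρ).subgroupOf (Subgroup.centralizer {ρ})).Normal := by
  constructor
  intro n hn g
  rw [Subgroup.mem_subgroupOf] at hn ⊢
  obtain ⟨k, hk⟩ := hn
  have hg : Commute ρ (g : G) := by
    have hmem := g.2
    rw [Subgroup.mem_centralizer_iff] at hmem
    exact hmem ρ (Set.mem_singleton ρ)
  have hng : Commute ((n : G)) (g : G) := by
    have h2 := hg.zpow_left k
    simp only at hk
    rwa [hk] at h2
  have hcoe : ((g * n * g⁻¹ : Subgroup.centralizer ({ρ} : Set G)) : G)
      = (g : G) * (n : G) * (g : G)⁻¹ := by push_cast; rfl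
  rw [hcoe, ← hng.eq, mul_assoc, mul_inv_cancel, mul_one]
  exact ⟨k, hk⟩

/-- Elementary consequences of `E` being extraspecial of order `2^7` and minus type with centre
generated by `z`. -/
structure ESet {G : Type*} [Group G] (E : Subgroup G) (z : G) : Prop where
  zE : z ∈ E
  z1 : z ≠ 1
  zz : z * z = 1
  zc : ∀ g, g * z = z * g
  comm : ∀ x ∈ E, ∀ y ∈ E, x * y = y * x ∨ x * y = y * x * z
  sq : ∀ x ∈ E, x * x = 1 ∨ x * x = z
  cen : ∀ x ∈ E, (∀ y ∈ E, x * y = y * x) → x = 1 ∨ x = z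
  card : Nat.card E = 128
  ab8 : ∀ A : Subgroup G, A ≤ E → (∀ x ∈ A, x * x = 1) → Nat.card A ≤ 8

namespace F2Aux

variable {G : Type*} [Group G]

/-- centralizer of `x` inside `D`. -/
def cz (D : Subgroup G) (x : G) : Subgroup G where
  carrier := {y | y ∈ D ∧ y * x = x * y}
  mul_mem' := by
    rintro a b ⟨ha, ha'⟩ ⟨hb, hb'⟩
    exact ⟨D.mul_mem ha hb, by rw [mul_assoc, hb', ← mul_assoc, ha', mul_assoc]⟩
  one_mem' := ⟨D.one_mem, by simp⟩
  inv_mem' := by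
    rintro a ⟨ha, ha'⟩
    refine ⟨D.inv_mem ha, ?_⟩
    rw [inv_mul_eq_iff_eq_mul, ← mul_assoc, ha', mul_inv_cancel_right]

theorem mem_cz {D : Subgroup G} {x y : G} : y ∈ cz D x ↔ y ∈ D ∧ y * x = x * y := Iff.rfl

theorem cz_le (D : Subgroup G) (x : G) : cz D x ≤ D := fun _ h => h.1

/-- adjoin an element, commuting with `B`, whose square lies in `B`. -/
def adj (B : Subgroup G) (x : G) (hx : x * x ∈ B) (hc : ∀ b ∈ B, b * x = x * b) : Subgroup G where
  carrier := {y | y ∈ B ∨ y * x ∈ B}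
  one_mem' := Or.inl B.one_mem
  mul_mem' := by
    rintro a b (ha | ha) (hb | hb)
    · exact Or.inl (B.mul_mem ha hb)
    · right; rw [mul_assoc]; exact B.mul_mem ha hb
    · right
      rw [mul_assoc, hc b hb, ← mul_assoc]; exact B.mul_mem ha hb
    · left
      have h1 : a * x * (b * x) ∈ B := B.mul_mem ha hb
      have h2 : a * b = a * x * (b * x) * (x * x)⁻¹ := by
        have h3 := hc _ hb
        have h4 : b * x = x * b := by
          have : b * x * x = x * b * x := by rw [h3]; group
          exact mul_right_cancel this
        rw [h4]
        have : x * (x * b) = b * (x * x) := by rw [← h4, ← mul_assoc, ← h4, mul_assoc]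
        rw [mul_assoc a, this]; group
      rw [h2]; exact B.mul_mem h1 (B.inv_mem hx)
  inv_mem' := by
    rintro a (ha | ha)
    · exact Or.inl (B.inv_mem ha)
    · right
      have h1 := hc _ ha
      have : a⁻¹ * x = (a * x)⁻¹ * (x * x) := by
        have h4 : a * x = x * a := by
          have : a * x * x = x * a * x := by rw [h1]; group
          exact mul_right_cancel this
        rw [h4]; group
      rw [this]; exact B.mul_mem (B.inv_mem ha) hx

theorem mem_adj {B : Subgroup G} {x : G} {hx hc} {y : G} :
    y ∈ adj B x hx hc ↔ y ∈ B ∨ y * x ∈ B := Iff.rfl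

theorem le_adj {B : Subgroup G} {x : G} {hx hc} : B ≤ adj B x hx hc := fun _ h => Or.inl h

theorem self_mem_adj {B : Subgroup G} {x : G} {hx hc} : x ∈ adj B x hx hc := Or.inr hx

theorem adj_le {B D : Subgroup G} {x : G} {hx hc} (hB : B ≤ D) (h : x ∈ D) :
    adj B x hx hc ≤ D := by
  rintro y (hy | hy)
  · exact hB hy
  · simpa using D.mul_mem (hB hy) (D.inv_mem h)

theorem card_two_of {K D : Subgroup G} (hK : K ≤ D) (e : G) (he : e ∈ D)
    (h : ∀ b ∈ D, Xor (b * e ∈ K) (b ∈ K)) : Nat.card D = 2 * Nat.card K := by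
  have h2 : K.relIndex D = 2 := by
    rw [Subgroup.relIndex_eq_two_iff]
    exact ⟨e, he, h⟩
  rw [← h2, mul_comm, ← Subgroup.card_mul_index (K.subgroupOf D), ← Subgroup.relIndex]
  congr 1
  exact Nat.card_congr (Subgroup.subgroupOfEquivOfLe hK).toEquiv

theorem card_adj {B : Subgroup G} {x : G} {hx hc} (h : x ∉ B) :
    Nat.card (adj B x hx hc) = 2 * Nat.card B := by
  refine card_two_of le_adj x self_mem_adj ?_
  rintro b (hb | hb)
  · right
    refine ⟨hb, fun h' => h ?_⟩
    simpa using B.mul_mem (B.inv_mem hb) h'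
  · left
    refine ⟨hb, fun h' => h ?_⟩
    simpa using B.mul_mem (B.inv_mem h') hb

theorem adj_sq {B : Subgroup G} {x : G} {hx hc} (hB : ∀ b ∈ B, b * b = 1) (h1 : x * x = 1) :
    ∀ y ∈ adj B x hx hc, y * y = 1 := by
  rintro y (hy | hy)
  · exact hB y hy
  · have h2 := hB _ hy
    have h3 := hc _ hy
    have h4 : y * x = x * y := by
      have : y * x * x = x * y * x := by rw [h3]; group
      exact mul_right_cancel this
    calc y * y = y * (x * x) * y := by rw [h1]; simp
      _ = y * x * (x * y) := by group
      _ = y * x * (y * x) := by rw [← h4]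
      _ = 1 := h2

theorem eq_of_card_le [Finite G] {K D : Subgroup G} (h : K ≤ D) (hc : Nat.card D ≤ Nat.card K) :
    K = D := by
  apply SetLike.coe_injective
  exact Set.eq_of_subset_of_ncard_le h (by rw [← Nat.card_coe_set_eq, ← Nat.card_coe_set_eq]; exact hc)

variable {E : Subgroup G} {z : G}

theorem card_cz [Finite G] (hE : ESet E z) {D : Subgroup G} (hD : D ≤ E) {x e : G} (hx : x ∈ E)
    (he : e ∈ D) (hn : e * x ≠ x * e) : Nat.card D = 2 * Nat.card (cz D x) := by
  refine card_two_of (cz_le D x) e he ?_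
  intro b hb
  have h1 := hE.comm b (hD hb) x hx
  have h2 := (hE.comm e (hD he) x hx).resolve_left hn
  have hz := hE.zc
  have key : b * e * x = b * x * e * z := by rw [mul_assoc, h2]; group
  rcases h1 with h1 | h1
  · right
    refine ⟨⟨hb, h1⟩, fun h => hn ?_⟩
    have h3 := h.2
    have : b * (e * x) = b * (x * e) := by rw [← mul_assoc, h3, ← mul_assoc, ← h1, mul_assoc]
    exact mul_left_cancel this
  · left
    refine ⟨⟨D.mul_mem hb he, ?_⟩, fun h => ?_⟩
    · rw [key, h1]
      calc x * b * z * e * z = x * b * (z * e) * z := by group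
        _ = x * b * e * (z * z) := by rw [← hz]; group
        _ = _ := by rw [hE.zz]; group
    · have h3 := h.2
      rw [h3] at h1
      exact hE.z1 (mul_left_cancel (a := x * b) (by rw [← h1, mul_one]))

/-- maximality of elementary abelian subgroups of order 8 -/
theorem mem_of_comm [Finite G] (hE : ESet E z) {B : Subgroup G} (hB : B ≤ E)
    (h2 : ∀ b ∈ B, b * b = 1) (hc : Nat.card B = 8) {x : G} (hx : x ∈ E) (hxx : x * x = 1)
    (hxc : ∀ b ∈ B, b * x = x * b) : x ∈ B := by
  by_contra h
  have := hE.ab8 (adj B x (by rw [hxx]; exact B.one_mem) hxc) (adj_le hB hx) (adj_sq h2 hxx)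
  rw [card_adj h] at this
  omega

theorem nonab [Finite G] (hE : ESet E z) {C : Subgroup G} (hC : C ≤ E) (hc : 32 ≤ Nat.card C) :
    ∃ x ∈ C, ∃ y ∈ C, x * y ≠ y * x := by
  by_contra! hab
  let K : Subgroup G :=
    { carrier := {x | x ∈ C ∧ x * x = 1}
      one_mem' := ⟨C.one_mem, by simp⟩
      mul_mem' := by
        rintro a b ⟨ha, ha'⟩ ⟨hb, hb'⟩
        refine ⟨C.mul_mem ha hb, ?_⟩
        calc a * b * (a * b) = a * (b * a) * b := by group
          _ = (a * a) * (b * b) := by rw [hab b hb a ha]; group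
          _ = 1 := by rw [ha', hb']; simp
      inv_mem' := by
        rintro a ⟨ha, ha'⟩
        refine ⟨C.inv_mem ha, ?_⟩
        rw [← mul_inv_rev, ha', inv_one] }
  have hK8 : Nat.card K ≤ 8 := hE.ab8 K (fun x hx => hC hx.1) (fun x hx => hx.2)
  by_cases hall : ∀ x ∈ C, x * x = 1
  · have := hE.ab8 C hC hall; omega
  · push Not at hall
    obtain ⟨e, he, hee⟩ := hall
    have hez := (hE.sq e (hC he)).resolve_left hee
    have : Nat.card C = 2 * Nat.card K := by
      refine card_two_of (fun x hx => hx.1) e he ?_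
      intro b hb
      have hbe : b * e * (b * e) = b * b * z := by
        calc b * e * (b * e) = b * (e * b) * e := by group
          _ = (b * b) * (e * e) := by rw [hab e he b hb]; group
          _ = _ := by rw [hez]
      rcases hE.sq b (hC hb) with h | h
      · right
        refine ⟨⟨hb, h⟩, fun h' => ?_⟩
        have := h'.2
        rw [hbe, h, one_mul] at this
        exact hE.z1 this
      · left
        refine ⟨⟨C.mul_mem hb he, by rw [hbe, h, hE.zz]⟩, fun h' => ?_⟩
        have := h'.2
        rw [h] at this
        exact hE.z1 this
    omega

/-- double centralizer -/
theorem dcent (hE : ESet E z) {r s : G} (hr : r ∈ E) (hs : s ∈ E)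
    {e : G} (he : e ∈ E) (hn : e * r ≠ r * e)
    (h : ∀ x ∈ E, x * r = r * x → x * s = s * x) : s = 1 ∨ s = z ∨ s = r ∨ s = r * z := by
  have hz := hE.zc
  have her := (hE.comm e he r hr).resolve_left hn
  -- any element of E not commuting with r is e times an element of the centralizer
  have hsplit : ∀ x ∈ E, x * r ≠ r * x → (e⁻¹ * x) * s = s * (e⁻¹ * x) := by
    intro x hx hxn
    have hxr := (hE.comm x hx r hr).resolve_left hxn
    apply h _ (E.mul_mem (E.inv_mem he) hx)
    have : e * (e⁻¹ * x * r) = e * (r * (e⁻¹ * x)) := by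
      calc e * (e⁻¹ * x * r) = x * r := by group
        _ = r * (x * z) := by rw [hxr]; group
        _ = r * (e * z) * e⁻¹ * x := by rw [hz x, hz e]; group
        _ = (e * r) * e⁻¹ * x := by rw [her]; group
        _ = _ := by group
    exact mul_left_cancel this
  by_cases hes : e * s = s * e
  · have := hE.cen s hs (by
      intro y hy
      by_cases hyr : y * r = r * y
      · exact (h y hy hyr).symm
      · have h1 := hsplit y hy hyr
        calc s * y = s * e * (e⁻¹ * y) := by group
          _ = e * (s * (e⁻¹ * y)) := by rw [← hes]; group
          _ = y * s := by rw [← h1]; group)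
    tauto
  · have hes' := (hE.comm e he s hs).resolve_left hes
    have := hE.cen (r⁻¹ * s) (E.mul_mem (E.inv_mem hr) hs) (by
      have hcr : ∀ y ∈ E, y * r = r * y → y * (r⁻¹ * s) = r⁻¹ * s * y := by
        intro y hy hyr
        have h1 := h y hy hyr
        have h2 : y * r⁻¹ = r⁻¹ * y := by
          rw [mul_inv_eq_iff_eq_mul, mul_assoc, hyr]; group
        rw [← mul_assoc, h2, mul_assoc, h1]; group
      have hce : e * (r⁻¹ * s) = r⁻¹ * s * e := by
        have h2 : e * r⁻¹ = r⁻¹ * e * z := by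
          rw [mul_inv_eq_iff_eq_mul]
          calc e = e * (z * z) := by rw [hE.zz, mul_one]
            _ = r⁻¹ * (r * e * z) * z := by group
            _ = r⁻¹ * (e * (r * z)) := by rw [← her]; group
            _ = r⁻¹ * e * z * r := by rw [hz r]; group
        rw [← mul_assoc, h2, mul_assoc, ← hz s, ← mul_assoc, mul_assoc r⁻¹, hes']
        calc r⁻¹ * (s * e * z) * z = r⁻¹ * s * e * (z * z) := by group
          _ = _ := by rw [hE.zz, mul_one]
      intro y hy
      by_cases hyr : y * r = r * y
      · exact (hcr y hy hyr).symm
      · have hxr := (hE.comm y hy r hr).resolve_left hyr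
        have h1 : (e⁻¹ * y) * (r⁻¹ * s) = (r⁻¹ * s) * (e⁻¹ * y) := by
          apply hcr _ (E.mul_mem (E.inv_mem he) hy)
          have : e * (e⁻¹ * y * r) = e * (r * (e⁻¹ * y)) := by
            calc e * (e⁻¹ * y * r) = y * r := by group
              _ = r * (y * z) := by rw [hxr]; group
              _ = r * (e * z) * e⁻¹ * y := by rw [hz y, hz e]; group
              _ = (e * r) * e⁻¹ * y := by rw [her]; group
              _ = _ := by group
          exact mul_left_cancel this
        calc r⁻¹ * s * y = (r⁻¹ * s * e) * (e⁻¹ * y) := by group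
          _ = e * ((r⁻¹ * s) * (e⁻¹ * y)) := by rw [← hce]; group
          _ = y * (r⁻¹ * s) := by rw [← h1]; group)
    rcases this with h | h
    · right; right; left
      exact (inv_mul_eq_one.mp h).symm
    · right; right; right
      exact inv_mul_eq_iff_eq_mul.mp h

end F2Aux

namespace F2Aux

variable {G : Type*} [Group G] {E : Subgroup G} {z : G}

/-- noncentral involutions of `E` -/
structure NC (E : Subgroup G) (z r : G) : Prop where
  mem : r ∈ E
  sq : r * r = 1
  ne1 : r ≠ 1
  nez : r ≠ z

theorem NC.ex (hE : ESet E z) {r : G} (h : NC E z r) : ∃ e ∈ E, e * r ≠ r * e := by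
  by_contra! hc
  rcases hE.cen r h.mem (fun y hy => (hc y hy).symm) with h1 | h1
  · exact h.ne1 h1
  · exact h.nez h1

theorem exB1 (hE : ESet E z) {r : G} (h : NC E z r) :
    ∃ B ≤ E, Nat.card B = 4 ∧ (∀ y ∈ B, y * y = 1) ∧
      (∀ y, y ∈ B ↔ y = 1 ∨ y = z ∨ y = r ∨ y = r * z) := by
  have hz := hE.zc
  have zi : z⁻¹ = z := inv_eq_of_mul_eq_one_left hE.zz
  have ri : r⁻¹ = r := inv_eq_of_mul_eq_one_left h.sq
  let B0 := adj (⊥ : Subgroup G) z (by rw [hE.zz]; exact Subgroup.one_mem _)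
    (by intro b hb; rw [Subgroup.mem_bot.mp hb]; simp)
  have m0 : ∀ y, y ∈ B0 ↔ y = 1 ∨ y = z := by
    intro y
    simp only [B0, mem_adj, Subgroup.mem_bot]
    rw [mul_eq_one_iff_eq_inv, zi]
  have c0 : Nat.card B0 = 2 := by
    rw [card_adj]
    · simp
    · simpa using hE.z1
  have s0 : ∀ y ∈ B0, y * y = 1 := adj_sq (by simp) hE.zz
  let B := adj B0 r (by rw [h.sq]; exact Subgroup.one_mem _)
    (by
      intro b hb
      rcases (m0 b).1 hb with rfl | rfl
      · simp
      · exact (hz r).symm)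
  refine ⟨B, ?_, ?_, ?_, ?_⟩
  · exact adj_le (adj_le bot_le hE.zE) h.mem
  · rw [card_adj, c0]
    rw [m0]; exact fun hh => hh.elim h.ne1 h.nez
  · exact adj_sq s0 h.sq
  · intro y
    simp only [B, mem_adj, m0]
    rw [mul_eq_one_iff_eq_inv, ← eq_mul_inv_iff_mul_eq, ri, ← hz r]
    tauto

theorem exB2 (hE : ESet E z) {r s : G} (h : NC E z r) (hs : NC E z s) (hrs : r * s = s * r)
    (h1 : s ≠ r) (h2 : s ≠ r * z) :
    ∃ B ≤ E, Nat.card B = 8 ∧ (∀ y ∈ B, y * y = 1) ∧ r ∈ B ∧ s ∈ B ∧ z ∈ B ∧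
      (∀ x, x * r = r * x → x * s = s * x → ∀ b ∈ B, b * x = x * b) := by
  obtain ⟨B1, hB1, c1, s1, m1⟩ := exB1 hE h
  have hz := hE.zc
  let B := adj B1 s (by rw [hs.sq]; exact Subgroup.one_mem _)
    (by
      intro b hb
      rcases (m1 b).1 hb with rfl | rfl | rfl | rfl
      · simp
      · exact (hz s).symm
      · exact hrs
      · rw [mul_assoc, ← hz s, ← mul_assoc, hrs, mul_assoc])
  have hsB : s ∈ B := self_mem_adj
  refine ⟨B, adj_le hB1 hs.mem, ?_, adj_sq s1 hs.sq, le_adj ((m1 _).2 (by tauto)), hsB,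
    le_adj ((m1 _).2 (by tauto)), ?_⟩
  · rw [card_adj, c1]
    rw [m1]
    have := hs.ne1
    have := hs.nez
    tauto
  · intro x hxr hxs
    have hle : B ≤ cz ⊤ x := by
      refine adj_le ?_ ⟨trivial, hxs.symm⟩
      intro y hy
      refine ⟨trivial, ?_⟩
      rcases (m1 y).1 hy with rfl | rfl | rfl | rfl
      · simp
      · exact (hz x).symm
      · exact hxr.symm
      · rw [mul_assoc, ← hz x, ← mul_assoc, ← hxr, mul_assoc]
    intro b hb
    exact (hle hb).2

theorem exists_notMem_of_card [Finite G] {K D : Subgroup G} (h : Nat.card K < Nat.card D) :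
    ∃ x ∈ D, x ∉ K := by
  by_contra! hc
  have : Nat.card D ≤ Nat.card K := Nat.card_le_card_of_injective _ (Subgroup.inclusion_injective hc)
  omega

theorem exs [Finite G] (hE : ESet E z) {r : G} (h : NC E z r) :
    ∃ s, NC E z s ∧ r * s = s * r ∧ s ≠ r ∧ s ≠ r * z := by
  obtain ⟨B1, hB1, c1, s1, m1⟩ := exB1 hE h
  obtain ⟨e, he, hn⟩ := h.ex hE
  have hz := hE.zc
  have cD := card_cz hE le_rfl h.mem he hn
  rw [hE.card] at cD
  have fin : ∀ s ∈ cz E r, s * s = 1 → s ∉ B1 →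
      ∃ s, NC E z s ∧ r * s = s * r ∧ s ≠ r ∧ s ≠ r * z := by
    intro s hs hss hn
    rw [m1] at hn
    push Not at hn
    exact ⟨s, ⟨hs.1, hss, hn.1, hn.2.1⟩, hs.2.symm, hn.2.2.1, hn.2.2.2⟩
  obtain ⟨x, hx, hxB⟩ := exists_notMem_of_card (K := B1) (D := cz E r) (by omega)
  by_cases hxx : x * x = 1
  · exact fin x hx hxx hxB
  have hxz := (hE.sq x hx.1).resolve_left hxx
  let B' := adj B1 x (by rw [hxz, m1]; tauto)
    (by
      intro b hb
      rcases (m1 b).1 hb with rfl | rfl | rfl | rfl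
      · simp
      · exact (hz x).symm
      · exact hx.2.symm
      · rw [mul_assoc, ← hz x, ← mul_assoc, ← hx.2, mul_assoc])
  have cB' : Nat.card B' = 8 := by rw [card_adj hxB, c1]
  have cC : 32 ≤ Nat.card (cz (cz E r) x) := by
    by_cases hall : ∀ y ∈ cz E r, y * x = x * y
    · have : cz E r ≤ cz (cz E r) x := fun y hy => ⟨hy, hall y hy⟩
      have := Subgroup.card_le_of_le this
      omega
    · push Not at hall
      obtain ⟨y, hy, hyn⟩ := hall
      have := card_cz hE (cz_le E r) hx.1 hy hyn
      omega
  obtain ⟨y, hy, hyB⟩ := exists_notMem_of_card (K := B') (D := cz (cz E r) x) (by omega)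
  by_cases hyy : y * y = 1
  · exact fin y hy.1 hyy (fun h => hyB (le_adj h))
  have hyz := (hE.sq y hy.1.1).resolve_left hyy
  refine fin (y * x) ((cz E r).mul_mem hy.1 hx) ?_ (fun h => hyB (Or.inr h))
  calc y * x * (y * x) = y * (x * y) * x := by group
    _ = (y * y) * (x * x) := by rw [← hy.2]; group
    _ = 1 := by rw [hyz, hxz, hE.zz]

/-- number of solutions of `t² = 1` in `D`. -/
noncomputable def sqc (D : Subgroup G) : ℕ := {t | t ∈ D ∧ t * t = 1}.ncard

theorem sqc_step [Finite G] (hE : ESet E z) {D : Subgroup G} (hD : D ≤ E) {x e : G} (hx : x ∈ D)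
    (hxx : x * x = 1) (he : e ∈ D) (hn : e * x ≠ x * e) :
    2 * sqc D = 2 * sqc (cz D x) + Nat.card (cz D x) := by
  have hc := card_cz hE hD (hD hx) he hn
  set C := cz D x with hC
  let X1 : Set G := {t | t ∈ D ∧ t ∉ C ∧ t * t = 1}
  let X2 : Set G := {t | t ∈ D ∧ t ∉ C ∧ t * t ≠ 1}
  have hz := hE.zc
  have key : ∀ t ∈ D, t ∉ C → (t * x) ∈ D ∧ t * x ∉ C ∧ t * x * (t * x) = t * t * z := by
    intro t ht htC
    have htx : t * x ≠ x * t := fun h => htC ⟨ht, h⟩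
    have h1 := (hE.comm t (hD ht) x (hD hx)).resolve_left htx
    refine ⟨D.mul_mem ht hx, fun h => htx ?_, ?_⟩
    · have h2 := h.2
      have : t * x * x = x * t * x := by rw [h2]; group
      exact mul_right_cancel this
    · have h3 : x * t = t * x * z := by rw [h1, mul_assoc, hE.zz, mul_one]
      calc t * x * (t * x) = t * (x * t) * x := by group
        _ = t * t * (x * (z * x)) := by rw [h3]; group
        _ = t * t * z * (x * x) := by
          rw [← hz x, ← mul_assoc x, hz (x * x)]; group
        _ = _ := by rw [hxx, mul_one]
  have h12 : X2 = (fun t => t * x) '' X1 := by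
    ext t
    constructor
    · rintro ⟨h1, h2, h3⟩
      obtain ⟨k1, k2, k3⟩ := key t h1 h2
      refine ⟨t * x, ⟨k1, k2, ?_⟩, ?_⟩
      · rw [k3, (hE.sq t (hD h1)).resolve_left h3, hE.zz]
      · simp [mul_assoc, hxx]
    · rintro ⟨u, ⟨h1, h2, h3⟩, rfl⟩
      obtain ⟨k1, k2, k3⟩ := key u h1 h2
      refine ⟨k1, k2, ?_⟩
      simp only
      rw [k3, h3, one_mul]; exact hE.z1
  have n12 : X2.ncard = X1.ncard := by
    rw [h12, Set.ncard_image_of_injective _ (mul_left_injective x)]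
  have nD : (D : Set G).ncard = (C : Set G).ncard + (X1.ncard + X2.ncard) := by
    rw [← Set.ncard_union_eq, ← Set.ncard_union_eq]
    · congr 1
      ext t
      simp only [SetLike.mem_coe, Set.mem_union, X1, X2, Set.mem_ofPred_eq]
      have : t ∈ C → t ∈ D := fun h => h.1
      tauto
    · rw [Set.disjoint_left]
      rintro t ht (h | h)
      · exact h.2.1 ht
      · exact h.2.1 ht
    · rw [Set.disjoint_left]
      rintro t h h'
      exact h'.2.2 h.2.2
  have nS : sqc D = sqc C + X1.ncard := by
    unfold sqc
    rw [← Set.ncard_union_eq]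
    · congr 1
      ext t
      simp only [Set.mem_union, X1, Set.mem_ofPred_eq]
      have : t ∈ C → t ∈ D := fun h => h.1
      tauto
    · rw [Set.disjoint_left]
      rintro t ht h
      exact h.2.1 ht.1
  rw [← Nat.card_coe_set_eq, ← Nat.card_coe_set_eq] at nD
  simp only [SetLike.coe_sort_coe] at nD
  omega

/-- all the facts we need about two commuting independent noncentral involutions -/
theorem pair_facts [Finite G] (hE : ESet E z) {r s : G} (h : NC E z r) (hs : NC E z s)
    (hrs : r * s = s * r) (h1 : s ≠ r) (h2 : s ≠ r * z) :
    (∃ e ∈ cz E r, e * s ≠ s * e) ∧ Nat.card (cz E r) = 64 ∧ Nat.card (cz (cz E r) s) = 32 ∧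
    sqc E = 56 ∧ sqc (cz E r) = 24 ∧
    (∃ x ∈ cz (cz E r) s, ∃ y ∈ cz (cz E r) s, x * y = y * x * z) := by
  obtain ⟨e, he, hn⟩ := h.ex hE
  have cD := card_cz hE le_rfl h.mem he hn
  have qD := sqc_step hE le_rfl h.mem h.sq he hn
  rw [hE.card] at cD
  have hsD : s ∈ cz E r := ⟨hs.mem, hrs.symm⟩
  have hf : ∃ f ∈ cz E r, f * s ≠ s * f := by
    by_contra! hc
    rcases dcent hE h.mem hs.mem he hn (fun x hx hxr => hc x ⟨hx, hxr⟩) with k | k | k | k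
    · exact hs.ne1 k
    · exact hs.nez k
    · exact h1 k
    · exact h2 k
  obtain ⟨f, hfD, hfn⟩ := hf
  have cF := card_cz hE (cz_le E r) hs.mem hfD hfn
  have qF := sqc_step hE (cz_le E r) hsD hs.sq hfD hfn
  have q8 : sqc (cz (cz E r) s) = 8 := by
    obtain ⟨B, hB, cB, sB, rB, sBm, zB, hcB⟩ := exB2 hE h hs hrs h1 h2
    have : {t | t ∈ cz (cz E r) s ∧ t * t = 1} = (B : Set G) := by
      ext t
      constructor
      · rintro ⟨ht, htt⟩
        exact mem_of_comm hE hB sB cB ht.1.1 htt (hcB t ht.1.2 ht.2)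
      · intro ht
        have k := fun b hb => hcB r rfl hrs b hb
        have k' := fun b hb => hcB s hrs.symm rfl b hb
        exact ⟨⟨⟨hB ht, k t ht⟩, k' t ht⟩, sB t ht⟩
    unfold sqc
    rw [this, ← Nat.card_coe_set_eq]
    exact cB
  refine ⟨⟨f, hfD, hfn⟩, by omega, by omega, by omega, by omega, ?_⟩
  obtain ⟨x, hx, y, hy, hxy⟩ := nonab hE (C := cz (cz E r) s) (fun t ht => ht.1.1) (by omega)
  exact ⟨x, hx, y, hy, (hE.comm x hx.1.1 y hy.1.1).resolve_left hxy⟩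

end F2Aux

namespace F2Aux

variable {G : Type*} [Group G] {E : Subgroup G} {z : G}
variable {V : Type*} [AddCommGroup V] [DistribMulAction G V]

/-- fixed points of `t` in `W` -/
def fixS (W : AddSubgroup V) (t : G) : AddSubgroup V where
  carrier := {w | w ∈ W ∧ t • w = w}
  zero_mem' := ⟨W.zero_mem, by simp⟩
  add_mem' := by
    rintro a b ⟨ha, ha'⟩ ⟨hb, hb'⟩
    exact ⟨W.add_mem ha hb, by rw [smul_add, ha', hb']⟩
  neg_mem' := by
    rintro a ⟨ha, ha'⟩
    exact ⟨W.neg_mem ha, by rw [smul_neg, ha']⟩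

/-- inverted points of `t` in `W` -/
def negS (W : AddSubgroup V) (t : G) : AddSubgroup V where
  carrier := {w | w ∈ W ∧ t • w = -w}
  zero_mem' := ⟨W.zero_mem, by simp⟩
  add_mem' := by
    rintro a b ⟨ha, ha'⟩ ⟨hb, hb'⟩
    exact ⟨W.add_mem ha hb, by rw [smul_add, ha', hb']; abel⟩
  neg_mem' := by
    rintro a ⟨ha, ha'⟩
    exact ⟨W.neg_mem ha, by rw [smul_neg, ha']⟩

theorem mem_fixS {W : AddSubgroup V} {t : G} {w : V} : w ∈ fixS W t ↔ w ∈ W ∧ t • w = w := Iff.rfl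
theorem mem_negS {W : AddSubgroup V} {t : G} {w : V} : w ∈ negS W t ↔ w ∈ W ∧ t • w = -w := Iff.rfl

theorem card_eig (h3 : ∀ v : V, v + v + v = 0) (W : AddSubgroup V) (t : G) (ht : t * t = 1)
    (hW : ∀ w ∈ W, t • w ∈ W) : Nat.card W = Nat.card (fixS W t) * Nat.card (negS W t) := by
  rw [← Nat.card_prod]
  have htt : ∀ w : V, t • t • w = w := fun w => by rw [smul_smul, ht, one_smul]
  refine Nat.card_congr
    { toFun := fun w => (⟨w + t • (w : V), W.add_mem w.2 (hW _ w.2), ?_⟩,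
        ⟨w - t • (w : V), W.sub_mem w.2 (hW _ w.2), ?_⟩)
      invFun := fun p => ⟨-(p.1 + p.2 : V), W.neg_mem (W.add_mem p.1.2.1 p.2.2.1)⟩
      left_inv := ?_
      right_inv := ?_ }
  · rw [smul_add, htt, add_comm]
  · rw [smul_sub, htt]; abel
  · intro w
    ext
    simp only
    have := h3 (w : V)
    have h2 : (w : V) + w = -w := by rw [eq_neg_iff_add_eq_zero]; exact this
    rw [add_add_sub_cancel, h2, neg_neg]
  · rintro ⟨⟨a, ha, ha'⟩, ⟨b, hb, hb'⟩⟩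
    have ea : -a + -a = a := by
      rw [← sub_eq_zero, ← neg_eq_zero, ← h3 a]; abel
    have eb : -b + -b = b := by
      rw [← sub_eq_zero, ← neg_eq_zero, ← h3 b]; abel
    ext
    · simp only [smul_neg, smul_add, ha', hb']
      calc -(a + b) + -(a + -b) = -a + -a := by abel
        _ = _ := ea
    · simp only [smul_neg, smul_add, ha', hb']
      calc -(a + b) - -(a + -b) = -b + -b := by abel
        _ = _ := eb

theorem card_swap [Finite V] (hE : ESet E z) (W : AddSubgroup V) (t e : G)
    (hz : ∀ w ∈ W, z • w = -w) (het : e * t = t * e * z)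
    (hW : ∀ w ∈ W, e • w ∈ W) : Nat.card (fixS W t) = Nat.card (negS W t) := by
  have hte : t * e = e * t * z := by rw [het, mul_assoc, hE.zz, mul_one]
  apply le_antisymm
  · refine Nat.card_le_card_of_injective
      (fun w : fixS W t => (⟨e • (w : V), hW _ w.2.1, ?_⟩ : negS W t)) ?_
    · rw [smul_smul, hte, mul_assoc, mul_smul, mul_smul, hz _ w.2.1, smul_neg, w.2.2, smul_neg]
    · intro a b hab
      exact Subtype.ext (smul_left_cancel e (congrArg Subtype.val hab))
  · refine Nat.card_le_card_of_injective
      (fun w : negS W t => (⟨e • (w : V), hW _ w.2.1, ?_⟩ : fixS W t)) ?_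
    · rw [smul_smul, hte, mul_assoc, mul_smul, mul_smul, hz _ w.2.1, smul_neg, w.2.2, neg_neg]
    · intro a b hab
      exact Subtype.ext (smul_left_cancel e (congrArg Subtype.val hab))

/-- analysis of the `z = -1` part of the module -/
theorem chain_cards [Finite G] [Finite V] (hE : ESet E z) (h3 : ∀ v : V, v + v + v = 0)
    (W : AddSubgroup V) (hz : ∀ w ∈ W, z • w = -w) (hWE : ∀ e ∈ E, ∀ w ∈ W, e • w ∈ W)
    {r s : G} (h : NC E z r) (hs : NC E z s)
    (hrs : r * s = s * r) (h1 : s ≠ r) (h2 : s ≠ r * z) :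
    Nat.card W = Nat.card (fixS W r) ^ 2 ∧
      Nat.card (fixS W r) = Nat.card (fixS (fixS W r) s) ^ 2 := by
  obtain ⟨⟨f, hf, hfn⟩, -⟩ := pair_facts hE h hs hrs h1 h2
  obtain ⟨e, he, hn⟩ := h.ex hE
  constructor
  · rw [card_eig h3 W r h.sq (hWE r h.mem), ← card_swap hE W r e hz
      ((hE.comm e he r h.mem).resolve_left hn) (hWE e he), sq]
  · rw [card_eig h3 (fixS W r) s hs.sq, ← card_swap hE (fixS W r) s f (fun w hw => hz w hw.1)
      ((hE.comm f hf.1 s hs.mem).resolve_left hfn), sq]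
    · rintro w ⟨hw, hw'⟩
      refine ⟨hWE f hf.1 w hw, ?_⟩
      rw [smul_smul, ← hf.2, mul_smul, hw']
    · rintro w ⟨hw, hw'⟩
      refine ⟨hWE s hs.mem w hw, ?_⟩
      rw [smul_smul, hrs, mul_smul, hw']

/-- the module hypotheses -/
structure VSet (G V : Type*) [Group G] [AddCommGroup V] [DistribMulAction G V] : Prop where
  three : ∀ v : V, v + v + v = 0
  card : Nat.card V = 3 ^ 8
  faith : ∀ g : G, (∀ v : V, g • v = v) → g = 1

theorem eq_zero_of_neg_eq (h3 : ∀ v : V, v + v + v = 0) {v : V} (h : -v = v) : v = 0 := by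
  have := h3 v
  nth_rw 1 [← h] at this
  simpa using this

theorem z_neg [Finite G] [Finite V] (hE : ESet E z) (hV : VSet G V) {r : G} (h : NC E z r) :
    ∀ v : V, z • v = -v := by
  obtain ⟨s, hs, hrs, h1, h2⟩ := exs hE h
  obtain ⟨-, -, -, -, -, ⟨x, hx, y, hy, hxy⟩⟩ := pair_facts hE h hs hrs h1 h2
  let W : AddSubgroup V := negS ⊤ z
  have hWE : ∀ e ∈ E, ∀ w ∈ W, e • w ∈ W := by
    rintro e - w ⟨-, hw⟩
    refine ⟨trivial, ?_⟩
    rw [smul_smul, ← hE.zc, mul_smul, hw, smul_neg]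
  obtain ⟨k1, k2⟩ := chain_cards hE hV.three W (fun w hw => hw.2) hWE h hs hrs h1 h2
  set U := fixS (fixS W r) s with hU
  have hWne : Nat.card W ≠ 1 := by
    intro hc
    apply hE.z1
    apply hV.faith
    intro v
    have hm : v - z • v ∈ W := by
      refine ⟨trivial, ?_⟩
      rw [smul_sub, smul_smul, hE.zz, one_smul, neg_sub]
    have := (AddSubgroup.card_eq_one.1 hc) ▸ hm
    rw [AddSubgroup.mem_bot, sub_eq_zero] at this
    exact this.symm
  have hdiv : Nat.card U ∣ 3 ^ 8 := hV.card ▸ AddSubgroup.card_addSubgroup_dvd_card U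
  obtain ⟨k, hk, hUk⟩ := (Nat.dvd_prime_pow Nat.prime_three).1 hdiv
  have hU2 : ∀ g ∈ cz (cz E r) s, ∀ w ∈ U, g • w ∈ U := by
    rintro g ⟨⟨hg, hgr⟩, hgs⟩ w ⟨⟨hw, hwr⟩, hws⟩
    refine ⟨⟨hWE g hg w hw, ?_⟩, ?_⟩
    · rw [smul_smul, ← hgr, mul_smul, hwr]
    · rw [smul_smul, ← hgs, mul_smul, hws]
  have hk2 : 2 ≤ k := by
    by_contra hlt
    have : k = 0 ∨ k = 1 := by omega
    rcases this with rfl | rfl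
    · apply hWne
      rw [k1, k2, hUk]; norm_num
    · -- order three: everything acts as a sign
      have hne : Nat.card U ≠ 1 := by rw [hUk]; norm_num
      have hbot : U ≠ ⊥ := fun hb => hne (by rw [hb]; simp)
      obtain ⟨w, hw, hw0⟩ := (AddSubgroup.bot_or_exists_ne_zero U).resolve_left hbot
      have hww : -w ≠ w := fun h => hw0 (eq_zero_of_neg_eq hV.three h)
      have h3 : ∀ u ∈ U, u = 0 ∨ u = w ∨ u = -w := by
        have hss : ({0, w, -w} : Set V) ⊆ U := by
          rintro u (rfl | rfl | rfl)
          · exact U.zero_mem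
          · exact hw
          · exact U.neg_mem hw
        have hcard : ({0, w, -w} : Set V).ncard = 3 := by
          rw [Set.ncard_eq_three]
          refine ⟨0, w, -w, hw0.symm, ?_, hww.symm, rfl⟩
          intro h; exact hw0 (by rw [← neg_neg w, ← h, neg_zero])
        have := Set.eq_of_subset_of_ncard_le hss (by
          rw [hcard, ← Nat.card_coe_set_eq]; simp only [SetLike.coe_sort_coe]; rw [hUk]; norm_num)
        intro u hu
        have hu' : u ∈ (U : Set V) := hu
        rw [← this] at hu'
        exact hu'
      have sgn : ∀ g ∈ cz (cz E r) s, g • w = w ∨ g • w = -w := by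
        intro g hg
        rcases h3 _ (hU2 g hg w hw) with h | h
        · exact absurd ((smul_eq_zero_iff_eq g).1 h) hw0
        · exact h
      have e1 : (x * y) • w = - ((y * x) • w) := by
        rw [hxy, mul_smul, hw.1.1.2, smul_neg]
      have e2 : (x * y) • w = (y * x) • w := by
        rw [mul_smul, mul_smul]
        rcases sgn x hx with h | h <;> rcases sgn y hy with h' | h' <;> simp [h, h']
      have e3 := eq_zero_of_neg_eq hV.three (e1.symm.trans e2)
      exact hw0 ((smul_eq_zero_iff_eq _).1 e3)
  have hbig : 3 ^ 8 ≤ Nat.card W := by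
    rw [k1, k2, hUk]
    calc 3 ^ 8 = ((3 ^ 2) ^ 2) ^ 2 := by norm_num
      _ ≤ _ := by gcongr; norm_num
  have hT : W = ⊤ := by
    apply AddSubgroup.eq_top_of_le_card
    rw [hV.card]; exact hbig
  intro v
  have : v ∈ W := hT ▸ AddSubgroup.mem_top v
  exact this.2

theorem cards_V [Finite G] [Finite V] (hE : ESet E z) (hV : VSet G V) {r s : G} (h : NC E z r)
    (hs : NC E z s) (hrs : r * s = s * r) (h1 : s ≠ r) (h2 : s ≠ r * z) :
    Nat.card (fixS (⊤ : AddSubgroup V) r) = 81 ∧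
      Nat.card (fixS (fixS (⊤ : AddSubgroup V) r) s) = 9 := by
  obtain ⟨k1, k2⟩ := chain_cards hE hV.three (⊤ : AddSubgroup V)
    (fun w _ => z_neg hE hV h w) (fun _ _ _ _ => trivial) h hs hrs h1 h2
  rw [AddSubgroup.card_top, hV.card] at k1
  have k3 : Nat.card (fixS (⊤ : AddSubgroup V) r) = 81 :=
    Nat.pow_left_injective (n := 2) (by norm_num) (by simp only; rw [← k1]; norm_num)
  refine ⟨k3, Nat.pow_left_injective (n := 2) (by norm_num) (by simp only; rw [← k2, k3])⟩

end F2Aux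

namespace F2Aux

variable {G : Type*} [Group G] {E : Subgroup G} {z : G}
variable {V : Type*} [AddCommGroup V] [DistribMulAction G V]

/-- stabilizer of `w` in `E` -/
def stE (E : Subgroup G) (w : V) : Subgroup G := E ⊓ MulAction.stabilizer G w

theorem mem_stE {w : V} {t : G} : t ∈ stE E w ↔ t ∈ E ∧ t • w = w := by
  simp [stE, Subgroup.mem_inf, MulAction.mem_stabilizer_iff]

theorem stE_facts [Finite G] [Finite V] (hE : ESet E z) (hV : VSet G V) {r : G} (h : NC E z r)
    {w : V} (hw : w ≠ 0) :
    (∀ t ∈ stE E w, t * t = 1) ∧ z ∉ stE E w ∧ Nat.card (stE E w) ≤ 4 := by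
  have hz := z_neg (V := V) hE hV h w
  have hzn : z ∉ stE E w := by
    rw [mem_stE]
    rintro ⟨-, hh⟩
    rw [hz] at hh
    exact hw (eq_zero_of_neg_eq hV.three hh)
  have hsq : ∀ t ∈ stE E w, t * t = 1 := by
    intro t ht
    rcases hE.sq t (mem_stE.1 ht).1 with h | h
    · exact h
    · exact absurd (h ▸ (stE E w).mul_mem ht ht) hzn
  refine ⟨hsq, hzn, ?_⟩
  have := hE.ab8 (adj (stE E w) z (by rw [hE.zz]; exact Subgroup.one_mem _)
    (fun b _ => hE.zc b)) (adj_le inf_le_left hE.zE) (adj_sq hsq hE.zz)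
  rw [card_adj hzn] at this
  omega

open Finset in
theorem card_stE [Finite G] [Finite V] (hE : ESet E z) (hV : VSet G V) {r : G} (h : NC E z r)
    {v : V} (hv : v ≠ 0) (hrv : r • v = v) : Nat.card (stE E v) = 4 := by
  classical
  have := Fintype.ofFinite G
  have := Fintype.ofFinite V
  obtain ⟨B1, hB1, c1, s1, m1⟩ := exB1 hE h
  have hz := hE.zc
  let T : Finset G := univ.filter (fun t => (t ∈ cz E r ∧ t * t = 1) ∧ t ∉ B1)
  let W : Finset V := univ.filter (fun w => w ≠ 0 ∧ r • w = w)
  have hT : T.card = 20 := by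
    obtain ⟨s, hs, hrs, h1, h2⟩ := exs hE h
    obtain ⟨-, -, -, -, q, -⟩ := pair_facts hE h hs hrs h1 h2
    have e1 : T = (univ.filter (fun t => (t ∈ cz E r ∧ t * t = 1))) \
        (univ.filter (fun t => t ∈ B1)) := by
      ext t; simp [T]
    have e2 : (univ.filter (fun t => (t ∈ cz E r ∧ t * t = 1))).card = 24 := by
      rw [← q, sqc, Set.ncard_eq_toFinset_card']
      congr 1; ext t; simp
    have e3 : (univ.filter (fun t => t ∈ B1)).card = 4 := by
      rw [← c1, Nat.card_eq_fintype_card, Fintype.card_subtype]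
    rw [e1, card_sdiff_of_subset, e2, e3]
    intro t
    simp only [mem_filter, mem_univ, true_and]
    intro ht
    refine ⟨⟨hB1 ht, ?_⟩, s1 t ht⟩
    rcases (m1 t).1 ht with rfl | rfl | rfl | rfl
    · simp
    · exact (hz r).symm
    · rfl
    · rw [mul_assoc, ← hz r]
  have hfix : ∀ U : AddSubgroup V, (univ.filter (fun w => w ≠ 0 ∧ w ∈ U)).card = Nat.card U - 1 := by
    intro U
    have : (univ.filter (fun w => w ≠ 0 ∧ w ∈ U)) = (univ.filter (fun w => w ∈ U)).erase 0 := by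
      ext w; simp
    rw [this, card_erase_of_mem (by simp), Nat.card_eq_fintype_card, Fintype.card_subtype]
  have hW : W.card = 80 := by
    obtain ⟨s, hs, hrs, h1, h2⟩ := exs hE h
    obtain ⟨q, -⟩ := cards_V (V := V) hE hV h hs hrs h1 h2
    have := hfix (fixS ⊤ r)
    rw [q] at this
    refine Eq.trans ?_ this
    congr 1; ext w; simp [W, mem_fixS]
  have hcol : ∀ t ∈ T, (W.bipartiteBelow (fun (w : V) (t : G) => t • w = w) t).card = 8 := by
    intro t ht
    simp only [T, mem_filter, mem_univ, true_and, m1] at ht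
    push Not at ht
    obtain ⟨⟨⟨k1, k2⟩, k3⟩, k4, k5, k6, k7⟩ := ht
    obtain ⟨-, q⟩ := cards_V (V := V) hE hV h ⟨k1, k3, k4, k5⟩ k2.symm k6 k7
    have := hfix (fixS (fixS ⊤ r) t)
    rw [q] at this
    refine Eq.trans ?_ this
    congr 1; ext w; simp [W, mem_fixS, bipartiteBelow, and_assoc]
  have hrow : ∀ w ∈ W, (T.bipartiteAbove (fun (w : V) (t : G) => t • w = w) w).card + 2 ≤
      Nat.card (stE E w) := by
    intro w hw
    simp only [W, mem_filter, mem_univ, true_and] at hw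
    have e : Nat.card (stE E w) = (univ.filter (fun t => t ∈ stE E w)).card := by
      rw [Nat.card_eq_fintype_card, Fintype.card_subtype]
    have e2 : ({1, r} : Finset G).card = 2 := by
      rw [card_pair h.ne1.symm]
    rw [e, ← e2, ← card_union_of_disjoint]
    · apply card_le_card
      intro t
      simp only [mem_union, bipartiteAbove, mem_filter, T, mem_univ, true_and, mem_insert,
        mem_singleton, mem_stE]
      rintro (⟨⟨⟨k, -⟩, -⟩, k'⟩ | rfl | rfl)
      · exact ⟨k.1, k'⟩
      · exact ⟨E.one_mem, by simp⟩
      · exact ⟨h.mem, hw.2⟩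
    · rw [disjoint_left]
      intro t
      simp only [bipartiteAbove, mem_filter, T, mem_univ, true_and, mem_insert, mem_singleton, m1]
      tauto
  have hsum := sum_card_bipartiteAbove_eq_sum_card_bipartiteBelow
    (s := W) (t := T) (fun (w : V) (t : G) => t • w = w)
  rw [sum_congr rfl hcol, sum_const, hT] at hsum
  have hvW : v ∈ W := by simp [W, hv, hrv]
  rw [← add_sum_erase _ _ hvW] at hsum
  have hle : ∑ w ∈ W.erase v, (T.bipartiteAbove (fun (w : V) (t : G) => t • w = w) w).card ≤
      ∑ w ∈ W.erase v, 2 := by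
    apply sum_le_sum
    intro w hw
    have hw' := mem_of_mem_erase hw
    have k := hrow w hw'
    have := (stE_facts hE hV h (w := w) (by simp [W] at hw'; exact hw'.1)).2.2
    omega
  rw [sum_const, card_erase_of_mem hvW, hW] at hle
  have k := hrow v hvW
  have := (stE_facts hE hV h hv).2.2
  simp only [smul_eq_mul] at *
  omega

open Finset in
theorem card_orbit_le [Finite G] [Finite V] (hE : ESet E z) (hV : VSet G V) (hN : E.Normal)
    {r : G} (h : NC E z r)
    {v : V} (hv : v ≠ 0) (hrv : r • v = v) : Nat.card (MulAction.orbit G v) ≤ 1440 := by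
  classical
  have := Fintype.ofFinite G
  have := Fintype.ofFinite V
  let T : Finset G := univ.filter (fun t => NC E z t)
  let O : Finset V := univ.filter (fun w => w ∈ MulAction.orbit G v)
  have hO : O.card = Nat.card (MulAction.orbit G v) := by
    rw [Nat.card_eq_fintype_card, ← Set.toFinset_card]
    congr 1; ext w; simp [O]
  have hT : T.card = 54 := by
    obtain ⟨s, hs, hrs, h1, h2⟩ := exs hE h
    obtain ⟨-, -, -, q, -, -⟩ := pair_facts hE h hs hrs h1 h2
    have e1 : T = (univ.filter (fun t => (t ∈ E ∧ t * t = 1))) \ {1, z} := by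
      ext t; simp only [T, mem_filter, mem_univ, true_and, mem_sdiff, mem_insert, mem_singleton]
      constructor
      · rintro ⟨k1, k2, k3, k4⟩; tauto
      · rintro ⟨⟨k1, k2⟩, k3⟩; push Not at k3; exact ⟨k1, k2, k3.1, k3.2⟩
    have e2 : (univ.filter (fun t => (t ∈ E ∧ t * t = 1))).card = 56 := by
      rw [← q, sqc, Set.ncard_eq_toFinset_card']
      congr 1; ext t; simp
    rw [e1, card_sdiff_of_subset, e2, card_pair hE.z1.symm]
    intro t
    simp only [mem_filter, mem_univ, true_and, mem_insert, mem_singleton]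
    rintro (rfl | rfl)
    · exact ⟨E.one_mem, by simp⟩
    · exact ⟨hE.zE, hE.zz⟩
  have hOf : ∀ w ∈ O, w ≠ 0 ∧ ∃ t, NC E z t ∧ t • w = w := by
    intro w hw
    simp only [O, mem_filter, mem_univ, true_and] at hw
    obtain ⟨g, rfl⟩ := hw
    refine ⟨fun hh => hv ((smul_eq_zero_iff_eq g).1 hh), g * r * g⁻¹, ⟨hN.conj_mem r h.mem g, ?_, ?_, ?_⟩, ?_⟩
    · calc g * r * g⁻¹ * (g * r * g⁻¹) = g * (r * r) * g⁻¹ := by group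
        _ = 1 := by rw [h.sq]; group
    · rw [Ne, conj_eq_one_iff]; exact h.ne1
    · intro hh
      apply h.nez
      rw [mul_inv_eq_iff_eq_mul, ← hE.zc] at hh
      exact mul_left_cancel hh
    · simp only [mul_smul, inv_smul_smul, hrv]
  have hrow : ∀ w ∈ O, 3 ≤ (T.bipartiteAbove (fun (w : V) (t : G) => t • w = w) w).card := by
    intro w hw
    obtain ⟨hw0, t, ht, htw⟩ := hOf w hw
    have hc := card_stE hE hV ht hw0 htw
    obtain ⟨k1, k2, -⟩ := stE_facts hE hV ht hw0
    have e : (T.bipartiteAbove (fun (w : V) (t : G) => t • w = w) w) =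
        (univ.filter (fun t => t ∈ stE E w)).erase 1 := by
      ext t
      simp only [bipartiteAbove, mem_filter, T, mem_univ, true_and, mem_erase]
      constructor
      · rintro ⟨k, k'⟩; exact ⟨k.ne1, mem_stE.2 ⟨k.mem, k'⟩⟩
      · rintro ⟨k, k'⟩
        exact ⟨⟨(mem_stE.1 k').1, k1 t k', k, fun hh => k2 (hh ▸ k')⟩, (mem_stE.1 k').2⟩
    rw [Nat.card_eq_fintype_card, Fintype.card_subtype] at hc
    rw [e, card_erase_of_mem (by simp), hc]
  have hcol : ∀ t ∈ T, (O.bipartiteBelow (fun (w : V) (t : G) => t • w = w) t).card ≤ 80 := by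
    intro t ht
    simp only [T, mem_filter, mem_univ, true_and] at ht
    obtain ⟨s, hs, hrs, h1, h2⟩ := exs hE ht
    obtain ⟨q, -⟩ := cards_V (V := V) hE hV ht hs hrs h1 h2
    rw [Nat.card_eq_fintype_card, Fintype.card_subtype] at q
    have : O.bipartiteBelow (fun (w : V) (t : G) => t • w = w) t ⊆
        (univ.filter (fun w => w ∈ fixS (⊤ : AddSubgroup V) t)).erase 0 := by
      intro w hw
      simp only [bipartiteBelow, mem_filter] at hw
      simp only [mem_erase, mem_filter, mem_univ, true_and]
      exact ⟨(hOf w hw.1).1, trivial, hw.2⟩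
    have := card_le_card this
    rw [card_erase_of_mem (by simp), q] at this
    exact this
  have hsum := sum_card_bipartiteAbove_eq_sum_card_bipartiteBelow
    (s := O) (t := T) (fun (w : V) (t : G) => t • w = w)
  have l1 := card_nsmul_le_sum O _ 3 hrow
  have l2 := sum_le_card_nsmul T _ 80 hcol
  rw [hT] at l2
  rw [← hO]
  simp only [smul_eq_mul] at *
  omega

end F2Aux

namespace F2Aux

variable {G : Type*} [Group G] {E : Subgroup G} {z : G}

theorem exHom [Finite G] (S F B : Subgroup G) (hBF : B ≤ F)
    (hFS : ∀ g ∈ S, ∀ x ∈ F, g * x * g⁻¹ ∈ F) (hBS : ∀ g ∈ S, ∀ x ∈ B, g * x * g⁻¹ ∈ B)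
    (hn : ∀ f ∈ F, ∀ b ∈ B, f * b * f⁻¹ ∈ B) (hc : Nat.card F = 4 * Nat.card B) :
    ∃ φ : S →* Equiv.Perm (Fin 3), ∀ g : S, φ g = 1 ↔ ∀ x ∈ F, (g : G) * x * (g : G)⁻¹ * x⁻¹ ∈ B := by
  classical
  let B' : Subgroup F := B.subgroupOf F
  have hB'n : B'.Normal := by
    constructor
    rintro ⟨b, hb⟩ hb' ⟨g, hg⟩
    rw [Subgroup.mem_subgroupOf] at hb' ⊢
    exact hn g hg b hb'
  let c : S → F →* F := fun g =>
    { toFun := fun x => ⟨(g : G) * x * (g : G)⁻¹, hFS g g.2 x x.2⟩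
      map_one' := by ext; simp
      map_mul' := by intro a b; ext; simp }
  have hcB : ∀ g, B' ≤ B'.comap (c g) := by
    intro g x hx
    rw [Subgroup.mem_comap, Subgroup.mem_subgroupOf]
    rw [Subgroup.mem_subgroupOf] at hx
    exact hBS g g.2 x hx
  let m : S → (F ⧸ B') →* (F ⧸ B') := fun g => QuotientGroup.map B' B' (c g) (hcB g)
  have m1 : ∀ q, m 1 q = q := by
    intro q
    induction q using QuotientGroup.induction_on with | H x => ?_
    simp only [m, QuotientGroup.map_mk]
    congr 1
    ext; simp [c]
  have mm : ∀ g h q, m (g * h) q = m g (m h q) := by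
    intro g h q
    induction q using QuotientGroup.induction_on with | H x => ?_
    simp only [m, QuotientGroup.map_mk]
    congr 1
    ext; simp [c, mul_assoc]
  let X := {q : F ⧸ B' // q ≠ 1}
  have hne : ∀ g q, q ≠ 1 → m g q ≠ 1 := by
    intro g q hq h
    apply hq
    rw [← m1 q, ← inv_mul_cancel g, mm, h, map_one]
  let ψ : S →* Equiv.Perm X :=
    { toFun := fun g =>
        { toFun := fun q => ⟨m g q.1, hne g _ q.2⟩
          invFun := fun q => ⟨m g⁻¹ q.1, hne _ _ q.2⟩
          left_inv := by intro q; ext; simp only; rw [← mm, inv_mul_cancel, m1]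
          right_inv := by intro q; ext; simp only; rw [← mm, mul_inv_cancel, m1] }
      map_one' := by ext q; simp [m1]
      map_mul' := by intro g h; ext q; simp [mm] }
  have hcard : Nat.card X = 3 := by
    have h4 : Nat.card (F ⧸ B') = 4 := by
      have h1 := Subgroup.card_eq_card_quotient_mul_card_subgroup B'
      have h2 : Nat.card B' = Nat.card B := Nat.card_congr (Subgroup.subgroupOfEquivOfLe hBF).toEquiv
      rw [hc, h2] at h1
      exact (Nat.eq_of_mul_eq_mul_right Nat.card_pos h1).symm
    have := Fintype.ofFinite (F ⧸ B')
    rw [Nat.card_eq_fintype_card] at h4 ⊢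
    have := Fintype.card_subtype_compl (fun q : F ⧸ B' => q = 1)
    rw [Fintype.card_subtype_eq, h4] at this
    convert this
  obtain ⟨e⟩ : Nonempty (X ≃ Fin 3) := by
    have := Finite.equivFin X
    rw [hcard] at this
    exact ⟨this⟩
  refine ⟨e.permCongrHom.toMonoidHom.comp ψ, ?_⟩
  intro g
  have hiff : ∀ x : F, m g (x : F ⧸ B') = (x : F ⧸ B') ↔ (g : G) * x * (g : G)⁻¹ * (x : G)⁻¹ ∈ B := by
    intro x
    simp only [m, QuotientGroup.map_mk]
    rw [QuotientGroup.eq_iff_div_mem, Subgroup.mem_subgroupOf]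
    simp [c, div_eq_mul_inv]
  simp only [MonoidHom.comp_apply, MulEquiv.coe_toMonoidHom]
  rw [EmbeddingLike.map_eq_one_iff]
  constructor
  · intro h x hx
    rw [← hiff ⟨x, hx⟩]
    by_cases h1 : ((⟨x, hx⟩ : F) : F ⧸ B') = 1
    · rw [h1, map_one]
    · have := congrArg (fun p : Equiv.Perm X => (p ⟨_, h1⟩).1) h
      exact this
  · intro h
    ext ⟨q, hq⟩
    induction q using QuotientGroup.induction_on with | H x => ?_
    exact (hiff x).2 (h x x.2)

/-- coprime action -/
theorem coprime_fix (hE : ESet E z) {g n x : G} (hn : n ∈ E) (hgn : g * n = n * g)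
    (hgx : g * x = n * x * g) {m : ℕ} (hm : Odd m) (hgm : g ^ m = 1) : g * x = x * g := by
  have hk : ∀ k : ℕ, g ^ k * x = n ^ k * x * g ^ k := by
    intro k
    induction k with
    | zero => simp
    | succ k ih =>
      have hc : Commute g (n ^ k) := (show Commute g n from hgn).pow_right k
      calc g ^ (k + 1) * x = g * (g ^ k * x) := by rw [pow_succ']; group
        _ = (g * n ^ k) * x * g ^ k := by rw [ih]; group
        _ = n ^ k * (g * x) * g ^ k := by rw [hc.eq]; group
        _ = n ^ (k + 1) * x * (g * g ^ k) := by rw [hgx, pow_succ]; group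
        _ = _ := by rw [← pow_succ']
  have h1 := hk m
  rw [hgm, one_mul, mul_one] at h1
  have h2 : n ^ m = 1 := mul_right_cancel (b := x) (by rw [← h1, one_mul])
  have h4 : n ^ 4 = 1 := by
    have : n ^ 4 = (n * n) * (n * n) := by simp only [pow_succ, pow_zero, one_mul, mul_assoc]
    rw [this]
    rcases hE.sq n hn with h | h
    · rw [h, one_mul]
    · rw [h, hE.zz]
  have hn1 : n = 1 := by
    have hco : Nat.Coprime m 4 := by
      have : Nat.Coprime m 2 := Nat.coprime_two_right.2 hm
      exact Nat.Coprime.pow_right 2 this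
    have := Nat.dvd_gcd (orderOf_dvd_of_pow_eq_one h2) (orderOf_dvd_of_pow_eq_one h4)
    rw [hco] at this
    exact orderOf_eq_one_iff.1 (Nat.dvd_one.1 this)
  rw [hgx, hn1, one_mul]

variable {V : Type*} [AddCommGroup V] [DistribMulAction G V]

/-- The centralizer in `E` of the stabilizer of `v` -/
def FF (E : Subgroup G) (v : V) : Subgroup G := E ⊓ Subgroup.centralizer (stE E v)

theorem mem_FF {v : V} {x : G} : x ∈ FF E v ↔ x ∈ E ∧ ∀ a ∈ stE E v, a * x = x * a := by
  simp [FF, Subgroup.mem_centralizer_iff]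

structure Conf (E : Subgroup G) (z : G) (v : V) (B : Subgroup G) : Prop where
  cA : Nat.card (stE E v) = 4
  cB : Nat.card B = 8
  cF : Nat.card (FF E v) = 32
  AB : stE E v ≤ B
  zB : z ∈ B
  BF : B ≤ FF E v
  sqB : ∀ b ∈ B, b * b = 1
  memB : ∀ b ∈ FF E v, b * b = 1 → b ∈ B
  comm : ∀ x ∈ FF E v, ∀ b ∈ B, b * x = x * b
  gen : ∀ g : G, (∀ a ∈ stE E v, g * a = a * g) → ∀ b ∈ B, g * b = b * g
  fix9 : Nat.card {w : V // ∀ a ∈ stE E v, a • w = w} = 9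

theorem conf [Finite G] [Finite V] (hE : ESet E z) (hV : VSet G V) {r : G} (h : NC E z r)
    {v : V} (hv : v ≠ 0) (hrv : r • v = v) : ∃ B, Conf E z v B := by
  have cA := card_stE hE hV h hv hrv
  obtain ⟨sqA, hzA, -⟩ := stE_facts hE hV h hv
  set A := stE E v with hA
  have hrA : r ∈ A := mem_stE.2 ⟨h.mem, hrv⟩
  have hAE : A ≤ E := inf_le_left
  have abA : ∀ a ∈ A, ∀ b ∈ A, a * b = b * a := by
    intro a ha b hb
    have h1 := sqA _ (A.mul_mem ha hb)
    have ai : a⁻¹ = a := inv_eq_of_mul_eq_one_left (sqA a ha)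
    have bi : b⁻¹ = b := inv_eq_of_mul_eq_one_left (sqA b hb)
    have h2 : (a * b)⁻¹ = a * b := inv_eq_of_mul_eq_one_left h1
    rw [mul_inv_rev, ai, bi] at h2
    exact h2.symm
  -- second generator
  let R : Subgroup G := adj ⊥ r (by rw [h.sq]; exact Subgroup.one_mem _)
    (by intro b hb; rw [Subgroup.mem_bot.1 hb]; simp)
  have cR : Nat.card R = 2 := by
    rw [card_adj]
    · simp
    · simpa using h.ne1
  obtain ⟨s, hsA, hsR⟩ := exists_notMem_of_card (K := R) (D := A) (by omega)
  have hs1 : s ≠ 1 := fun hh => hsR (hh ▸ R.one_mem)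
  have hsr : s ≠ r := fun hh => hsR (hh ▸ self_mem_adj)
  have hs : NC E z s := ⟨hAE hsA, sqA s hsA, hs1, fun hh => hzA (hh ▸ hsA)⟩
  have hsrz : s ≠ r * z := by
    intro hh
    apply hzA
    have : z = r⁻¹ * s := by rw [hh]; group
    rw [this]
    exact A.mul_mem (A.inv_mem hrA) hsA
  have hrs := abA r hrA s hsA
  obtain ⟨-, -, cF, -⟩ := pair_facts hE h hs hrs hsr hsrz
  -- A generated by r, s
  let A' : Subgroup G := adj R s (by rw [sqA s hsA]; exact Subgroup.one_mem _) (by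
    rintro b (hb | hb)
    · rw [Subgroup.mem_bot.1 hb]; simp
    · rw [Subgroup.mem_bot] at hb
      have : b = r := by
        rw [mul_eq_one_iff_eq_inv] at hb
        rw [hb, inv_eq_of_mul_eq_one_left h.sq]
      rw [this, hrs])
  have hRA : R ≤ A := adj_le bot_le hrA
  have hA' : A' = A := by
    apply eq_of_card_le (adj_le hRA hsA)
    rw [card_adj hsR, cR, cA]
  have genA : ∀ (D : Subgroup G), r ∈ D → s ∈ D → A ≤ D := by
    intro D h1 h2
    rw [← hA']
    exact adj_le (adj_le bot_le h1) h2
  have hFF : FF E v = cz (cz E r) s := by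
    ext x
    rw [mem_FF]
    constructor
    · rintro ⟨h1, h2⟩
      exact ⟨⟨h1, (h2 r hrA).symm⟩, (h2 s hsA).symm⟩
    · rintro ⟨⟨h1, h2⟩, h3⟩
      refine ⟨h1, fun a ha => ?_⟩
      exact (genA (cz ⊤ x) ⟨trivial, h2.symm⟩ ⟨trivial, h3.symm⟩ ha).2
  let B : Subgroup G := adj A z (by rw [hE.zz]; exact Subgroup.one_mem _) (fun b _ => hE.zc b)
  have cB : Nat.card B = 8 := by rw [card_adj hzA, cA]
  have hBE : B ≤ E := adj_le hAE hE.zE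
  have sqB : ∀ b ∈ B, b * b = 1 := adj_sq sqA hE.zz
  have gen : ∀ g : G, (∀ a ∈ A, g * a = a * g) → ∀ b ∈ B, g * b = b * g := by
    intro g hg b hb
    have : B ≤ cz ⊤ g := adj_le (fun a ha => ⟨trivial, (hg a ha).symm⟩) ⟨trivial, (hE.zc g).symm⟩
    exact (this hb).2.symm
  have comm : ∀ x ∈ FF E v, ∀ b ∈ B, b * x = x * b := by
    intro x hx b hb
    exact (gen x (fun a ha => ((mem_FF.1 hx).2 a ha).symm) b hb).symm
  refine ⟨B, cA, cB, by rw [hFF, cF], le_adj, self_mem_adj, ?_, sqB, ?_, comm, gen, ?_⟩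
  · intro b hb
    rw [mem_FF]
    refine ⟨hBE hb, fun a ha => ?_⟩
    exact gen a (fun c hc => abA a ha c hc) b hb
  · intro b hb hbb
    exact mem_of_comm hE hBE sqB cB (mem_FF.1 hb).1 hbb (comm b hb)
  · rw [← (cards_V (V := V) hE hV h hs hrs hsr hsrz).2]
    apply Nat.card_congr
    apply Equiv.subtypeEquivRight
    intro w
    constructor
    · intro hw
      exact ⟨⟨trivial, hw r hrA⟩, hw s hsA⟩
    · rintro ⟨⟨-, h1⟩, h2⟩ a ha
      exact genA (MulAction.stabilizer G w) h1 h2 ha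

end F2Aux

namespace F2Aux

variable {G : Type*} [Group G] {E : Subgroup G} {z : G}
variable {V : Type*} [AddCommGroup V] [DistribMulAction G V]

theorem pow4 (hE : ESet E z) {n : G} (hn : n ∈ E) : n ^ 4 = 1 := by
  have : n ^ 4 = (n * n) * (n * n) := by simp only [pow_succ, pow_zero, one_mul, mul_assoc]
  rw [this]
  rcases hE.sq n hn with h | h
  · rw [h, one_mul]
  · rw [h, hE.zz]

theorem eq_one_of_coprime {n : G} {a b : ℕ} (h : Nat.Coprime a b) (ha : n ^ a = 1) (hb : n ^ b = 1) :
    n = 1 := by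
  have := Nat.dvd_gcd (orderOf_dvd_of_pow_eq_one ha) (orderOf_dvd_of_pow_eq_one hb)
  rw [h] at this
  exact orderOf_eq_one_iff.1 (Nat.dvd_one.1 this)

/-- if `g` commutes with `x` and normalises `E`, then `[g,e]` commutes with `x`. -/
theorem comm_commutes (hE : ESet E z) {g e x : G} (he : e ∈ E) (hx : x ∈ E)
    (hg : g * x = x * g) : (g * e * g⁻¹ * e⁻¹) * x = x * (g * e * g⁻¹ * e⁻¹) := by
  have hgi : g⁻¹ * x = x * g⁻¹ := by
    rw [inv_mul_eq_iff_eq_mul, ← mul_assoc, hg, mul_inv_cancel_right]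
  rcases hE.comm e he x hx with h | h
  · have hei : e⁻¹ * x = x * e⁻¹ := by
      rw [inv_mul_eq_iff_eq_mul, ← mul_assoc, h, mul_inv_cancel_right]
    calc g * e * g⁻¹ * e⁻¹ * x = g * e * g⁻¹ * (e⁻¹ * x) := by group
      _ = g * e * (g⁻¹ * x) * e⁻¹ := by rw [hei]; group
      _ = g * (e * x) * g⁻¹ * e⁻¹ := by rw [hgi]; group
      _ = (g * x) * e * g⁻¹ * e⁻¹ := by rw [h]; group
      _ = _ := by rw [hg]; group
  · have hei : e⁻¹ * x = x * e⁻¹ * z := by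
      have h' : x * e = e * x * z := by
        rw [h, mul_assoc, hE.zz, mul_one]
      rw [inv_mul_eq_iff_eq_mul]
      calc x = x * e * e⁻¹ := by group
        _ = e * x * (z * e⁻¹) := by rw [h']; group
        _ = _ := by rw [← hE.zc]; group
    calc g * e * g⁻¹ * e⁻¹ * x = g * e * g⁻¹ * (e⁻¹ * x) := by group
      _ = g * e * (g⁻¹ * x) * e⁻¹ * z := by rw [hei]; group
      _ = g * (e * x) * g⁻¹ * e⁻¹ * z := by rw [hgi]; group
      _ = (g * x) * e * (z * (g⁻¹ * e⁻¹)) * z := by rw [h]; group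
      _ = x * g * e * g⁻¹ * e⁻¹ * (z * z) := by rw [hg, ← hE.zc]; group
      _ = _ := by rw [hE.zz]; group

theorem eq_mul_of_conj {g x : G} : g * x = (g * x * g⁻¹ * x⁻¹) * x * g := by group

theorem triv_of_F (hE : ESet E z) (hN : E.Normal) (hCE : Subgroup.centralizer (E : Set G) ≤ E)
    {v : V} {B : Subgroup G} (C : Conf E z v B) {g : G} {m : ℕ} (hm : Odd m) (hgm : g ^ m = 1)
    (hF : ∀ x ∈ FF E v, g * x = x * g) : g = 1 := by
  have hFE : FF E v ≤ E := inf_le_left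
  have hg : g ∈ E := by
    apply hCE
    rw [Subgroup.mem_centralizer_iff]
    intro e he
    symm
    have hn : g * e * g⁻¹ * e⁻¹ ∈ E := E.mul_mem (hN.conj_mem e he g) (E.inv_mem he)
    refine coprime_fix hE hn ?_ eq_mul_of_conj hm hgm
    apply hF
    rw [mem_FF]
    refine ⟨hn, fun a ha => ?_⟩
    exact (comm_commutes hE he (hFE (C.BF (C.AB ha))) (hF a (C.BF (C.AB ha)))).symm
  have : Nat.Coprime m 4 := Nat.Coprime.pow_right 2 (Nat.coprime_two_right.2 hm)
  exact eq_one_of_coprime this hgm (pow4 hE hg)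

theorem triv_of (hE : ESet E z) (hN : E.Normal) (hCE : Subgroup.centralizer (E : Set G) ≤ E)
    {v : V} {B : Subgroup G} (C : Conf E z v B) {g : G} {m : ℕ} (hm : Odd m) (hgm : g ^ m = 1)
    (hA : ∀ a ∈ stE E v, g * a = a * g)
    (hB : ∀ x ∈ FF E v, g * x * g⁻¹ * x⁻¹ ∈ B) : g = 1 := by
  apply triv_of_F hE hN hCE C hm hgm
  intro x hx
  exact coprime_fix hE ((inf_le_left : FF E v ≤ E) (C.BF (hB x hx))) (C.gen g hA _ (hB x hx))
    eq_mul_of_conj hm hgm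

structure KSet (E : Subgroup G) (v : V) (B K : Subgroup G) : Prop where
  le : ∀ k ∈ K, k • v = v
  norm : ∀ g : G, g • v = v → ∀ k ∈ K, g * k * g⁻¹ ∈ K
  mem : ∀ k : G, k • v = v → (k ∈ K ↔ (∀ a ∈ stE E v, k * a = a * k) ∧
    ∀ x ∈ FF E v, k * x * k⁻¹ * x⁻¹ ∈ B)
  two : ∃ j, Nat.card K = 2 ^ j
  big : 64 ≤ Nat.card K

theorem arith1 {s k d : ℕ} (h1 : s = 2 ^ k * d) (hd : d ∣ 36) (h2 : s ∣ 103680) (h3 : 2304 ≤ s) :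
    s = 2304 := by
  have hs : s ≠ 0 := by omega
  obtain ⟨a, m, hm, rfl⟩ := Nat.exists_eq_two_pow_mul_odd hs
  have hm2 : Nat.Coprime m 2 := Nat.coprime_two_right.2 hm
  have c9 : m ∣ 9 := by
    have e1 : m ∣ 2 ^ (k + 2) * 9 := by
      refine (Dvd.intro_left _ rfl : m ∣ 2 ^ a * m).trans ?_
      rw [h1, pow_add, mul_assoc]
      exact Nat.mul_dvd_mul_left _ hd
    exact (Nat.Coprime.pow_right _ hm2).dvd_of_dvd_mul_left e1
  have c2 : 2 ^ a ∣ 256 := by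
    have e1 : 2 ^ a ∣ 405 * 256 := (Dvd.intro _ rfl : 2 ^ a ∣ 2 ^ a * m).trans h2
    exact Nat.Coprime.dvd_of_dvd_mul_left (Nat.Coprime.pow_left _ (by norm_num)) e1
  have l1 := Nat.le_of_dvd (by norm_num) c9
  have l2 := Nat.le_of_dvd (by norm_num) c2
  have : 2 ^ a * m ≤ 256 * 9 := Nat.mul_le_mul l2 l1
  omega

theorem exK [Finite G] [Finite V] (hE : ESet E z) (hN : E.Normal)
    (hCE : Subgroup.centralizer (E : Set G) ≤ E) (hcard : E.index = 25920) (hV : VSet G V) {r : G}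
    (h : NC E z r) {v : V} (hv : v ≠ 0) (hrv : r • v = v) {B : Subgroup G} (C : Conf E z v B) :
    Nat.card (MulAction.stabilizer G v) = 2304 ∧ ∃ K, KSet E v B K := by
  set S := MulAction.stabilizer G v with hS
  have hFE : FF E v ≤ E := inf_le_left
  have nA : ∀ g ∈ S, ∀ a ∈ stE E v, g * a * g⁻¹ ∈ stE E v := by
    intro g hg a ha
    rw [mem_stE] at ha ⊢
    refine ⟨hN.conj_mem a ha.1 g, ?_⟩
    have h1 : g⁻¹ • v = v := S.inv_mem hg
    rw [mul_smul, mul_smul, h1, ha.2]; exact hg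
  have nF : ∀ g ∈ S, ∀ a ∈ FF E v, g * a * g⁻¹ ∈ FF E v := by
    intro g hg x hx
    rw [mem_FF] at hx ⊢
    refine ⟨hN.conj_mem x hx.1 g, fun a ha => ?_⟩
    have h1 := hx.2 _ (nA g⁻¹ (S.inv_mem hg) a ha)
    rw [inv_inv] at h1
    calc a * (g * x * g⁻¹) = g * ((g⁻¹ * a * g) * x) * g⁻¹ := by group
      _ = _ := by rw [h1]; group
  have nB : ∀ g ∈ S, ∀ a ∈ B, g * a * g⁻¹ ∈ B := by
    intro g hg b hb
    apply C.memB _ (nF g hg b (C.BF hb))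
    calc g * b * g⁻¹ * (g * b * g⁻¹) = g * (b * b) * g⁻¹ := by group
      _ = 1 := by rw [C.sqB b hb]; group
  obtain ⟨φ1, h1⟩ := exHom S (stE E v) ⊥ bot_le nA (by
    intro g _ x hx; rw [Subgroup.mem_bot] at *; rw [hx]; group) (by
    intro g _ x hx; rw [Subgroup.mem_bot] at *; rw [hx]; group) (by simp [C.cA])
  obtain ⟨φ2, h2⟩ := exHom S (FF E v) B C.BF nF nB (by
    intro f hf b hb
    rw [← C.comm f hf b hb]; simpa using hb) (by rw [C.cF, C.cB])
  let ψ := φ1.prod φ2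
  have hker : ∀ g : S, g ∈ ψ.ker ↔ (∀ a ∈ stE E v, (g : G) * a = a * g) ∧
      ∀ x ∈ FF E v, (g : G) * x * (g : G)⁻¹ * x⁻¹ ∈ B := by
    intro g
    rw [MonoidHom.mem_ker, MonoidHom.prod_apply, Prod.mk_eq_one, h1, h2]
    apply and_congr_left
    intro _
    apply forall₂_congr
    intro a _
    rw [Subgroup.mem_bot, mul_inv_eq_one, mul_inv_eq_iff_eq_mul]
  let K : Subgroup G := ψ.ker.map S.subtype
  have hKc : Nat.card K = Nat.card ψ.ker :=
    (Nat.card_congr (ψ.ker.equivMapOfInjective S.subtype S.subtype_injective).toEquiv).symm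
  have hK2 : ∃ j, Nat.card K = 2 ^ j := by
    refine ⟨_, Nat.eq_prime_pow_of_unique_prime_dvd (p := 2) Nat.card_pos.ne' ?_⟩
    intro p hp hpd
    by_contra hp2
    have := Fact.mk hp
    rw [hKc] at hpd
    obtain ⟨g, hg⟩ := exists_prime_orderOf_dvd_card' p hpd
    have hm : Odd p := hp.odd_of_ne_two hp2
    obtain ⟨k1, k2⟩ := (hker g.1).1 g.2
    have hgp : ((g : S) : G) ^ p = 1 := by
      have : g ^ p = 1 := by rw [← hg]; exact pow_orderOf_eq_one g
      have := congrArg (fun x : ψ.ker => ((x : S) : G)) this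
      simpa using this
    have := triv_of hE hN hCE C hm hgp k1 k2
    have : g = 1 := by ext; exact this
    rw [this, orderOf_one] at hg
    exact hp.one_lt.ne hg
  have hSK : Nat.card S = Nat.card K * Nat.card ψ.range := by
    rw [hKc, ← Subgroup.card_mul_index ψ.ker, Subgroup.index_ker]
  have h36 : Nat.card ψ.range ∣ 36 := by
    have := Subgroup.card_subgroup_dvd_card ψ.range
    have e : Nat.card (Equiv.Perm (Fin 3) × Equiv.Perm (Fin 3)) = 36 := by
      rw [Nat.card_prod, Nat.card_perm]; simp; decide
    rwa [e] at this
  have hdvd : Nat.card S ∣ 103680 := by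
    have e1 : Nat.card (E.subgroupOf S) = 4 := by
      rw [← C.cA]
      apply Nat.card_congr
      refine ⟨fun x => ⟨x.1.1, x.2, x.1.2⟩, fun x => ⟨⟨x.1, x.2.2⟩, x.2.1⟩, fun x => rfl, fun x => rfl⟩
    rw [← Subgroup.card_mul_index (E.subgroupOf S), e1]
    have : E.relIndex S ∣ E.index := Subgroup.relIndex_dvd_index_of_normal E S
    rw [hcard] at this
    exact (Nat.mul_dvd_mul_left 4 this)
  have hGc : Nat.card G = 128 * 25920 := by rw [← Subgroup.card_mul_index E, hE.card, hcard]
  have hle : 2304 ≤ Nat.card S := by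
    have o := card_orbit_le hE hV hN h hv hrv
    have := MulAction.index_stabilizer G v
    have e := Subgroup.card_mul_index S
    rw [hGc, hS, this, ← Nat.card_coe_set_eq] at e
    by_contra! hlt
    have : Nat.card S * Nat.card (MulAction.orbit G v) ≤ 2303 * 1440 :=
      Nat.mul_le_mul (by omega) o
    rw [hS] at this
    omega
  obtain ⟨j, hj⟩ := hK2
  have hfin : Nat.card S = 2304 := arith1 (by rw [hSK, hj]) h36 hdvd hle
  refine ⟨hfin, K, ?_, ?_, ?_, ⟨j, hj⟩, ?_⟩
  · rintro _ ⟨k, -, rfl⟩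
    exact k.2
  · rintro g hg _ ⟨k, hk, rfl⟩
    exact ⟨⟨g, hg⟩ * k * ⟨g, hg⟩⁻¹, (MonoidHom.normal_ker ψ).conj_mem k hk _, rfl⟩
  · intro k hk
    rw [← hker ⟨k, hk⟩]
    constructor
    · rintro ⟨k', hk', rfl⟩; exact hk'
    · intro hh; exact ⟨_, hh, rfl⟩
  · have l := Nat.le_of_dvd (by norm_num) h36
    rw [hfin] at hSK
    by_contra! hlt
    have : Nat.card K * Nat.card ψ.range ≤ 63 * 36 := Nat.mul_le_mul (by omega) l
    omega

end F2Aux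

namespace F2Aux

variable {G : Type*} [Group G] {E : Subgroup G} {z : G}
variable {V : Type*} [AddCommGroup V] [DistribMulAction G V]

theorem small_K [Finite G] [Finite V] (hE : ESet E z) (hN : E.Normal)
    (hCE : Subgroup.centralizer (E : Set G) ≤ E) (hV : VSet G V) {r : G}
    (h : NC E z r) {v : V} (hv : v ≠ 0) {B : Subgroup G} (C : Conf E z v B)
    {K : Subgroup G} (hK : KSet E v B K) (hKF : ∀ k ∈ K, ∀ x ∈ FF E v, k * x = x * k) : False := by
  have hFE : FF E v ≤ E := inf_le_left
  have hBE : B ≤ E := C.BF.trans hFE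
  have hz := hE.zc
  have key : ∀ k ∈ K, ∀ e ∈ E, k * e * k⁻¹ * e⁻¹ ∈ cz B e := by
    intro k hk e he
    set c := k * e * k⁻¹ * e⁻¹ with hc
    have cE : c ∈ E := E.mul_mem (hN.conj_mem e he k) (E.inv_mem he)
    have cF : ∀ x ∈ FF E v, c * x = x * c := fun x hx =>
      comm_commutes hE he (hFE hx) (hKF k hk x hx)
    have cFF : c ∈ FF E v := mem_FF.2 ⟨cE, fun a ha => (cF a (C.BF (C.AB ha))).symm⟩
    have cB : c ∈ B := by
      by_contra hcB
      have hcc : c * c = z := (hE.sq c cE).resolve_left (fun hh => hcB (C.memB c cFF hh))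
      obtain ⟨x, hx, y, hy, hxy⟩ := nonab hE hFE (by rw [C.cF])
      apply hxy
      let D := adj B c (by rw [hcc]; exact C.zB) (fun b hb => (cF b (C.BF hb)).symm)
      have hD : x ∈ D := by
        rcases hE.sq x (hFE hx) with h1 | h1
        · exact le_adj (C.memB x hx h1)
        · right
          apply C.memB _ ((FF E v).mul_mem hx cFF)
          calc x * c * (x * c) = x * (c * x) * c := by group
            _ = (x * x) * (c * c) := by rw [cF x hx]; group
            _ = 1 := by rw [h1, hcc, hE.zz]
      have hD2 : D ≤ cz ⊤ y := adj_le (fun b hb => ⟨trivial, C.comm y hy b hb⟩) ⟨trivial, cF y hy⟩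
      exact (hD2 hD).2
    refine ⟨cB, ?_⟩
    have hee : ∀ g : G, g * (e * e) = (e * e) * g := by
      intro g
      rcases hE.sq e he with h1 | h1
      · rw [h1]; simp
      · rw [h1, hz]
    have h1 : c * e * (c * e) = e * e := by
      have : c * e = k * e * k⁻¹ := by rw [hc]; group
      rw [this]
      calc k * e * k⁻¹ * (k * e * k⁻¹) = (k * (e * e)) * k⁻¹ := by group
        _ = _ := by rw [hee]; group
    have h2 : c * e * c = e := by
      rw [← mul_assoc] at h1; exact mul_right_cancel h1
    have ci : c⁻¹ = c := inv_eq_of_mul_eq_one_left (C.sqB c cB)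
    rw [← eq_mul_inv_iff_mul_eq, ci] at h2
    exact h2
  have step : ∀ L ≤ K, ∀ e ∈ E, e ∉ FF E v → Nat.card L ≤ 4 * Nat.card (cz L e) := by
    intro L hL e he heF
    have c4 : Nat.card (cz B e) = 4 := by
      have : ∃ a ∈ B, a * e ≠ e * a := by
        by_contra! hh
        exact heF (mem_FF.2 ⟨he, fun a ha => hh a (C.AB ha)⟩)
      obtain ⟨a, ha, hae⟩ := this
      have := card_cz hE hBE he ha hae
      rw [C.cB] at this
      omega
    have hind : (cz L e).relIndex L ≤ 4 := by
      rw [← c4, Subgroup.relIndex, Subgroup.index_eq_card]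
      let f : (L ⧸ (cz L e).subgroupOf L) → cz B e := fun q =>
        ⟨_, key q.out (hL q.out.2) e he⟩
      apply Nat.card_le_card_of_injective f
      intro p q hpq
      have h1 : (p.out : G) * e * (p.out : G)⁻¹ * e⁻¹ = (q.out : G) * e * (q.out : G)⁻¹ * e⁻¹ :=
        congrArg Subtype.val hpq
      rw [← QuotientGroup.out_eq' p, ← QuotientGroup.out_eq' q, QuotientGroup.eq,
        Subgroup.mem_subgroupOf]
      refine ⟨((p.out)⁻¹ * q.out).2, ?_⟩
      have h2 := mul_right_cancel h1
      push_cast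
      generalize (p.out : G) = a at *
      generalize (q.out : G) = b at *
      calc a⁻¹ * b * e = a⁻¹ * (b * e * b⁻¹) * b := by group
        _ = _ := by rw [← h2]; group
    have := Subgroup.card_mul_index ((cz L e).subgroupOf L)
    rw [← this]
    have e1 : Nat.card ((cz L e).subgroupOf L) = Nat.card (cz L e) :=
      Nat.card_congr (Subgroup.subgroupOfEquivOfLe (cz_le L e)).toEquiv
    rw [e1, mul_comm 4]
    exact Nat.mul_le_mul_left _ hind
  have hdiv : ∀ {D D' : Subgroup G}, D ≤ D' → ∀ e ∈ D', e ∉ D → 2 * Nat.card D ≤ Nat.card D' := by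
    intro D D' hh e he heD
    obtain ⟨m, hm⟩ := Subgroup.card_dvd_of_le hh
    have hp : 0 < Nat.card D := Nat.card_pos
    have hp' : 0 < Nat.card D' := Nat.card_pos
    have : m ≠ 0 := by rintro rfl; omega
    have : m ≠ 1 := by
      rintro rfl
      exact heD ((eq_of_card_le hh (by omega)).symm ▸ he)
    rw [hm, mul_comm 2]
    exact Nat.mul_le_mul_left _ (by omega)
  let DD : Subgroup G → Subgroup G := fun L => E ⊓ Subgroup.centralizer (L : Set G)
  have base : ∀ L ≤ K, E ≤ DD L → Nat.card L ≤ 1 := by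
    intro L hL hD
    have : L = ⊥ := by
      rw [eq_bot_iff]
      intro k hk
      have hkE : k ∈ E := by
        apply hCE
        rw [Subgroup.mem_centralizer_iff]
        intro e he
        exact (Subgroup.mem_centralizer_iff.1 (hD he).2 k hk).symm
      rcases hE.cen k hkE (fun y hy => Subgroup.mem_centralizer_iff.1 (hD hy).2 k hk) with h1 | h1
      · rw [h1]; exact Subgroup.one_mem _
      · exfalso
        apply (stE_facts hE hV h hv).2.1
        rw [mem_stE, ← h1]
        exact ⟨hkE, hK.le k (hL hk)⟩
    rw [this]; simp
  have ind : ∀ n : ℕ, ∀ L ≤ K, 128 ≤ 2 ^ n * Nat.card (DD L) → Nat.card L ≤ 4 ^ n := by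
    intro n
    induction n with
    | zero =>
      intro L hL hc
      rw [pow_zero]
      apply base L hL
      exact (eq_of_card_le (inf_le_left : DD L ≤ E) (by
        rw [hE.card]
        rw [pow_zero, one_mul] at hc
        exact hc)).ge
    | succ n ih =>
      intro L hL hc
      by_cases hD : E ≤ DD L
      · exact (base L hL hD).trans (Nat.one_le_pow _ _ (by norm_num))
      · obtain ⟨e, he, heD⟩ := SetLike.not_le_iff_exists.1 hD
        have heF : e ∉ FF E v := fun hh => heD ⟨he, by
          refine Subgroup.mem_centralizer_iff.2 ?_
          intro k hk
          exact hKF k (hL hk) e hh⟩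
        have h1 := step L hL e he heF
        have hle : DD L ≤ DD (cz L e) := inf_le_inf le_rfl (Subgroup.centralizer_le (cz_le L e))
        have h2 := hdiv hle e ⟨he, by
          refine Subgroup.mem_centralizer_iff.2 ?_
          intro k hk
          exact hk.2⟩ heD
        have h3 := ih (cz L e) ((cz_le L e).trans hL) (by
          rw [pow_succ, mul_assoc] at hc
          exact hc.trans (Nat.mul_le_mul_left _ h2))
        rw [pow_succ]
        omega
  have := ind 2 K le_rfl (by
    have : FF E v ≤ DD K := fun x hx => ⟨hFE hx, by
      refine Subgroup.mem_centralizer_iff.2 ?_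
      intro k hk; exact hKF k hk x hx⟩
    have := Nat.le_of_dvd Nat.card_pos (Subgroup.card_dvd_of_le this)
    rw [C.cF] at this
    omega)
  have := hK.big
  omega

theorem no_three [Finite G] [Finite V] (hE : ESet E z) (hN : E.Normal)
    (hCE : Subgroup.centralizer (E : Set G) ≤ E) (hcard : E.index = 25920) (hV : VSet G V) {r : G}
    (h : NC E z r) {v : V} (hv : v ≠ 0) (hrv : r • v = v) (R : Subgroup G)
    (hRS : ∀ g ∈ R, g • v = v) (hRn : ∀ s : G, s • v = v → ∀ g ∈ R, s * g * s⁻¹ ∈ R)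
    (hR3 : ∀ g ∈ R, ∃ k, g ^ 3 ^ k = 1) : ∀ g ∈ R, g = 1 := by
  obtain ⟨B, C⟩ := conf hE hV h hv hrv
  obtain ⟨-, K, hK⟩ := exK hE hN hCE hcard hV h hv hrv C
  have hFE : FF E v ≤ E := inf_le_left
  have hBE : B ≤ E := C.BF.trans hFE
  intro g hg
  by_contra hg1
  obtain ⟨m0, hgm⟩ := hR3 g hg
  have hodd : Odd (3 ^ m0) := Odd.pow (by decide)
  have hgK : ∀ k ∈ K, g * k = k * g := by
    intro k hk
    set w := g * k * g⁻¹ * k⁻¹ with hw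
    have w1 : w ∈ K := K.mul_mem (hK.norm g (hRS g hg) k hk) (K.inv_mem hk)
    have w2 : w ∈ R := by
      have : w = g * (k * g⁻¹ * k⁻¹) := by rw [hw]; group
      rw [this]
      exact R.mul_mem hg (hRn k (hK.le k hk) _ (R.inv_mem hg))
    obtain ⟨i, hi⟩ := hR3 w w2
    obtain ⟨j, hj⟩ := hK.two
    have hwj : w ^ 2 ^ j = 1 := by
      rw [← hj]
      have := pow_card_eq_one' (x := (⟨w, w1⟩ : K))
      exact congrArg Subtype.val this
    have : w = 1 := eq_one_of_coprime
      (Nat.Coprime.pow_left _ (Nat.Coprime.pow_right _ (by norm_num))) hi hwj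
    rw [hw, mul_inv_eq_one, mul_inv_eq_iff_eq_mul] at this
    exact this
  have hAK : stE E v ≤ K := by
    intro a ha
    rw [hK.mem a (mem_stE.1 ha).2]
    have hF : ∀ x ∈ FF E v, a * x = x * a := fun x hx => C.comm x hx a (C.AB ha)
    refine ⟨fun b hb => hF b (C.BF (C.AB hb)), fun x hx => ?_⟩
    rw [hF x hx]; simp
  have gA : ∀ a ∈ stE E v, g * a = a * g := fun a ha => hgK a (hAK ha)
  have gB := C.gen g gA
  have gF : ∀ x ∈ FF E v, g * x * g⁻¹ ∈ FF E v := by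
    intro x hx
    rw [mem_FF] at hx ⊢
    refine ⟨hN.conj_mem x hx.1 g, fun a ha => ?_⟩
    have e1 := gA a ha
    have e2 : a * g⁻¹ = g⁻¹ * a := by
      rw [eq_inv_mul_iff_mul_eq, ← mul_assoc, e1, mul_inv_cancel_right]
    calc a * (g * x * g⁻¹) = (a * g) * x * g⁻¹ := by group
      _ = g * (a * x) * g⁻¹ := by rw [← e1]; group
      _ = g * x * (a * g⁻¹) := by rw [hx.2 a ha]; group
      _ = _ := by rw [e2]; group
  have : ∃ x ∈ FF E v, g * x * g⁻¹ * x⁻¹ ∉ B := by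
    by_contra! hh
    exact hg1 (triv_of hE hN hCE C hodd hgm gA hh)
  obtain ⟨x, hx, hy1⟩ := this
  set y1 := g * x * g⁻¹ * x⁻¹ with hy1d
  have y1F : y1 ∈ FF E v := (FF E v).mul_mem (gF x hx) ((FF E v).inv_mem hx)
  have y1sq : y1 * y1 ∈ B := by
    rcases hE.sq y1 (hFE y1F) with h1 | h1
    · rw [h1]; exact B.one_mem
    · rw [h1]; exact C.zB
  have Kprop : ∀ k ∈ K, (∀ a ∈ stE E v, k * a = a * k) ∧
    ∀ x ∈ FF E v, k * x * k⁻¹ * x⁻¹ ∈ B := fun k hk => (hK.mem k (hK.le k hk)).1 hk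
  have ky1 : ∀ k ∈ K, k * y1 = y1 * k := by
    intro k hk
    have hb := (Kprop k hk).2 x hx
    set b := k * x * k⁻¹ * x⁻¹ with hbd
    have e1 : k * x * k⁻¹ = b * x := by rw [hbd]; group
    have e2 : k * g = g * k := (hgK k hk).symm
    have e3 : k * y1 * k⁻¹ = y1 := by
      calc k * y1 * k⁻¹ = (k * g) * x * (k * g)⁻¹ * (k * x * k⁻¹)⁻¹ := by rw [hy1d]; group
        _ = g * (k * x * k⁻¹) * g⁻¹ * (k * x * k⁻¹)⁻¹ := by rw [e2]; group
        _ = (g * b) * x * g⁻¹ * x⁻¹ * b⁻¹ := by rw [e1]; group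
        _ = b * y1 * b⁻¹ := by rw [gB b hb, hy1d]; group
        _ = y1 := by rw [C.comm y1 y1F b hb]; group
    rwa [mul_inv_eq_iff_eq_mul] at e3
  set y2 := g * y1 * g⁻¹ with hy2d
  have y2F : y2 ∈ FF E v := gF y1 y1F
  have ky2 : ∀ k ∈ K, k * y2 = y2 * k := by
    intro k hk
    have e2 : k * g = g * k := (hgK k hk).symm
    have e4 : k * g⁻¹ = g⁻¹ * k := by
      rw [eq_inv_mul_iff_mul_eq, ← mul_assoc, hgK k hk, mul_inv_cancel_right]
    calc k * y2 = (k * g) * y1 * g⁻¹ := by rw [hy2d]; group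
      _ = g * (k * y1) * g⁻¹ := by rw [e2]; group
      _ = g * y1 * (k * g⁻¹) := by rw [ky1 k hk]; group
      _ = _ := by rw [e4, hy2d]; group
  let B1 := adj B y1 y1sq (fun b hb => C.comm y1 y1F b hb)
  have cB1 : Nat.card B1 = 16 := by rw [card_adj hy1, C.cB]
  have hB1F : B1 ≤ FF E v := adj_le C.BF y1F
  have y2B1 : y2 ∉ B1 := by
    rintro (h2 | h2)
    · apply hy1
      have e := gB y2 h2
      have : y2 = y1 := by
        have : g * y1 = g * y2 := by rw [e, hy2d]; group
        exact (mul_left_cancel this).symm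
      rwa [this] at h2
    · have hn : y2 * y1⁻¹ ∈ B := by
        have : y2 * y1⁻¹ = y2 * y1 * (y1 * y1)⁻¹ := by group
        rw [this]; exact B.mul_mem h2 (B.inv_mem y1sq)
      have c1 : g * y1 = y1 * g := coprime_fix hE (hBE hn) (gB _ hn)
        (by rw [hy2d]; group) hodd hgm
      have gB1 : ∀ b ∈ B1, g * b = b * g := by
        intro b hb
        have : B1 ≤ cz ⊤ g := adj_le (fun b hb => ⟨trivial, (gB b hb).symm⟩) ⟨trivial, c1.symm⟩
        exact (this hb).2.symm
      apply hg1
      apply triv_of_F hE hN hCE C hodd hgm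
      intro u hu
      have hi : (B1.subgroupOf (FF E v)).index = 2 := by
        have e := Subgroup.card_mul_index (B1.subgroupOf (FF E v))
        rw [Nat.card_congr (Subgroup.subgroupOfEquivOfLe hB1F).toEquiv, cB1, C.cF] at e
        omega
      have hmem : g * u * g⁻¹ * u⁻¹ ∈ B1 := by
        have := Subgroup.mul_mem_iff_of_index_two hi (a := ⟨_, gF u hu⟩) (b := ⟨_, (FF E v).inv_mem hu⟩)
        rw [Subgroup.mem_subgroupOf, Subgroup.mem_subgroupOf, Subgroup.mem_subgroupOf] at this
        simp only [Subgroup.coe_mul] at this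
        rw [this, inv_mem_iff]
        constructor
        · intro hh
          have e := gB1 _ hh
          have : g * u * g⁻¹ = u := by
            have : g * (g * u * g⁻¹) = g * u := by rw [e]; group
            exact mul_left_cancel this
          rwa [this] at hh
        · intro hh
          rw [gB1 u hh]; simpa using hh
      exact coprime_fix hE (hFE (hB1F hmem)) (gB1 _ hmem) eq_mul_of_conj hodd hgm
  apply small_K hE hN hCE hV h hv C hK
  intro k hk
  have hle : B1 ≤ cz (FF E v) k := by
    apply adj_le
    · intro b hb
      exact ⟨C.BF hb, (C.gen k (Kprop k hk).1 b hb).symm⟩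
    · exact ⟨y1F, (ky1 k hk).symm⟩
  have hne : B1 ≠ cz (FF E v) k := by
    intro hh
    apply y2B1
    rw [hh]
    exact ⟨y2F, (ky2 k hk).symm⟩
  have d1 := Subgroup.card_dvd_of_le hle
  have d2 := Subgroup.card_dvd_of_le (cz_le (FF E v) k)
  rw [cB1] at d1
  rw [C.cF] at d2
  have : Nat.card (cz (FF E v) k) = 32 := by
    obtain ⟨m, hm⟩ := d1
    have l := Nat.le_of_dvd (by norm_num) d2
    have : m ≠ 1 := by
      rintro rfl
      exact hne (eq_of_card_le hle (by omega))
    have : m ≠ 0 := by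
      rintro rfl
      have : 0 < Nat.card (cz (FF E v) k) := Nat.card_pos
      omega
    omega
  have heq := eq_of_card_le (cz_le (FF E v) k) (by rw [this, C.cF])
  intro u hu
  rw [← heq] at hu
  exact hu.2.symm

theorem exists_y [Finite G] [Finite V] (hE : ESet E z) (hV : VSet G V) (hN : E.Normal) {r : G}
    (h : NC E z r) {v : V} (hv : v ≠ 0) (hrv : r • v = v) {M : Type*} [AddCommGroup M]
    (χ : V →+ M) (hχ : ∀ g : G, g • v = v → ∀ u, χ (g • u) = χ u) (hχv : χ v = 0)
    (w : V) (hw : χ w ≠ 0) :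
    ∃ y, χ y ≠ 0 ∧ ∀ g : G, g • v = v → g • y - y ∈ AddSubgroup.zmultiples v := by
  classical
  obtain ⟨B, C⟩ := conf hE hV h hv hrv
  have := Fintype.ofFinite (stE E v)
  let y : V := ∑ a : stE E v, (a : G) • w
  have hst : ∀ a : stE E v, (a : G) • v = v := fun a => (mem_stE.1 a.2).2
  have hy : χ y = χ w := by
    have h3 : χ w + χ w + χ w = 0 := by rw [← map_add, ← map_add, hV.three, map_zero]
    have : χ y = 4 • χ w := by
      simp only [y, map_sum, hχ _ (hst _), Finset.sum_const, Finset.card_univ]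
      rw [← Nat.card_eq_fintype_card, C.cA]
    rw [this]
    have : 4 • χ w = (χ w + χ w + χ w) + χ w := by abel
    rw [this, h3, zero_add]
  have hyA : ∀ a ∈ stE E v, a • y = y := by
    intro a ha
    simp only [y, Finset.smul_sum, ← mul_smul]
    exact Fintype.sum_equiv (Equiv.mulLeft ⟨a, ha⟩) _ _ (fun b => rfl)
  let W : AddSubgroup V :=
    { carrier := {w | ∀ a ∈ stE E v, a • w = w}
      zero_mem' := by intro a _; simp
      add_mem' := by intro p q hp hq a ha; rw [smul_add, hp a ha, hq a ha]
      neg_mem' := by intro p hp a ha; rw [smul_neg, hp a ha] }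
  have cW : Nat.card W = 9 := C.fix9
  let U : AddSubgroup V := W ⊓ χ.ker
  have hUW : U ≤ W := inf_le_left
  have cU : Nat.card U ≤ 3 := by
    have d := AddSubgroup.card_dvd_of_le hUW
    rw [cW] at d
    have l := Nat.le_of_dvd (by norm_num) d
    have : Nat.card U ≠ 9 := by
      intro h9
      have : (U : Set V) = W := by
        apply Set.eq_of_subset_of_ncard_le hUW
        rw [← Nat.card_coe_set_eq, ← Nat.card_coe_set_eq]
        exact (cW.trans h9.symm).le
      have : y ∈ (U : Set V) := this ▸ hyA
      have := this.2
      apply hw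
      rw [← hy]; exact this
    interval_cases Nat.card U <;> omega
  have hvU : AddSubgroup.zmultiples v ≤ U := by
    rw [AddSubgroup.zmultiples_le]
    exact ⟨fun a ha => (mem_stE.1 ha).2, hχv⟩
  have cv : Nat.card (AddSubgroup.zmultiples v) = 3 := by
    rw [Nat.card_zmultiples]
    apply addOrderOf_eq_prime
    · rw [← hV.three v]; abel
    · exact hv
  have heq : (AddSubgroup.zmultiples v : Set V) = U := by
    apply Set.eq_of_subset_of_ncard_le hvU
    rw [← Nat.card_coe_set_eq, ← Nat.card_coe_set_eq]
    exact cU.trans cv.ge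
  refine ⟨y, by rw [hy]; exact hw, ?_⟩
  intro g hg
  have : g • y - y ∈ (U : Set V) := by
    refine ⟨?_, ?_⟩
    · apply W.sub_mem _ hyA
      intro a ha
      have ha' : g⁻¹ * a * g ∈ stE E v := by
        rw [mem_stE] at ha ⊢
        have hgi : g⁻¹ • v = v := by rw [inv_smul_eq_iff, hg]
        refine ⟨by simpa using hN.conj_mem a ha.1 g⁻¹, ?_⟩
        rw [mul_smul, mul_smul, hg, ha.2, hgi]
      calc a • g • y = g • ((g⁻¹ * a * g) • y) := by
            simp only [mul_smul, smul_inv_smul]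
        _ = g • y := by rw [hyA _ ha']
    · have : χ (g • y - y) = 0 := by rw [map_sub, hχ g hg, sub_self]
      exact this
  rw [← heq] at this
  exact this

end F2Aux

namespace F2Aux

abbrev T4 := ZMod 3 × ZMod 3 × ZMod 3 × ZMod 3

def om (x y : T4) : ZMod 3 :=
  x.2.2.1 * y.1 + x.2.2.2 * y.2.1 - x.1 * y.2.2.1 - x.2.1 * y.2.2.2

def bas : Fin 4 → T4 := ![(1, 0, 0, 0), (0, 1, 0, 0), (0, 0, 1, 0), (0, 0, 0, 1)]

/-- projection to the orthogonal complement of a hyperbolic pair -/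
def prj (x y e : T4) : T4 :=
  (e.1 + om e y * x.1 - om e x * y.1, e.2.1 + om e y * x.2.1 - om e x * y.2.1,
    e.2.2.1 + om e y * x.2.2.1 - om e x * y.2.2.1, e.2.2.2 + om e y * x.2.2.2 - om e x * y.2.2.2)

def scl (s : ZMod 3) (e : T4) : T4 := (s * e.1, s * e.2.1, s * e.2.2.1, s * e.2.2.2)

set_option maxRecDepth 100000 in
theorem cnt : Fintype.card {p : T4 × T4 // om p.1 p.2 = 2} = 2160 := by decide +kernel

set_option maxRecDepth 100000 in
theorem cnt2 : Fintype.card {p : T4 // p.1 * p.2.2.2 - p.2.1 * p.2.2.1 = 1} = 24 := by decide +kernel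

theorem om_swap (x y : T4) : om x y = - om y x := by unfold om; ring
theorem om_self (x : T4) : om x x = 0 := by unfold om; ring

theorem om_prj (x y e f : T4) (h : om x y = 2) :
    om (prj x y e) (prj x y f) = om e f + om e x * om f y - om e y * om f x := by
  have e1 : om (prj x y e) (prj x y f) = om e f + om f y * om e x - om f x * om e y +
    om e y * om x f - om e y * om f x * om x y - om e x * om y f + om e x * om f y * om x y := by
    simp only [prj]; unfold om; ring
  have h3 : (3 : ZMod 3) = 0 := by decide
  rw [e1, om_swap x f, om_swap y f, h]
  linear_combination (om e x * om f y - om f x * om e y) * h3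

theorem om_prj1 (x y e : T4) (h : om x y = 2) : om x (prj x y e) = 0 := by
  have e1 : om x (prj x y e) = om x e - om e x * om x y := by
    simp only [prj]; unfold om; ring
  have h3 : (3 : ZMod 3) = 0 := by decide
  rw [e1, h, om_swap x e]
  linear_combination (- om e x) * h3

theorem om_prj2 (x y e : T4) (h : om x y = 2) : om y (prj x y e) = 0 := by
  have e1 : om y (prj x y e) = om y e + om e y * om y x := by
    simp only [prj]; unfold om; ring
  have h3 : (3 : ZMod 3) = 0 := by decide
  rw [e1, om_swap y x, h, om_swap y e]
  linear_combination (- om e y) * h3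

theorem om_scl (s : ZMod 3) (x y : T4) : om x (scl s y) = s * om x y := by
  simp only [scl]; unfold om; ring

set_option maxRecDepth 100000 in
theorem ext00 : ∀ p : T4 × T4, om p.1 p.2 = 2 → ∃ i j : Fin 4,
    om (bas i) (bas j) + om (bas i) p.1 * om (bas j) p.2 - om (bas i) p.2 * om (bas j) p.1 ≠ 0 := by
  decide +kernel

theorem ext0 (a c : T4) (h : om a c = 2) : ∃ b d, om b d = 2 ∧ om a b = 0 ∧ om a d = 0 ∧
    om b c = 0 ∧ om c d = 0 := by
  obtain ⟨i, j, hij⟩ := ext00 (a, c) h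
  rw [← om_prj _ _ _ _ h] at hij
  refine ⟨prj a c (bas i), scl (2 * om (prj a c (bas i)) (prj a c (bas j))) (prj a c (bas j)), ?_, ?_⟩
  · rw [om_scl]
    revert hij
    generalize om (prj a c (bas i)) (prj a c (bas j)) = t
    revert t
    decide
  · rw [om_scl, om_scl, om_swap (prj a c (bas i)) c]
    simp only [om_prj1 _ _ _ h, om_prj2 _ _ _ h]
    simp

abbrev X4 := Fin 2 ⊕ Fin 2 → ZMod 3

def toT : X4 ≃ T4 where
  toFun x := (x (.inl 0), x (.inl 1), x (.inr 0), x (.inr 1))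
  invFun t := Sum.elim ![t.1, t.2.1] ![t.2.2.1, t.2.2.2]
  left_inv x := by ext (i | i) <;> fin_cases i <;> rfl
  right_inv t := rfl

open Matrix

def ome (x y : X4) : ZMod 3 := x ⬝ᵥ (Matrix.J (Fin 2) (ZMod 3) *ᵥ y)

theorem ome_eq (x y : X4) : ome x y = om (toT x) (toT y) := by
  have e : ∀ x : X4, toT x = (x (.inl 0), x (.inl 1), x (.inr 0), x (.inr 1)) := fun _ => rfl
  rw [e, e]
  simp [ome, om, dotProduct, Matrix.mulVec, Matrix.J, Fintype.sum_sum_type, Fin.sum_univ_two,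
    Matrix.fromBlocks, Matrix.one_apply]
  ring

theorem ome_smul (A : Sp43) (x y : X4) : ome (A.1 *ᵥ x) (A.1 *ᵥ y) = ome x y := by
  have h := SymplecticGroup.mem_iff'.1 A.2
  unfold ome
  conv_rhs => rw [← h]
  rw [Matrix.mulVec_mulVec, Matrix.dotProduct_mulVec, Matrix.dotProduct_mulVec,
    Matrix.vecMul_mulVec, Matrix.mul_assoc]

def mat (a b c d : T4) : Matrix (Fin 2 ⊕ Fin 2) (Fin 2 ⊕ Fin 2) (ZMod 3) :=
  Matrix.of fun i j => (Sum.elim ![toT.symm a, toT.symm b] ![toT.symm c, toT.symm d] j : X4) i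

theorem mat_mem {a b c d : T4} (h1 : om a c = 2) (h2 : om b d = 2) (h3 : om a b = 0)
    (h4 : om a d = 0) (h5 : om b c = 0) (h6 : om c d = 0) : mat a b c d ∈ Matrix.symplecticGroup (Fin 2) (ZMod 3) := by
  rw [SymplecticGroup.mem_iff']
  have key : ∀ i j, ((mat a b c d)ᵀ * Matrix.J (Fin 2) (ZMod 3) * mat a b c d) i j =
      ome (fun k => mat a b c d k i) (fun k => mat a b c d k j) := by
    intro i j
    rw [Matrix.mul_assoc]
    rfl
  have m2 : (2 : ZMod 3) = -1 := by decide
  have h1' := om_swap c a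
  have h2' := om_swap d b
  have h3' := om_swap b a
  have h4' := om_swap d a
  have h5' := om_swap c b
  have h6' := om_swap d c
  ext i j
  rw [key, ome_eq]
  rcases i with i | i <;> rcases j with j | j <;> fin_cases i <;> fin_cases j <;>
    simp [mat, toT, Matrix.J, om_self, h1, h2, h3, h4, h5, h6, h1', h2', h3', h4', h5', h6', m2]

end F2Aux

namespace F2Aux
open Matrix

theorem coe_mul_sp (A B : Sp43) : (A * B).1 = A.1 * B.1 := rfl
theorem coe_one_sp : (1 : Sp43).1 = 1 := rfl

theorem toTs (t : T4) : toT.symm t = Sum.elim ![t.1, t.2.1] ![t.2.2.1, t.2.2.2] := rfl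

@[reducible] def pairAct : MulAction Sp43 (X4 × X4) where
  smul A p := (A.1 *ᵥ p.1, A.1 *ᵥ p.2)
  one_smul p := by
    show ((1 : Sp43).1 *ᵥ p.1, (1 : Sp43).1 *ᵥ p.2) = p
    rw [coe_one_sp, Matrix.one_mulVec, Matrix.one_mulVec]
  mul_smul A B p := by
    show ((A * B).1 *ᵥ p.1, (A * B).1 *ᵥ p.2) = (A.1 *ᵥ B.1 *ᵥ p.1, A.1 *ᵥ B.1 *ᵥ p.2)
    rw [coe_mul_sp, Matrix.mulVec_mulVec, Matrix.mulVec_mulVec]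

def e0 : X4 := Pi.single (.inl 0) 1
def e2 : X4 := Pi.single (.inr 0) 1

theorem mv_e0 (A : Matrix (Fin 2 ⊕ Fin 2) (Fin 2 ⊕ Fin 2) (ZMod 3)) : A *ᵥ e0 = A.col (.inl 0) :=
  Matrix.mulVec_single_one A _
theorem mv_e2 (A : Matrix (Fin 2 ⊕ Fin 2) (Fin 2 ⊕ Fin 2) (ZMod 3)) : A *ᵥ e2 = A.col (.inr 0) :=
  Matrix.mulVec_single_one A _

theorem ome_col (A : Sp43) (i j) : ome (A.1.col i) (A.1.col j) = Matrix.J (Fin 2) (ZMod 3) i j := by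
  rw [← Matrix.mulVec_single_one, ← Matrix.mulVec_single_one, ome_smul]
  unfold ome
  rw [Matrix.mulVec_single_one]
  simp

theorem card_orb : letI := pairAct; Nat.card (MulAction.orbit Sp43 (e0, e2)) = 2160 := by
  let _ := pairAct
  have : ∀ p : X4 × X4, p ∈ MulAction.orbit Sp43 (e0, e2) ↔ om (toT p.1) (toT p.2) = 2 := by
    rintro ⟨x, y⟩
    constructor
    · rintro ⟨A, hA⟩
      have h1 : A.1 *ᵥ e0 = x := congrArg Prod.fst hA
      have h2 : A.1 *ᵥ e2 = y := congrArg Prod.snd hA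
      simp only
      rw [← ome_eq, ← h1, ← h2, ome_smul, ome_eq]
      decide
    · intro h
      obtain ⟨b, d, k1, k2, k3, k4, k5⟩ := ext0 _ _ h
      refine ⟨⟨_, mat_mem h k1 k2 k3 k4 k5⟩, ?_⟩
      apply Prod.ext
      · show mat _ _ _ _ *ᵥ e0 = x
        rw [mv_e0]
        funext i
        simp [mat]
      · show mat _ _ _ _ *ᵥ e2 = y
        rw [mv_e2]
        funext i
        simp [mat]
  rw [← cnt, ← Nat.card_eq_fintype_card]
  apply Nat.card_congr
  exact (toT.prodCongr toT).subtypeEquiv this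

theorem card_stab : letI := pairAct; Nat.card (MulAction.stabilizer Sp43 (e0, e2)) = 24 := by
  let _ := pairAct
  rw [← cnt2, ← Nat.card_eq_fintype_card]
  have hst : ∀ A : Sp43, A ∈ MulAction.stabilizer Sp43 (e0, e2) ↔
      A.1.col (.inl 0) = e0 ∧ A.1.col (.inr 0) = e2 := by
    intro A
    rw [MulAction.mem_stabilizer_iff, ← mv_e0, ← mv_e2]
    exact Prod.ext_iff
  let mk : {p : T4 // p.1 * p.2.2.2 - p.2.1 * p.2.2.1 = 1} → MulAction.stabilizer Sp43 (e0, e2) :=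
    fun p => ⟨⟨mat (1, 0, 0, 0) (0, p.1.1, 0, p.1.2.1) (0, 0, 1, 0) (0, p.1.2.2.1, 0, p.1.2.2.2), by
      have h := p.2
      have m2 : (2 : ZMod 3) = -1 := by decide
      apply mat_mem <;> simp [om, m2]
      linear_combination -h⟩, by
      rw [hst]
      constructor <;> (ext (i | i) <;> fin_cases i <;> simp [mat, toTs, e0, e2])⟩
  symm
  apply Nat.card_congr
  apply Equiv.ofBijective mk
  constructor
  · intro p q hpq
    have h : mat (1, 0, 0, 0) (0, p.1.1, 0, p.1.2.1) (0, 0, 1, 0) (0, p.1.2.2.1, 0, p.1.2.2.2) =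
      mat (1, 0, 0, 0) (0, q.1.1, 0, q.1.2.1) (0, 0, 1, 0) (0, q.1.2.2.1, 0, q.1.2.2.2) :=
      congrArg (fun A => A.1.1) hpq
    have h1 := congrFun (congrFun h (.inl 1)) (.inl 1)
    have h2 := congrFun (congrFun h (.inr 1)) (.inl 1)
    have h3 := congrFun (congrFun h (.inl 1)) (.inr 1)
    have h4 := congrFun (congrFun h (.inr 1)) (.inr 1)
    simp [mat, toTs] at h1 h2 h3 h4
    ext <;> assumption
  · intro A
    obtain ⟨h0, h2⟩ := (hst A.1).1 A.2
    set M := A.1.1 with hM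
    have g : ∀ i j, ome (M.col i) (M.col j) = Matrix.J (Fin 2) (ZMod 3) i j := ome_col A.1
    have c0 : ∀ i, M i (.inl 0) = e0 i := fun i => congrFun h0 i
    have c2 : ∀ i, M i (.inr 0) = e2 i := fun i => congrFun h2 i
    have m2 : (2 : ZMod 3) = -1 := by decide
    have E : ∀ i, toT (M.col i) = (M (.inl 0) i, M (.inl 1) i, M (.inr 0) i, M (.inr 1) i) := fun _ => rfl
    have g1 := g (.inl 0) (.inl 1)
    have g2 := g (.inl 0) (.inr 1)
    have g3 := g (.inr 0) (.inl 1)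
    have g4 := g (.inr 0) (.inr 1)
    have g5 := g (.inl 1) (.inr 1)
    rw [ome_eq, E, E] at g1 g2 g3 g4 g5
    simp [om, c0, c2, e0, e2, Matrix.J] at g1 g2 g3 g4 g5
    refine ⟨⟨(M (.inl 1) (.inl 1), M (.inr 1) (.inl 1), M (.inl 1) (.inr 1), M (.inr 1) (.inr 1)), ?_⟩, ?_⟩
    · simp only
      simp [g1, g2, g3, g4] at g5
      linear_combination -g5
    · apply Subtype.ext
      apply Subtype.ext
      rw [← hM]
      show mat (1, 0, 0, 0) (0, M (.inl 1) (.inl 1), 0, M (.inr 1) (.inl 1)) (0, 0, 1, 0)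
        (0, M (.inl 1) (.inr 1), 0, M (.inr 1) (.inr 1)) = M
      clear_value M
      clear hst mk
      ext i j
      rcases i with i | i <;> rcases j with j | j <;> fin_cases i <;> fin_cases j <;>
        simp [mat, toTs, c0, c2, e0, e2, g1, g2, g3, g4]

theorem card_sp : Nat.card Sp43 = 51840 := by
  let _ := pairAct
  have h1 := card_orb
  have h2 := card_stab
  have h3 := MulAction.index_stabilizer Sp43 ((e0, e2) : X4 × X4)
  have h4 := Subgroup.card_mul_index (MulAction.stabilizer Sp43 ((e0, e2) : X4 × X4))
  rw [h3, ← Nat.card_coe_set_eq, h2] at h4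
  exact h4.symm.trans (congrArg (24 * ·) h1)

end F2Aux

namespace F2Aux
open Matrix

theorem up_mem (S : Matrix (Fin 2) (Fin 2) (ZMod 3)) (hS : Sᵀ = S) :
    Matrix.fromBlocks 1 S 0 1 ∈ Matrix.symplecticGroup (Fin 2) (ZMod 3) := by
  rw [SymplecticGroup.mem_iff]
  simp [Matrix.J, Matrix.fromBlocks_multiply, Matrix.fromBlocks_transpose, hS]

theorem up_comm {a b c d S : Matrix (Fin 2) (Fin 2) (ZMod 3)}
    (h : Matrix.fromBlocks 1 S 0 1 * Matrix.fromBlocks a b c d =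
      Matrix.fromBlocks a b c d * Matrix.fromBlocks 1 S 0 1) : S * c = 0 ∧ S * d = a * S := by
  rw [Matrix.fromBlocks_multiply, Matrix.fromBlocks_multiply, Matrix.fromBlocks_inj] at h
  obtain ⟨h1, h2, -, -⟩ := h
  simp only [Matrix.one_mul, Matrix.mul_one, Matrix.mul_zero, add_zero] at h1 h2
  refine ⟨by simpa using h1, ?_⟩
  rw [add_comm (a * S)] at h2
  exact add_left_cancel h2

theorem card_center_sp : Nat.card (Subgroup.center Sp43) = 2 := by
  have hneg : (-1 : Matrix (Fin 2 ⊕ Fin 2) (Fin 2 ⊕ Fin 2) (ZMod 3)) ∈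
    Matrix.symplecticGroup (Fin 2) (ZMod 3) := SymplecticGroup.neg_mem (Submonoid.one_mem _)
  let n : Sp43 := ⟨-1, hneg⟩
  have hn1 : n ≠ 1 := by
    intro h
    have h1 : (-1 : Matrix (Fin 2 ⊕ Fin 2) (Fin 2 ⊕ Fin 2) (ZMod 3)) = 1 := congrArg Subtype.val h
    have := congrFun (congrFun h1 (.inl 0)) (.inl 0)
    simp at this
    revert this
    decide
  have hset : (Subgroup.center Sp43 : Set Sp43) = {1, n} := by
    ext A
    simp only [SetLike.mem_coe, Set.mem_insert_iff, Set.mem_singleton_iff]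
    constructor
    · intro hA
      rw [Subgroup.mem_center_iff] at hA
      have hc : ∀ M ∈ Matrix.symplecticGroup (Fin 2) (ZMod 3), M * A.1 = A.1 * M := fun M hM =>
        congrArg Subtype.val (hA ⟨M, hM⟩)
      have hJ := hc _ (SymplecticGroup.J_mem _ _)
      have u1 := hc _ (up_mem 1 (by simp))
      have u2 := hc _ (up_mem !![1, 0; 0, 0] (by decide))
      have u3 := hc _ (up_mem !![0, 1; 1, 0] (by decide))
      have hmem := SymplecticGroup.mem_iff.1 A.2
      rw [← Matrix.fromBlocks_toBlocks A.1] at hJ u1 u2 u3 hmem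
      obtain ⟨p1, p2⟩ := up_comm u1
      obtain ⟨-, p3⟩ := up_comm u2
      obtain ⟨-, p4⟩ := up_comm u3
      rw [Matrix.one_mul] at p1 p2
      rw [Matrix.mul_one] at p2
      have hbl := Matrix.fromBlocks_toBlocks A.1
      set a := A.1.toBlocks₁₁
      set b := A.1.toBlocks₁₂
      set c := A.1.toBlocks₂₁
      set d := A.1.toBlocks₂₂
      have hb : b = 0 := by
        rw [Matrix.J, Matrix.fromBlocks_multiply, Matrix.fromBlocks_multiply, Matrix.fromBlocks_inj] at hJ
        have := hJ.1
        rw [p1] at this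
        simpa using this.symm
      rw [p2] at p3 p4
      have q1 : a 0 1 = 0 := by
        have := congrFun (congrFun p3 0) 1
        simpa [Matrix.mul_apply, Fin.sum_univ_two] using this
      have q2 : a 1 0 = 0 := by
        have := congrFun (congrFun p3 1) 0
        simpa [Matrix.mul_apply, Fin.sum_univ_two] using this.symm
      have q3 : a 1 1 = a 0 0 := by
        have := congrFun (congrFun p4 0) 1
        simpa [Matrix.mul_apply, Fin.sum_univ_two] using this
      have q4 : a 0 0 = 1 ∨ a 0 0 = -1 := by
        rw [Matrix.J, p1, p2, hb, Matrix.fromBlocks_transpose, Matrix.fromBlocks_multiply,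
          Matrix.fromBlocks_multiply, Matrix.fromBlocks_inj] at hmem
        have := congrFun (congrFun hmem.2.2.1 0) 0
        simp [Matrix.mul_apply, Fin.sum_univ_two, q1] at this
        revert this
        generalize a 0 0 = t
        revert t
        decide
      have ha : a = (a 0 0) • 1 := by
        ext i j
        fin_cases i <;> fin_cases j <;> simp [q1, q2, q3]
      rcases q4 with q | q
      · left
        apply Subtype.ext
        rw [coe_one_sp, ← hbl, p1, p2, hb, ha, q, one_smul, Matrix.fromBlocks_one]
      · right
        apply Subtype.ext
        show A.1 = -1
        rw [← hbl, p1, p2, hb, ha, q, neg_smul, one_smul, ← Matrix.fromBlocks_one, Matrix.fromBlocks_neg]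
        simp
    · rintro (rfl | rfl)
      · exact Subgroup.one_mem _
      · rw [Subgroup.mem_center_iff]
        intro B
        apply Subtype.ext
        show B.1 * (-1) = (-1) * B.1
        simp
  have : Nat.card (Subgroup.center Sp43) = (Subgroup.center Sp43 : Set Sp43).ncard :=
    Nat.card_coe_set_eq _
  rw [this, hset, Set.ncard_pair hn1.symm]

theorem card_psp : Nat.card PSp43 = 25920 := by
  have h := Subgroup.card_eq_card_quotient_mul_card_subgroup (Subgroup.center Sp43)
  rw [card_sp, card_center_sp] at h
  have : Nat.card PSp43 = Nat.card (Sp43 ⧸ Subgroup.center Sp43) := rfl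
  omega

end F2Aux

namespace F2Aux

theorem eset_of {G : Type*} [Group G] [Finite G] (E : Subgroup G) (hN : E.Normal)
    (hx : IsExtraspecial 2 E) (hc : Nat.card E = 2 ^ 7)
    (hab : ∀ A : Subgroup G, A ≤ E → (∀ x ∈ A, x ^ 2 = 1) → Nat.card A ≤ 2 ^ 3) :
    ∃ z, ESet E z := by
  obtain ⟨-, hcc, -, h2⟩ := hx
  obtain ⟨z0, hz0, huniq⟩ := (Nat.card_eq_two_iff' (1 : Subgroup.center E)).1 h2
  set z : G := ((z0 : E) : G) with hz
  have hcen : ∀ x ∈ E, (∀ y ∈ E, x * y = y * x) → x = 1 ∨ x = z := by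
    intro x hx hxy
    by_cases h1 : x = 1
    · exact Or.inl h1
    · right
      let x0 : Subgroup.center E := ⟨⟨x, hx⟩, by
        rw [Subgroup.mem_center_iff]
        intro g
        ext
        exact (hxy g g.2).symm⟩
      have : x0 = z0 := huniq x0 (fun hh => h1 (congrArg (fun t : Subgroup.center E => ((t : E) : G)) hh))
      exact congrArg (fun t : Subgroup.center E => ((t : E) : G)) this
  have zE : z ∈ E := z0.1.2
  have z1 : z ≠ 1 := fun hh => hz0 (by ext; exact hh)
  have zy : ∀ y ∈ E, z * y = y * z := by
    intro y hy
    have := Subgroup.mem_center_iff.1 z0.2 ⟨y, hy⟩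
    exact (congrArg Subtype.val this).symm
  have zz : z * z = 1 := by
    have h := hcen (z * z) (E.mul_mem zE zE) (fun y hy => by
      rw [mul_assoc, zy y hy, ← mul_assoc, zy y hy, mul_assoc])
    rcases h with h | h
    · exact h
    · exact absurd (mul_eq_left.1 h) z1
  have zc : ∀ g, g * z = z * g := by
    intro g
    have h := hcen (g * z * g⁻¹) (hN.conj_mem z zE g) (fun y hy => by
      have h1 : g⁻¹ * y * g ∈ E := by simpa using hN.conj_mem y hy g⁻¹
      have h2 := zy _ h1
      calc g * z * g⁻¹ * y = g * (z * (g⁻¹ * y * g)) * g⁻¹ := by group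
        _ = _ := by rw [h2]; group)
    rcases h with h | h
    · exact absurd (conj_eq_one_iff.1 h) z1
    · exact mul_inv_eq_iff_eq_mul.1 h
  have comm : ∀ x ∈ E, ∀ y ∈ E, x * y = y * x ∨ x * y = y * x * z := by
    intro x hx y hy
    have h1 : (⟨x, hx⟩ * ⟨y, hy⟩ * ⟨x, hx⟩⁻¹ * ⟨y, hy⟩⁻¹ : E) ∈ commutator E :=
      Subgroup.commutator_mem_commutator (Subgroup.mem_top _) (Subgroup.mem_top _)
    rw [← hcc, Subgroup.mem_center_iff] at h1
    have h2 := hcen (x * y * x⁻¹ * y⁻¹)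
      (E.mul_mem (E.mul_mem (E.mul_mem hx hy) (E.inv_mem hx)) (E.inv_mem hy)) (fun w hw =>
        (congrArg Subtype.val (h1 ⟨w, hw⟩)).symm)
    rcases h2 with h | h
    · left
      rwa [mul_inv_eq_one, mul_inv_eq_iff_eq_mul] at h
    · right
      rw [mul_inv_eq_iff_eq_mul, mul_inv_eq_iff_eq_mul] at h
      rw [h, zc (y * x), mul_assoc]
  refine ⟨z, zE, z1, zz, zc, comm, ?_, hcen, hc, ?_⟩
  · intro x hx
    apply hcen _ (E.mul_mem hx hx)
    intro y hy
    rcases comm x hx y hy with h | h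
    · rw [mul_assoc, h, ← mul_assoc, h, mul_assoc]
    · calc x * x * y = x * (x * y) := by group
        _ = x * (y * x * z) := by rw [h]
        _ = (x * y) * x * z := by group
        _ = (y * x * z) * x * z := by rw [h]
        _ = y * x * (z * x) * z := by group
        _ = y * x * (x * z) * z := by rw [zc x]
        _ = y * (x * x) * (z * z) := by group
        _ = _ := by rw [zz, mul_one]
  · intro A hA hsq
    exact hab A hA (fun x hx => by rw [pow_two]; exact hsq x hx)

universe u

structure HF {H : Type u} [Group H] (Q : Subgroup H) : Prop where
  cQ : ∀ x ∈ Q, ∀ y ∈ Q, x * y * x⁻¹ * y⁻¹ ∈ Subgroup.center H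
  cube : ∀ x ∈ Q, x ^ 3 = 1
  cardQ : Nat.card Q = 3 ^ 9
  cardZ : Nat.card (Subgroup.center H) = 3
  cen : ∀ h, (∀ x ∈ Q, h * x = x * h) → h ∈ Subgroup.center H
  ZQ : Subgroup.center H ≤ Q

theorem hf_of {H : Type u} [Group H] [Finite H] {Q : Subgroup H} [Q.Normal]
    (hH : SimilarToF2Centralizer H Q) : HF Q := by
  have cen : ∀ h, (∀ x ∈ Q, h * x = x * h) → h ∈ Subgroup.center H := by
    intro h hh
    rw [← hH.centralizer_eq, Subgroup.mem_centralizer_iff]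
    exact fun x hx => (hh x hx).symm
  obtain ⟨-, hcc, -, h3⟩ := hH.extraspecial
  have cq : ∀ x : Q, x ∈ Subgroup.center Q → (x : H) ∈ Subgroup.center H := by
    intro x hx
    apply cen
    intro y hy
    exact (congrArg Subtype.val (Subgroup.mem_center_iff.1 hx ⟨y, hy⟩)).symm
  refine ⟨?_, hH.exponent3, hH.card_eq, ?_, cen, hH.center_le⟩
  · intro x hx y hy
    have h1 : (⟨x, hx⟩ * ⟨y, hy⟩ * ⟨x, hx⟩⁻¹ * ⟨y, hy⟩⁻¹ : Q) ∈ commutator Q :=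
      Subgroup.commutator_mem_commutator (Subgroup.mem_top _) (Subgroup.mem_top _)
    rw [← hcc] at h1
    exact cq _ h1
  · rw [← h3]
    apply Nat.card_congr
    refine ⟨fun x => ⟨⟨x, hH.center_le x.2⟩, ?_⟩, fun x => ⟨x, cq _ x.2⟩, fun x => rfl, fun x => rfl⟩
    rw [Subgroup.mem_center_iff]
    intro g
    ext
    exact Subgroup.mem_center_iff.1 x.2 g

theorem exV {H : Type u} [Group H] [Finite H] (Q : Subgroup H) [Q.Normal] (hF : HF Q) :
    ∃ (V : Type u) (_ : Finite V) (_ : AddCommGroup V) (_ : DistribMulAction (H ⧸ Q) V) (π : Q → V),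
      Function.Surjective π ∧ (∀ x y, π (x * y) = π x + π y) ∧
      (∀ x : Q, π x = 0 ↔ (x : H) ∈ Subgroup.center H) ∧
      (∀ (h : H) (x : Q), (h : H ⧸ Q) • π x = π (MulAut.conjNormal h x)) ∧
      Nat.card V = 3 ^ 8 := by
  let Z : Subgroup Q := (Subgroup.center H).subgroupOf Q
  have hZn : Z.Normal := Subgroup.normal_subgroupOf
  have hc : ∀ h : H, Z ≤ Z.comap (MulAut.conjNormal h : Q ≃* Q).toMonoidHom := by
    intro h x hx
    rw [Subgroup.mem_comap, Subgroup.mem_subgroupOf]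
    have : (x : H) ∈ Subgroup.center H := hx
    show ((MulAut.conjNormal h x : Q) : H) ∈ _
    rw [MulAut.conjNormal_apply]
    exact (inferInstance : (Subgroup.center H).Normal).conj_mem _ this h
  let Φ : H →* Monoid.End (Q ⧸ Z) :=
    { toFun := fun h => QuotientGroup.map Z Z _ (hc h)
      map_one' := by
        ext x
        obtain ⟨x, rfl⟩ := QuotientGroup.mk_surjective x
        show ((MulAut.conjNormal (1 : H) x : Q) : Q ⧸ Z) = (x : Q ⧸ Z)
        rw [map_one]; rfl
      map_mul' := by
        intro a b
        ext x
        obtain ⟨x, rfl⟩ := QuotientGroup.mk_surjective x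
        show ((MulAut.conjNormal (a * b) x : Q) : Q ⧸ Z) =
          ((MulAut.conjNormal a (MulAut.conjNormal b x) : Q) : Q ⧸ Z)
        rw [map_mul]; rfl }
  have hΦ : ∀ q ∈ Q, Φ q = 1 := by
    intro q hq
    ext x
    obtain ⟨x, rfl⟩ := QuotientGroup.mk_surjective x
    show ((MulAut.conjNormal q x : Q) : Q ⧸ Z) = (x : Q ⧸ Z)
    rw [QuotientGroup.eq_iff_div_mem, Subgroup.mem_subgroupOf]
    have := hF.cQ q hq x x.2
    simpa [div_eq_mul_inv] using this
  let Ψ : H ⧸ Q →* Monoid.End (Q ⧸ Z) := QuotientGroup.lift Q Φ hΦ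
  have hcomm : ∀ a b : Q ⧸ Z, a * b = b * a := by
    intro a b
    induction a using QuotientGroup.induction_on with | H x => ?_
    induction b using QuotientGroup.induction_on with | H y => ?_
    rw [← QuotientGroup.mk_mul, ← QuotientGroup.mk_mul, QuotientGroup.eq_iff_div_mem,
      Subgroup.mem_subgroupOf]
    have := hF.cQ x x.2 y y.2
    simpa [div_eq_mul_inv, mul_assoc] using this
  let i1 : AddCommGroup (Additive (Q ⧸ Z)) :=
    { (inferInstance : AddGroup (Additive (Q ⧸ Z))) with
      add_comm := fun a b => congrArg Additive.ofMul (hcomm a.toMul b.toMul) }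
  let i2 : DistribMulAction (H ⧸ Q) (Additive (Q ⧸ Z)) :=
    { smul := fun g v => Additive.ofMul (Ψ g v.toMul)
      one_smul := fun v => by
        show Additive.ofMul (Ψ 1 v.toMul) = v
        rw [map_one]; rfl
      mul_smul := fun a b v => by
        show Additive.ofMul (Ψ (a * b) v.toMul) = Additive.ofMul (Ψ a (Ψ b v.toMul))
        rw [map_mul]; rfl
      smul_zero := fun a => congrArg Additive.ofMul (map_one (Ψ a))
      smul_add := fun a v w => congrArg Additive.ofMul (map_mul (Ψ a) v.toMul w.toMul) }
  refine ⟨Additive (Q ⧸ Z), inferInstanceAs (Finite (Q ⧸ Z)), i1, i2,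
    fun x => Additive.ofMul (x : Q ⧸ Z), ?_, ?_, ?_, ?_, ?_⟩
  · intro v
    obtain ⟨x, hx⟩ := QuotientGroup.mk_surjective v.toMul
    exact ⟨x, congrArg Additive.ofMul hx⟩
  · intro x y; rfl
  · intro x
    exact (QuotientGroup.eq_one_iff (N := Z) x)
  · intro h x; rfl
  · have h := Subgroup.card_eq_card_quotient_mul_card_subgroup Z
    have e : Nat.card Z = 3 := by
      rw [← hF.cardZ]
      exact Nat.card_congr (Subgroup.subgroupOfEquivOfLe hF.ZQ).toEquiv
    rw [e, hF.cardQ] at h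
    have : Nat.card (Additive (Q ⧸ Z)) = Nat.card (Q ⧸ Z) := rfl
    rw [this]
    omega

end F2Aux

namespace F2Aux

universe u

theorem hpow {H : Type u} [Group H] {h x t : H} (e1 : h * x = t * x * h) (hc : h * t = t * h) :
    ∀ n : ℕ, h ^ n * x = t ^ n * x * h ^ n
  | 0 => by simp
  | n + 1 => by
    have hc' : h * t ^ n = t ^ n * h := (Commute.pow_right (show Commute h t from hc) n)
    rw [pow_succ' h, mul_assoc, hpow e1 hc n, ← mul_assoc, ← mul_assoc, hc', mul_assoc (t ^ n), e1,
      pow_succ t]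
    simp only [mul_assoc]

/-- commutation with `ρ`, as a homomorphism to the centre -/
def kap {H : Type u} [Group H] {Q : Subgroup H} (hF : HF Q) {ρ : H} (hρ : ρ ∈ Q) :
    Q →* Subgroup.center H where
  toFun q := ⟨q * ρ * (q : H)⁻¹ * ρ⁻¹, hF.cQ q q.2 ρ hρ⟩
  map_one' := by ext; simp
  map_mul' := by
    intro a b
    ext
    show (a * b : H) * ρ * (a * b : H)⁻¹ * ρ⁻¹ = (a * ρ * (a : H)⁻¹ * ρ⁻¹) * (b * ρ * (b : H)⁻¹ * ρ⁻¹)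
    have h := Subgroup.mem_center_iff.1 (hF.cQ b b.2 ρ hρ) (a * ρ * (a : H)⁻¹ * ρ⁻¹)
    have h2 := Subgroup.mem_center_iff.1 (hF.cQ b b.2 ρ hρ) a
    rw [h]
    calc (a * b : H) * ρ * (a * b : H)⁻¹ * ρ⁻¹ = (a * (b * ρ * (b : H)⁻¹ * ρ⁻¹)) * (ρ * (a : H)⁻¹ * ρ⁻¹) := by group
      _ = _ := by rw [h2]; group

theorem kap_coe {H : Type u} [Group H] {Q : Subgroup H} (hF : HF Q) {ρ : H} (hρ : ρ ∈ Q) (q : Q) :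
    (kap hF hρ q : H) = q * ρ * (q : H)⁻¹ * ρ⁻¹ := rfl

theorem kap_eq_one {H : Type u} [Group H] {Q : Subgroup H} (hF : HF Q) {ρ : H} (hρ : ρ ∈ Q) (q : Q) :
    kap hF hρ q = 1 ↔ (q : H) * ρ = ρ * q := by
  rw [Subtype.ext_iff, kap_coe, Subgroup.coe_one, mul_inv_eq_one, mul_inv_eq_iff_eq_mul]

theorem kap_surj {H : Type u} [Group H] [Finite H] {Q : Subgroup H} (hF : HF Q) {ρ : H} (hρ : ρ ∈ Q)
    (hZ : ρ ∉ Subgroup.center H) : Function.Surjective (kap hF hρ) := by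
  rw [← MonoidHom.range_eq_top]
  have : Fact (Nat.card (Subgroup.center H)).Prime := ⟨by rw [hF.cardZ]; norm_num⟩
  rcases Subgroup.eq_bot_or_eq_top_of_prime_card (kap hF hρ).range with h | h
  · exfalso
    apply hZ
    apply hF.cen
    intro x hx
    have : kap hF hρ ⟨x, hx⟩ ∈ (kap hF hρ).range := ⟨_, rfl⟩
    rw [h, Subgroup.mem_bot, kap_eq_one] at this
    exact this.symm
  · exact h

theorem mem_cent {H : Type u} [Group H] {ρ h : H} :
    h ∈ Subgroup.centralizer ({ρ} : Set H) ↔ h * ρ = ρ * h := by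
  rw [Subgroup.mem_centralizer_iff]
  simp only [Set.mem_singleton_iff, forall_eq]
  exact eq_comm

theorem card_CQ {H : Type u} [Group H] [Finite H] {Q : Subgroup H} (hF : HF Q) {ρ : H} (hρ : ρ ∈ Q)
    (hZ : ρ ∉ Subgroup.center H) :
    Nat.card (Q.subgroupOf (Subgroup.centralizer ({ρ} : Set H))) = 3 ^ 8 := by
  have e1 : (kap hF hρ).ker = (Subgroup.centralizer ({ρ} : Set H)).subgroupOf Q := by
    ext q
    rw [MonoidHom.mem_ker, kap_eq_one, Subgroup.mem_subgroupOf, mem_cent]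
  have e2 : Nat.card (Q.subgroupOf (Subgroup.centralizer ({ρ} : Set H))) =
      Nat.card ((Subgroup.centralizer ({ρ} : Set H)).subgroupOf Q) :=
    Nat.card_congr ⟨fun x => ⟨⟨x.1.1, x.2⟩, x.1.2⟩, fun x => ⟨⟨x.1.1, x.2⟩, x.1.2⟩,
      fun _ => rfl, fun _ => rfl⟩
  rw [e2, ← e1]
  have h1 := Subgroup.card_mul_index (kap hF hρ).ker
  rw [Subgroup.index_ker, MonoidHom.range_eq_top.2 (kap_surj hF hρ hZ), Subgroup.card_top,
    hF.cardZ, hF.cardQ] at h1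
  omega

theorem facts {H : Type u} [Group H] [Finite H] (Q : Subgroup H) [Q.Normal]
    (hH : SimilarToF2Centralizer H Q) (r : H) (hr : orderOf r = 2)
    (hrO2 : (r : H ⧸ Q) ∈ Op 2 (H ⧸ Q))
    (hrnc : (r : H ⧸ Q) ∉ Subgroup.centralizer ((Op 2 (H ⧸ Q)) : Set (H ⧸ Q)))
    (ρ : H) (hρQ : ρ ∈ Q) (hρr : ρ ∈ Subgroup.centralizer {r})
    (hρZ : ρ ∉ Subgroup.center H) :
    Nat.card (Subgroup.centralizer ({ρ} : Set H)) = 2 ^ 8 * 3 ^ 10 ∧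
    (∃ y ∈ Q, y * ρ ≠ ρ * y ∧ ∀ h ∈ Subgroup.centralizer ({ρ} : Set H),
      ∃ m : ℤ, h * y * h⁻¹ * y⁻¹ * ρ ^ m ∈ Subgroup.center H) ∧
    ∀ R : Subgroup H, R ≤ Subgroup.centralizer ({ρ} : Set H) →
      (∀ s ∈ Subgroup.centralizer ({ρ} : Set H), ∀ g ∈ R, s * g * s⁻¹ ∈ R) →
      (∀ g ∈ R, ∃ k, g ^ 3 ^ k = 1) → R ≤ Q := by
  have hF := hf_of hH
  obtain ⟨z, hE⟩ := eset_of (Op 2 (H ⧸ Q)) inferInstance hH.O2_extraspecial hH.O2_card hH.O2_minusType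
  have hN : (Op 2 (H ⧸ Q)).Normal := inferInstance
  have hCE := hH.O2_selfCentralizing
  have hcard : (Op 2 (H ⧸ Q)).index = 25920 := by
    obtain ⟨e⟩ := hH.quotient_iso
    rw [← card_psp]
    exact Nat.card_congr e.toEquiv
  obtain ⟨V, _, _, _, π, hπs, hπm, hπ0, hπc, hVc⟩ := exV Q hF
  have π1 : π 1 = 0 := (hπ0 1).2 (Subgroup.one_mem _)
  have hπi : ∀ x, π x⁻¹ = - π x := by
    intro x
    have := hπm x⁻¹ x
    rw [inv_mul_cancel, π1] at this
    exact eq_neg_of_add_eq_zero_left this.symm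
  have hπe : ∀ x x', π x = π x' ↔ ((x * x'⁻¹ : Q) : H) ∈ Subgroup.center H := by
    intro x x'
    rw [← hπ0, hπm, hπi, ← sub_eq_add_neg, sub_eq_zero]
  have hconj : ∀ (h : H) (x : Q), (h : H ⧸ Q) • π x = π x ↔
      h * x * h⁻¹ * (x : H)⁻¹ ∈ Subgroup.center H := by
    intro h x
    rw [hπc, hπe]
    simp
  have hV : VSet (H ⧸ Q) V := by
    have three : ∀ v : V, v + v + v = 0 := by
      intro v
      obtain ⟨x, rfl⟩ := hπs v
      rw [← hπm, ← hπm, hπ0]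
      have : ((x * x * x : Q) : H) = x ^ 3 := by push_cast; rw [pow_succ, pow_two]
      rw [this, hF.cube x x.2]
      exact Subgroup.one_mem _
    have h3 : ∀ g : H ⧸ Q, (∀ v : V, g • v = v) → g ^ 3 = 1 := by
      intro g hg
      obtain ⟨h, rfl⟩ := QuotientGroup.mk_surjective g
      rw [← QuotientGroup.mk_pow, QuotientGroup.eq_one_iff]
      apply hF.ZQ
      apply hF.cen
      intro x hx
      have h1 := (hconj h ⟨x, hx⟩).1 (hg _)
      have h2 := hF.cube _ (hF.ZQ h1)
      set t := h * x * h⁻¹ * x⁻¹ with ht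
      have hc := Subgroup.mem_center_iff.1 h1
      have e1 : h * x = t * x * h := by rw [ht]; group
      rw [hpow e1 (hc h) 3, h2, one_mul]
    refine ⟨three, hVc, ?_⟩
    intro g hg
    have hgE : g ∈ Op 2 (H ⧸ Q) := by
      apply hCE
      rw [Subgroup.mem_centralizer_iff]
      intro e he
      have hw : g * e * g⁻¹ * e⁻¹ = 1 := by
        apply eq_one_of_coprime (a := 3) (b := 4) (by norm_num)
        · apply h3
          intro v
          have gi : ∀ v : V, g⁻¹ • v = v := fun v => by rw [inv_smul_eq_iff, hg]
          rw [mul_smul, mul_smul, mul_smul, gi, smul_inv_smul, hg]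
        · exact pow4 hE ((Op 2 (H ⧸ Q)).mul_mem (hN.conj_mem e he g) ((Op 2 (H ⧸ Q)).inv_mem he))
      rw [mul_inv_eq_one, mul_inv_eq_iff_eq_mul] at hw
      exact hw.symm
    exact eq_one_of_coprime (a := 3) (b := 4) (by norm_num) (h3 g hg) (pow4 hE hgE)
  have hnc : NC (Op 2 (H ⧸ Q)) z (r : H ⧸ Q) := by
    refine ⟨hrO2, ?_, ?_, ?_⟩
    · have := pow_orderOf_eq_one r
      rw [hr, pow_two] at this
      rw [← QuotientGroup.mk_mul, this]; rfl
    · intro h1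
      exact hrnc (h1 ▸ Subgroup.one_mem _)
    · intro h1
      apply hrnc
      rw [h1, Subgroup.mem_centralizer_iff]
      exact fun g _ => hE.zc g
  set v := π ⟨ρ, hρQ⟩ with hv_def
  have hv : v ≠ 0 := fun h => hρZ ((hπ0 _).1 h)
  have hrv : (r : H ⧸ Q) • v = v := by
    rw [hconj]
    have := mem_cent.1 hρr
    show r * ρ * r⁻¹ * ρ⁻¹ ∈ _
    rw [← this, mul_inv_cancel_right, mul_inv_cancel]
    exact Subgroup.one_mem _
  obtain ⟨B, hB⟩ := conf hE hV hnc hv hrv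
  have hS := (exK hE hN hCE hcard hV hnc hv hrv hB).1
  have hSt : ∀ h ∈ Subgroup.centralizer ({ρ} : Set H), (h : H ⧸ Q) • v = v := by
    intro h hh
    rw [hconj]
    have := mem_cent.1 hh
    show h * ρ * h⁻¹ * ρ⁻¹ ∈ _
    rw [this, mul_inv_cancel_right, mul_inv_cancel]
    exact Subgroup.one_mem _
  have hLift : ∀ g : H ⧸ Q, g • v = v → ∃ h ∈ Subgroup.centralizer ({ρ} : Set H), (h : H ⧸ Q) = g := by
    intro g hg
    obtain ⟨h, rfl⟩ := QuotientGroup.mk_surjective g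
    have h1 : h * ρ * h⁻¹ * ρ⁻¹ ∈ Subgroup.center H := (hconj h ⟨ρ, hρQ⟩).1 hg
    obtain ⟨q, hq⟩ := kap_surj hF hρQ hρZ ⟨_, h1⟩
    have hq' : (q : H) * ρ * (q : H)⁻¹ * ρ⁻¹ = h * ρ * h⁻¹ * ρ⁻¹ := congrArg Subtype.val hq
    have hq2 : (q : H) * ρ * (q : H)⁻¹ = h * ρ * h⁻¹ := mul_right_cancel hq'
    refine ⟨(q : H)⁻¹ * h, ?_, ?_⟩
    · rw [mem_cent]
      calc (q : H)⁻¹ * h * ρ = (q : H)⁻¹ * (h * ρ * h⁻¹) * h := by group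
        _ = _ := by rw [← hq2]; group
    · rw [QuotientGroup.mk_mul, (QuotientGroup.eq_one_iff _).2 (Q.inv_mem q.2), one_mul]
  refine ⟨?_, ?_, ?_⟩
  · let θ : Subgroup.centralizer ({ρ} : Set H) →* H ⧸ Q :=
      (QuotientGroup.mk' Q).comp (Subgroup.centralizer ({ρ} : Set H)).subtype
    have hk : θ.ker = Q.subgroupOf (Subgroup.centralizer ({ρ} : Set H)) := by
      ext x
      rw [MonoidHom.mem_ker, Subgroup.mem_subgroupOf]
      exact QuotientGroup.eq_one_iff (N := Q) (x : H)
    have hrg : θ.range = MulAction.stabilizer (H ⧸ Q) v := by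
      ext g
      rw [MonoidHom.mem_range, MulAction.mem_stabilizer_iff]
      constructor
      · rintro ⟨x, rfl⟩
        exact hSt x x.2
      · intro hg
        obtain ⟨h, hh, rfl⟩ := hLift g hg
        exact ⟨⟨h, hh⟩, rfl⟩
    have h1 := Subgroup.card_mul_index θ.ker
    rw [Subgroup.index_ker, hrg, hS, hk, card_CQ hF hρQ hρZ] at h1
    rw [← h1]; norm_num
  · have kw : ∀ x x' : Q, π x = π x' → kap hF hρQ x = kap hF hρQ x' := by
      intro x x' h
      rw [hπe] at h
      have : kap hF hρQ (x * x'⁻¹) = 1 := by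
        rw [kap_eq_one]
        exact (Subgroup.mem_center_iff.1 h ρ).symm
      rwa [map_mul, map_inv, mul_inv_eq_one] at this
    let iC : CommGroup (Subgroup.center H) :=
      { (inferInstance : Group (Subgroup.center H)) with
        mul_comm := fun a b => Subtype.ext (Subgroup.mem_center_iff.1 b.2 a) }
    let χ : V →+ Additive (Subgroup.center H) :=
      { toFun := fun w => Additive.ofMul (kap hF hρQ (Function.surjInv hπs w))
        map_zero' := by
          rw [kw _ 1 (by rw [Function.surjInv_eq hπs, π1]), map_one]; rfl
        map_add' := by
          intro a b
          rw [kw _ (Function.surjInv hπs a * Function.surjInv hπs b)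
            (by rw [hπm]; simp only [Function.surjInv_eq hπs]), map_mul]; rfl }
    have hχ : ∀ x : Q, χ (π x) = Additive.ofMul (kap hF hρQ x) := by
      intro x
      exact congrArg Additive.ofMul (kw _ x (Function.surjInv_eq hπs _))
    obtain ⟨w, hw⟩ : ∃ w : Q, kap hF hρQ w ≠ 1 := by
      by_contra! hcon
      apply hρZ
      apply hF.cen
      intro x hx
      exact ((kap_eq_one hF hρQ ⟨x, hx⟩).1 (hcon _)).symm
    have hχg : ∀ g : H ⧸ Q, g • v = v → ∀ u, χ (g • u) = χ u := by
      intro g hg u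
      obtain ⟨h, hh, rfl⟩ := hLift g hg
      obtain ⟨x, rfl⟩ := hπs u
      rw [hπc, hχ, hχ]
      congr 1
      ext
      rw [kap_coe, kap_coe, MulAut.conjNormal_apply]
      have h1 := mem_cent.1 hh
      have h2 : h⁻¹ * ρ * h = ρ := by rw [mul_assoc, ← h1, inv_mul_cancel_left]
      have h3 : h * ρ⁻¹ * h⁻¹ = ρ⁻¹ := by
        nth_rw 1 [← h2]; group
      have h4 := Subgroup.mem_center_iff.1 (hF.cQ x x.2 ρ hρQ) h
      calc h * x * h⁻¹ * ρ * (h * x * h⁻¹)⁻¹ * ρ⁻¹ = h * x * (h⁻¹ * ρ * h) * (x : H)⁻¹ * h⁻¹ * ρ⁻¹ := by group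
        _ = h * (x * ρ * (x : H)⁻¹ * ρ⁻¹) * (ρ * h⁻¹ * ρ⁻¹) := by rw [h2]; group
        _ = (x * ρ * (x : H)⁻¹ * ρ⁻¹) * (h * ρ * h⁻¹ * ρ⁻¹) := by rw [h4]; group
        _ = _ := by rw [h1, mul_inv_cancel_right, mul_inv_cancel, mul_one]
    have hχv : χ v = 0 := by
      rw [hv_def, hχ, (kap_eq_one hF hρQ _).2 rfl]; rfl
    have hχw : χ (π w) ≠ 0 := by
      rw [hχ]; exact hw
    obtain ⟨y, hy, hyy⟩ := exists_y (M := Additive (Subgroup.center H)) hE hV hN hnc hv hrv χ hχg hχv (π w) hχw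
    obtain ⟨y, rfl⟩ := hπs y
    refine ⟨y, y.2, ?_, ?_⟩
    · rw [hχ] at hy
      exact fun h => hy ((kap_eq_one hF hρQ y).2 h)
    · intro h hh
      obtain ⟨m, hm⟩ := AddSubgroup.mem_zmultiples_iff.1 (hyy h (hSt h hh))
      refine ⟨-m, ?_⟩
      have πz : ∀ (x : Q) (m : ℤ), π (x ^ m) = m • π x := by
        intro x m
        let f : Additive Q →+ V := { toFun := fun a => π a.toMul, map_zero' := π1, map_add' := fun a b => hπm _ _ }
        exact map_zsmul f m (Additive.ofMul x)
      rw [hπc, sub_eq_add_neg, ← hπi, ← hπm, hv_def, ← πz, eq_comm, hπe] at hm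
      simpa using hm
  · intro R hR hRn hR3 g hg
    have := no_three hE hN hCE hcard hV hnc hv hrv (R.map (QuotientGroup.mk' Q)) (by
      rintro _ ⟨x, hx, rfl⟩
      exact hSt x (hR hx)) (by
      rintro s hs _ ⟨x, hx, rfl⟩
      obtain ⟨h, hh, rfl⟩ := hLift s hs
      exact ⟨_, hRn h hh x hx, rfl⟩) (by
      rintro _ ⟨x, hx, rfl⟩
      obtain ⟨k, hk⟩ := hR3 x hx
      exact ⟨k, by rw [← map_pow, hk, map_one]⟩) _ ⟨g, hg, rfl⟩
    exact (QuotientGroup.eq_one_iff (N := Q) g).1 this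

end F2Aux

namespace F2Aux

theorem exsp {P : Type*} [Group P] [Finite P] (h3 : ∀ x : P, x ^ 3 = 1)
    (hc : Nat.card (Subgroup.center P) = 3)
    (hcomm : ∀ x y : P, x * y * x⁻¹ * y⁻¹ ∈ Subgroup.center P)
    (hne : ∃ x y : P, x * y ≠ y * x) : IsExtraspecial 3 P := by
  have hP : Fact (Nat.card (Subgroup.center P)).Prime := ⟨by rw [hc]; norm_num⟩
  have hsub : ∀ K : Subgroup P, K ≤ Subgroup.center P → K ≠ ⊥ → K = Subgroup.center P := by
    intro K hK hb
    rcases Subgroup.eq_bot_or_eq_top_of_prime_card (K.subgroupOf (Subgroup.center P)) with h | h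
    · exfalso
      apply hb
      rw [Subgroup.subgroupOf_eq_bot, disjoint_iff] at h
      rwa [inf_eq_left.2 hK] at h
    · exact le_antisymm hK (Subgroup.subgroupOf_eq_top.1 h)
  have hcle : commutator P ≤ Subgroup.center P := by
    rw [commutator_def, Subgroup.commutator_le]
    intro x _ y _
    exact hcomm x y
  have hcc : commutator P = Subgroup.center P := by
    apply hsub _ hcle
    intro hb
    obtain ⟨x, y, hxy⟩ := hne
    apply hxy
    have : x * y * x⁻¹ * y⁻¹ ∈ commutator P :=
      Subgroup.commutator_mem_commutator (Subgroup.mem_top x) (Subgroup.mem_top y)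
    rw [hb, Subgroup.mem_bot, mul_inv_eq_one, mul_inv_eq_iff_eq_mul] at this
    exact this
  refine ⟨fun x => ⟨1, by rw [pow_one]; exact h3 x⟩, hcc.symm, ?_, hc⟩
  apply le_antisymm
  · unfold frattini Order.radical
    refine le_iInf₂ fun M hM => ?_
    by_contra hcon
    have htop : M ⊔ Subgroup.center P = ⊤ := by
      apply hM.2
      rw [left_lt_sup]
      exact hcon
    apply hcon
    rw [← hcc, commutator_def, Subgroup.commutator_le]
    have hd : ∀ x : P, ∃ m ∈ M, ∃ c ∈ Subgroup.center P, m * c = x := by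
      intro x
      have : x ∈ M ⊔ Subgroup.center P := htop ▸ Subgroup.mem_top x
      exact Subgroup.mem_sup_of_normal_right.1 this
    intro x _ y _
    obtain ⟨m, hm, c, hc, rfl⟩ := hd x
    obtain ⟨n, hn, d, hd, rfl⟩ := hd y
    rw [commutatorElement_def]
    have e : m * c * (n * d) * (m * c)⁻¹ * (n * d)⁻¹ = m * n * m⁻¹ * n⁻¹ := by
      have hc' := Subgroup.mem_center_iff.1 hc
      have hd' := Subgroup.mem_center_iff.1 hd
      calc m * c * (n * d) * (m * c)⁻¹ * (n * d)⁻¹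
          = m * c * ((n * d) * c⁻¹) * m⁻¹ * d⁻¹ * n⁻¹ := by group
        _ = m * c * (c⁻¹ * (n * d)) * m⁻¹ * d⁻¹ * n⁻¹ := by
            rw [Subgroup.mem_center_iff.1 ((Subgroup.center P).inv_mem hc)]
        _ = m * n * (d * m⁻¹) * d⁻¹ * n⁻¹ := by group
        _ = m * n * (m⁻¹ * d) * d⁻¹ * n⁻¹ := by rw [hd']
        _ = _ := by group
    rw [e]
    exact M.mul_mem (M.mul_mem (M.mul_mem hm hn) (M.inv_mem hm)) (M.inv_mem hn)
  · intro x hx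
    rw [Subgroup.mem_center_iff]
    intro w
    by_contra hxw
    let φ : P →* Subgroup.center P :=
      { toFun := fun u => ⟨u * w * u⁻¹ * w⁻¹, hcomm u w⟩
        map_one' := by ext; simp
        map_mul' := by
          intro a b
          ext
          show (a * b) * w * (a * b)⁻¹ * w⁻¹ = (a * w * a⁻¹ * w⁻¹) * (b * w * b⁻¹ * w⁻¹)
          have h := Subgroup.mem_center_iff.1 (hcomm b w) (a * w * a⁻¹ * w⁻¹)
          have h2 := Subgroup.mem_center_iff.1 (hcomm b w) a
          rw [h]
          calc (a * b) * w * (a * b)⁻¹ * w⁻¹ = (a * (b * w * b⁻¹ * w⁻¹)) * (w * a⁻¹ * w⁻¹) := by group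
            _ = _ := by rw [h2]; group }
    have hφ : ∀ u, φ u = 1 ↔ u * w = w * u := by
      intro u
      rw [Subtype.ext_iff]
      show u * w * u⁻¹ * w⁻¹ = 1 ↔ _
      rw [mul_inv_eq_one, mul_inv_eq_iff_eq_mul]
    have hxk : x ∉ φ.ker := by
      rw [MonoidHom.mem_ker, hφ]
      exact fun h => hxw h.symm
    have hr : φ.range = ⊤ := by
      rcases Subgroup.eq_bot_or_eq_top_of_prime_card φ.range with h | h
      · exfalso
        apply hxk
        have : φ x ∈ φ.range := ⟨x, rfl⟩
        rwa [h, Subgroup.mem_bot] at this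
      · exact h
    have hi : φ.ker.index = 3 := by
      rw [Subgroup.index_ker, hr, Subgroup.card_top, hc]
    have hco : IsCoatom φ.ker := by
      refine ⟨fun h => hxk (h ▸ Subgroup.mem_top x), ?_⟩
      intro K hK
      have h1 := Subgroup.relIndex_mul_index hK.le
      rw [hi] at h1
      rcases (Nat.prime_three.eq_one_or_self_of_dvd K.index ⟨_, by rw [mul_comm, h1]⟩) with h | h
      · exact Subgroup.index_eq_one.1 h
      · exfalso
        rw [h] at h1
        have : φ.ker.relIndex K = 1 := by omega
        exact hK.not_ge (Subgroup.relIndex_eq_one.1 this)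
    exact hxk (frattini_le_coatom hco hx)

end F2Aux

namespace F2Aux

universe u

variable {H : Type u} [Group H] [Finite H] {Q : Subgroup H}

theorem mem_zpow_symm (hF : HF Q) {ρ x : H} (hρ : ρ ∈ Q) (hρ1 : ρ ≠ 1)
    (hx : x ∈ Subgroup.zpowers ρ) (hx1 : x ≠ 1) : ρ ∈ Subgroup.zpowers x := by
  have ho : orderOf ρ = 3 := orderOf_eq_prime (hF.cube ρ hρ) hρ1
  have : Fact (Nat.Prime 3) := ⟨Nat.prime_three⟩
  have hc : Nat.card (Subgroup.zpowers ρ) = 3 := by rw [Nat.card_zpowers, ho]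
  have h := mem_zpowers_of_prime_card (g := (⟨x, hx⟩ : Subgroup.zpowers ρ))
    (g' := ⟨ρ, Subgroup.mem_zpowers ρ⟩) hc (fun h => hx1 (congrArg Subtype.val h))
  obtain ⟨k, hk⟩ := h
  exact ⟨k, congrArg Subtype.val hk⟩

theorem zpow_center (hF : HF Q) {ρ x : H} (hρ : ρ ∈ Q) (hZ : ρ ∉ Subgroup.center H)
    (hx : x ∈ Subgroup.zpowers ρ) (hxZ : x ∈ Subgroup.center H) : x = 1 := by
  by_contra h1
  have hρ1 : ρ ≠ 1 := fun h => hZ (h ▸ Subgroup.one_mem _)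
  have := mem_zpow_symm hF hρ hρ1 hx h1
  exact hZ ((Subgroup.zpowers_le.2 hxZ) this)

theorem zpow_comm {ρ x h : H} (hx : x ∈ Subgroup.zpowers ρ)
    (hh : h ∈ Subgroup.centralizer ({ρ} : Set H)) : h * x = x * h := by
  obtain ⟨k, rfl⟩ := hx
  exact (Commute.zpow_right (show Commute h ρ from mem_cent.1 hh) k)

theorem exists_zpow (hF : HF Q) {ρ y t : H} (hρ : ρ ∈ Q) (hy : y ∈ Q) (hyρ : y * ρ ≠ ρ * y)
    (ht : t ∈ Subgroup.center H) : ∃ k : ℤ, ρ ^ k * y * (ρ ^ k)⁻¹ * y⁻¹ = t := by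
  have : Fact (Nat.Prime 3) := ⟨Nat.prime_three⟩
  obtain ⟨k, hk⟩ := mem_zpowers_of_prime_card (g := kap hF hy ⟨ρ, hρ⟩) (g' := ⟨t, ht⟩) hF.cardZ
    (fun h => hyρ ((kap_eq_one hF hy _).1 h).symm)
  refine ⟨k, ?_⟩
  simp only [← map_zpow] at hk
  exact congrArg Subtype.val hk

theorem splitting (hF : HF Q) {ρ y : H} (hρ : ρ ∈ Q) (hZ : ρ ∉ Subgroup.center H) (hy : y ∈ Q)
    (hyρ : y * ρ ≠ ρ * y)
    (hyy : ∀ h ∈ Subgroup.centralizer ({ρ} : Set H),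
      ∃ m : ℤ, h * y * h⁻¹ * y⁻¹ * ρ ^ m ∈ Subgroup.center H) :
    ∃ C : Subgroup H, C ≤ Subgroup.centralizer {ρ} ∧
      (∀ g ∈ Subgroup.centralizer ({ρ} : Set H), ∀ c ∈ C, g * c * g⁻¹ ∈ C) ∧
      Subgroup.zpowers ρ ⊔ C = Subgroup.centralizer {ρ} ∧
      Subgroup.zpowers ρ ⊓ C = ⊥ := by
  have hρ1 : ρ ≠ 1 := fun h => hZ (h ▸ Subgroup.one_mem _)
  have hzl : Subgroup.zpowers ρ ≤ Subgroup.centralizer ({ρ} : Set H) := by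
    rw [Subgroup.zpowers_le, mem_cent]
  let C : Subgroup H :=
    { carrier := {h | h ∈ Subgroup.centralizer ({ρ} : Set H) ∧ h * y * h⁻¹ * y⁻¹ ∈ Subgroup.zpowers ρ}
      one_mem' := ⟨Subgroup.one_mem _, by simp [Subgroup.one_mem]⟩
      mul_mem' := by
        rintro a b ⟨ha, ha'⟩ ⟨hb, hb'⟩
        refine ⟨Subgroup.mul_mem _ ha hb, ?_⟩
        have e := zpow_comm hb' ha
        have : a * b * y * (a * b)⁻¹ * y⁻¹ = (b * y * b⁻¹ * y⁻¹) * (a * y * a⁻¹ * y⁻¹) := by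
          calc a * b * y * (a * b)⁻¹ * y⁻¹ = (a * (b * y * b⁻¹ * y⁻¹)) * (y * a⁻¹ * y⁻¹) := by group
            _ = _ := by rw [e]; group
        rw [this]
        exact Subgroup.mul_mem _ hb' ha'
      inv_mem' := by
        rintro a ⟨ha, ha'⟩
        refine ⟨Subgroup.inv_mem _ ha, ?_⟩
        have hi := Subgroup.inv_mem _ ha'
        have e := zpow_comm hi (Subgroup.inv_mem _ ha)
        have : a⁻¹ * y * a⁻¹⁻¹ * y⁻¹ = (a * y * a⁻¹ * y⁻¹)⁻¹ := by
          calc a⁻¹ * y * a⁻¹⁻¹ * y⁻¹ = (a⁻¹ * (a * y * a⁻¹ * y⁻¹)⁻¹) * a := by group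
            _ = _ := by rw [e]; group
        rw [this]
        exact hi }
  have hCm : ∀ h, h ∈ C ↔ h ∈ Subgroup.centralizer ({ρ} : Set H) ∧
    h * y * h⁻¹ * y⁻¹ ∈ Subgroup.zpowers ρ := fun h => Iff.rfl
  have hCl : C ≤ Subgroup.centralizer ({ρ} : Set H) := fun h hh => hh.1
  have hdec : ∀ h ∈ Subgroup.centralizer ({ρ} : Set H), ∃ p ∈ Subgroup.zpowers ρ, ∃ c ∈ C, h = p * c := by
    intro h hh
    obtain ⟨m, hm⟩ := hyy h hh
    obtain ⟨k, hk⟩ := exists_zpow hF hρ hy hyρ (Subgroup.inv_mem _ hm)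
    have hp : ρ ^ k ∈ Subgroup.zpowers ρ := ⟨k, rfl⟩
    have hm' : ρ ^ m ∈ Subgroup.zpowers ρ := ⟨m, rfl⟩
    refine ⟨(ρ ^ k)⁻¹, Subgroup.inv_mem _ hp, ρ ^ k * h, ?_, by group⟩
    rw [hCm]
    refine ⟨Subgroup.mul_mem _ (hzl hp) hh, ?_⟩
    set t := h * y * h⁻¹ * y⁻¹ * ρ ^ m with ht
    have hfc : h * y * h⁻¹ * y⁻¹ = t * (ρ ^ m)⁻¹ := by rw [ht, mul_inv_cancel_right]
    have hc := Subgroup.mem_center_iff.1 hm (ρ ^ k)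
    have : ρ ^ k * h * y * (ρ ^ k * h)⁻¹ * y⁻¹ = (ρ ^ m)⁻¹ := by
      calc ρ ^ k * h * y * (ρ ^ k * h)⁻¹ * y⁻¹ = ρ ^ k * (h * y * h⁻¹ * y⁻¹) * (y * (ρ ^ k)⁻¹ * y⁻¹) := by group
        _ = (ρ ^ k * t) * (ρ ^ m)⁻¹ * (y * (ρ ^ k)⁻¹ * y⁻¹) := by rw [hfc]; group
        _ = (ρ ^ m)⁻¹ * (t * (ρ ^ k * y * (ρ ^ k)⁻¹ * y⁻¹)) := by
          have hc2 := Subgroup.mem_center_iff.1 hm (ρ ^ m)⁻¹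
          rw [hc, ← mul_assoc ((ρ ^ m)⁻¹), hc2]; group
        _ = _ := by rw [hk, mul_inv_cancel, mul_one]
    rw [this]
    exact Subgroup.inv_mem _ hm'
  refine ⟨C, hCl, ?_, ?_, ?_⟩
  · intro g hg c hc
    obtain ⟨p, hp, c', hc', rfl⟩ := hdec g hg
    have h1 : c' * c * c'⁻¹ ∈ C := C.mul_mem (C.mul_mem hc' hc) (C.inv_mem hc')
    have : p * c' * c * (p * c')⁻¹ = c' * c * c'⁻¹ := by
      calc p * c' * c * (p * c')⁻¹ = (p * (c' * c * c'⁻¹)) * p⁻¹ := by group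
        _ = _ := by rw [← zpow_comm hp (hCl h1), mul_inv_cancel_right]
    rw [this]
    exact h1
  · apply le_antisymm (sup_le hzl hCl)
    intro h hh
    obtain ⟨p, hp, c, hc, rfl⟩ := hdec h hh
    exact Subgroup.mul_mem_sup hp hc
  · rw [eq_bot_iff]
    rintro x ⟨hx, hxC⟩
    rw [Subgroup.mem_bot]
    by_contra hx1
    have hxQ : x ∈ Q := (Subgroup.zpowers_le.2 hρ) hx
    have h1 := zpow_center hF hρ hZ ((hCm x).1 hxC).2 (hF.cQ x hxQ y hy)
    rw [mul_inv_eq_one, mul_inv_eq_iff_eq_mul] at h1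
    apply hyρ
    exact zpow_comm (mem_zpow_symm hF hρ hρ1 hx hx1) (mem_cent.2 h1.symm)

end F2Aux

namespace F2Aux

universe u

variable {H : Type u} [Group H] [Finite H] {Q : Subgroup H}

/-- elements of `C_Q(ρ)` commuting with `C_Q(ρ)` modulo `⟨ρ⟩` -/
theorem central_CQ (hF : HF Q) {ρ y q : H} (hρ : ρ ∈ Q) (hZ : ρ ∉ Subgroup.center H) (hy : y ∈ Q)
    (hyρ : y * ρ ≠ ρ * y) (hq : q ∈ Q) (hqc : q * ρ = ρ * q)
    (h : ∀ u ∈ Q, u * ρ = ρ * u → q * u * q⁻¹ * u⁻¹ ∈ Subgroup.zpowers ρ) :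
    ∃ k : ℤ, ρ ^ k * q ∈ Subgroup.center H := by
  obtain ⟨k, hk⟩ := exists_zpow hF hρ hy hyρ (Subgroup.inv_mem _ (hF.cQ q hq y hy))
  have hkQ : ρ ^ k ∈ Q := Q.zpow_mem hρ k
  refine ⟨k, ?_⟩
  have hpy : (ρ ^ k * q) * y = y * (ρ ^ k * q) := by
    have := (kap_eq_one hF hy (⟨ρ ^ k, hkQ⟩ * ⟨q, hq⟩)).1 (by
      rw [map_mul, mul_eq_one_iff_eq_inv]
      ext
      exact hk)
    exact this
  have hpu : ∀ u ∈ Q, u * ρ = ρ * u → (ρ ^ k * q) * u = u * (ρ ^ k * q) := by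
    intro u hu huρ
    have h1 := zpow_center hF hρ hZ (h u hu huρ) (hF.cQ q hq u hu)
    rw [mul_inv_eq_one, mul_inv_eq_iff_eq_mul] at h1
    have h2 : u * ρ ^ k = ρ ^ k * u := zpow_comm ⟨k, rfl⟩ (mem_cent.2 huρ)
    rw [mul_assoc, h1, ← mul_assoc, ← h2, mul_assoc]
  apply hF.cen
  intro x hx
  obtain ⟨j, hj⟩ := exists_zpow hF hy hρ (fun e => hyρ e.symm) (hF.cQ x hx ρ hρ)
  have hj' : y ^ j * ρ * (y ^ j)⁻¹ = x * ρ * x⁻¹ := mul_right_cancel hj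
  have hu := hpu ((y ^ j)⁻¹ * x) (Q.mul_mem (Q.inv_mem (Q.zpow_mem hy j)) hx) (by
    calc (y ^ j)⁻¹ * x * ρ = (y ^ j)⁻¹ * (x * ρ * x⁻¹) * x := by group
      _ = _ := by rw [← hj']; group)
  have hyj : (ρ ^ k * q) * y ^ j = y ^ j * (ρ ^ k * q) :=
    (Commute.zpow_right (show Commute (ρ ^ k * q) y from hpy) j)
  generalize ρ ^ k * q = p at *
  calc p * x = (p * y ^ j) * ((y ^ j)⁻¹ * x) := by group
    _ = y ^ j * (p * ((y ^ j)⁻¹ * x)) := by rw [hyj]; group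
    _ = x * p := by rw [hu]; group

theorem pow27 (hF : HF Q) [hQ : Q.Normal] {ρ h : H} (hρ : ρ ∈ Q) (hh : h * ρ = ρ * h)
    (hu : ∀ u ∈ Q, u * ρ = ρ * u → h * u * h⁻¹ * u⁻¹ ∈ Subgroup.zpowers ρ) : h ^ 27 = 1 := by
  have g1 : ∀ u ∈ Q, u * ρ = ρ * u → h ^ 3 * u = u * h ^ 3 := by
    intro u hu1 hu2
    have ht := hu u hu1 hu2
    set t := h * u * h⁻¹ * u⁻¹ with htd
    have e1 : h * u = t * u * h := by rw [htd]; group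
    have ht3 : t ^ 3 = 1 := hF.cube t ((Subgroup.zpowers_le.2 hρ) ht)
    rw [hpow e1 (zpow_comm ht (mem_cent.2 hh)) 3, ht3, one_mul]
  have hg : h ^ 3 * ρ = ρ * h ^ 3 := g1 ρ hρ rfl
  generalize hgd : h ^ 3 = g at *
  have g3 : g ^ 3 ∈ Subgroup.center H := by
    apply hF.cen
    intro x hx
    set w := g * x * g⁻¹ * x⁻¹ with hw
    have e1 : g * x = w * x * g := by rw [hw]; group
    have hgx : g * x * g⁻¹ ∈ Q := hQ.conj_mem x hx g
    have hwQ : w ∈ Q := Q.mul_mem hgx (Q.inv_mem hx)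
    have hwρ : w * ρ = ρ * w := by
      have := (kap_eq_one hF hρ (⟨g * x * g⁻¹, hgx⟩ * ⟨x, hx⟩⁻¹)).1 (by
        rw [map_mul, map_inv, mul_inv_eq_one]
        ext
        rw [kap_coe, kap_coe]
        show g * x * g⁻¹ * ρ * (g * x * g⁻¹)⁻¹ * ρ⁻¹ = x * ρ * x⁻¹ * ρ⁻¹
        have hg' : g⁻¹ * ρ * g = ρ := by rw [mul_assoc, ← hg, inv_mul_cancel_left]
        have hc := Subgroup.mem_center_iff.1 (hF.cQ x hx ρ hρ) g
        calc g * x * g⁻¹ * ρ * (g * x * g⁻¹)⁻¹ * ρ⁻¹ = g * x * (g⁻¹ * ρ * g) * x⁻¹ * g⁻¹ * ρ⁻¹ := by group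
          _ = (g * (x * ρ * x⁻¹ * ρ⁻¹)) * (ρ * g⁻¹ * ρ⁻¹) := by rw [hg']; group
          _ = (x * ρ * x⁻¹ * ρ⁻¹) * ((g * ρ) * g⁻¹ * ρ⁻¹) := by rw [hc]; group
          _ = _ := by rw [hg]; group)
      exact this
    rw [hpow e1 (g1 w hwQ hwρ) 3, hF.cube w hwQ, one_mul]
  have := hF.cube _ (hF.ZQ g3)
  rw [← pow_mul, ← hgd, ← pow_mul] at this
  exact this

theorem final (hF : HF Q) [hQ : Q.Normal] {ρ y : H} (hρ : ρ ∈ Q) (hZ : ρ ∉ Subgroup.center H)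
    (hy : y ∈ Q) (hyρ : y * ρ ≠ ρ * y)
    (hR : ∀ R : Subgroup H, R ≤ Subgroup.centralizer ({ρ} : Set H) →
      (∀ s ∈ Subgroup.centralizer ({ρ} : Set H), ∀ g ∈ R, s * g * s⁻¹ ∈ R) →
      (∀ g ∈ R, ∃ k, g ^ 3 ^ k = 1) → R ≤ Q) :
    ∃ P : Subgroup (Subgroup.centralizer ({ρ} : Set H) ⧸
        (Subgroup.zpowers ρ).subgroupOf (Subgroup.centralizer {ρ})),
      Op 3 (Subgroup.centralizer ({ρ} : Set H) ⧸
        (Subgroup.zpowers ρ).subgroupOf (Subgroup.centralizer {ρ})) = P ∧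
      IsExtraspecial 3 P ∧ Nat.card P = 3 ^ 7 ∧
      Subgroup.centralizer (P : Set (Subgroup.centralizer ({ρ} : Set H) ⧸
        (Subgroup.zpowers ρ).subgroupOf (Subgroup.centralizer {ρ}))) =
        Subgroup.map P.subtype (Subgroup.center P) := by
  set CH := Subgroup.centralizer ({ρ} : Set H) with hCH
  have hρ1 : ρ ≠ 1 := fun h => hZ (h ▸ Subgroup.one_mem _)
  have hWl : Subgroup.zpowers ρ ≤ CH := by
    rw [Subgroup.zpowers_le, hCH, mem_cent]
  have hWQ : Subgroup.zpowers ρ ≤ Q := Subgroup.zpowers_le.2 hρ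
  have hZl : Subgroup.center H ≤ CH := fun z hz => mem_cent.2 (Subgroup.mem_center_iff.1 hz ρ).symm
  set W := (Subgroup.zpowers ρ).subgroupOf CH with hW
  have hmk : ∀ a b : CH, (a : CH ⧸ W) = b ↔ (b : H) * (a : H)⁻¹ ∈ Subgroup.zpowers ρ := by
    intro a b
    rw [eq_comm, QuotientGroup.eq_iff_div_mem, hW, Subgroup.mem_subgroupOf, div_eq_mul_inv]
    rfl
  have hmk1 : ∀ a : CH, (a : CH ⧸ W) = 1 ↔ (a : H) ∈ Subgroup.zpowers ρ := by
    intro a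
    rw [QuotientGroup.eq_one_iff, hW, Subgroup.mem_subgroupOf]
  let P : Subgroup (CH ⧸ W) := (Q.subgroupOf CH).map (QuotientGroup.mk' W)
  have hPm : ∀ a : CH, (a : CH ⧸ W) ∈ P ↔ (a : H) ∈ Q := by
    intro a
    constructor
    · rintro ⟨b, hb, hab⟩
      have hab' : (b : CH ⧸ W) = a := hab
      rw [hmk] at hab'
      have := Q.mul_mem (hWQ hab') (show (b : H) ∈ Q from hb)
      rwa [inv_mul_cancel_right] at this
    · intro ha
      exact ⟨a, ha, rfl⟩
  have hPn : P.Normal := Subgroup.Normal.map inferInstance _ (QuotientGroup.mk'_surjective W)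
  have hcW : Nat.card W = 3 := by
    rw [hW, Nat.card_congr (Subgroup.subgroupOfEquivOfLe hWl).toEquiv, Nat.card_zpowers]
    exact orderOf_eq_prime (hF.cube ρ hρ) hρ1
  have hcP : Nat.card P = 3 ^ 7 := by
    have h1 := Subgroup.card_mul_index P
    have h2 := Subgroup.card_mul_index (Q.subgroupOf CH)
    have h3 := Subgroup.card_eq_card_quotient_mul_card_subgroup W
    have h4 : P.comap (QuotientGroup.mk' W) = Q.subgroupOf CH := by
      ext a
      exact hPm a
    have h5 := Subgroup.index_comap_of_surjective P (QuotientGroup.mk'_surjective W)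
    rw [h4] at h5
    rw [card_CQ hF hρ hZ, h5] at h2
    rw [hcW, ← h1, ← h2] at h3
    have h6 : P.index ≠ 0 := Subgroup.index_ne_zero_of_finite
    have h7 : (3 ^ 7 * 3) * P.index = (Nat.card P * 3) * P.index := by
      rw [mul_right_comm (Nat.card P), ← h3]; norm_num
    have := Nat.eq_of_mul_eq_mul_right (Nat.pos_of_ne_zero h6) h7
    omega
  have hOp : Op 3 (CH ⧸ W) = P := by
    apply le_antisymm
    · apply sSup_le
      rintro R ⟨hRn, hRp⟩
      have hle : (R.comap (QuotientGroup.mk' W)).map CH.subtype ≤ Q := by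
        apply hR
        · rintro _ ⟨x, _, rfl⟩
          exact x.2
        · rintro s hs _ ⟨x, hx, rfl⟩
          refine ⟨⟨s, hs⟩ * x * ⟨s, hs⟩⁻¹, ?_, rfl⟩
          exact hRn.conj_mem _ hx ((⟨s, hs⟩ : CH) : CH ⧸ W)
        · rintro _ ⟨x, hx, rfl⟩
          obtain ⟨k, hk⟩ := hRp ⟨_, hx⟩
          have hk' : ((x ^ 3 ^ k : CH) : CH ⧸ W) = 1 := congrArg Subtype.val hk
          rw [hmk1] at hk'
          have := hF.cube _ (hWQ hk')
          refine ⟨k + 1, ?_⟩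
          rw [pow_succ, pow_mul]
          exact this
      intro x hx
      obtain ⟨a, rfl⟩ := QuotientGroup.mk_surjective x
      rw [hPm]
      exact hle ⟨a, hx, rfl⟩
    · apply le_sSup
      refine ⟨hPn, ?_⟩
      rintro ⟨x, hx⟩
      obtain ⟨a, rfl⟩ := QuotientGroup.mk_surjective x
      refine ⟨1, ?_⟩
      ext
      have h3 : a ^ 3 = 1 := Subtype.ext (hF.cube a ((hPm a).1 hx))
      show (a : CH ⧸ W) ^ 3 ^ 1 = 1
      rw [pow_one, ← QuotientGroup.mk_pow, h3]; rfl
  have hZP : ∀ z : Subgroup.center H, ((⟨z, hZl z.2⟩ : CH) : CH ⧸ W) ∈ P := fun z =>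
    (hPm _).2 (hF.ZQ z.2)
  have hZc : ∀ z : Subgroup.center H, (⟨_, hZP z⟩ : P) ∈ Subgroup.center P := by
    intro z
    rw [Subgroup.mem_center_iff]
    rintro ⟨x, hx⟩
    obtain ⟨a, rfl⟩ := QuotientGroup.mk_surjective x
    ext
    show (a : CH ⧸ W) * ((⟨z, hZl z.2⟩ : CH) : CH ⧸ W) = ((⟨z, hZl z.2⟩ : CH) : CH ⧸ W) * a
    rw [← QuotientGroup.mk_mul, ← QuotientGroup.mk_mul]
    congr 1
    ext
    exact Subgroup.mem_center_iff.1 z.2 a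
  have hbij : Function.Bijective
      (fun z : Subgroup.center H => (⟨⟨_, hZP z⟩, hZc z⟩ : Subgroup.center P)) := by
    constructor
    · intro z z' h
      have h1 : ((⟨z, hZl z.2⟩ : CH) : CH ⧸ W) = ((⟨z', hZl z'.2⟩ : CH) : CH ⧸ W) :=
        congrArg (fun t : Subgroup.center P => ((t : P) : CH ⧸ W)) h
      rw [hmk] at h1
      have h2 := zpow_center hF hρ hZ h1 (Subgroup.mul_mem _ z'.2 (Subgroup.inv_mem _ z.2))
      rw [mul_inv_eq_one] at h2
      exact Subtype.ext h2.symm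
    · rintro ⟨⟨x, hx⟩, hxc⟩
      obtain ⟨a, rfl⟩ := QuotientGroup.mk_surjective x
      obtain ⟨k, hk⟩ := central_CQ hF hρ hZ hy hyρ ((hPm a).1 hx) (mem_cent.1 a.2) (by
        intro u hu huρ
        have huC : u ∈ CH := mem_cent.2 huρ
        have huP : ((⟨u, huC⟩ : CH) : CH ⧸ W) ∈ P := (hPm _).2 hu
        have h1 := Subgroup.mem_center_iff.1 hxc ⟨_, huP⟩
        have h2 : ((⟨u, huC⟩ * a : CH) : CH ⧸ W) = ((a * ⟨u, huC⟩ : CH) : CH ⧸ W) :=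
          congrArg Subtype.val h1
        rw [hmk] at h2
        have e : (a : H) * u * (a : H)⁻¹ * u⁻¹ = (a * u) * (u * a : H)⁻¹ := by group
        rw [e]
        exact h2)
      refine ⟨⟨_, hk⟩, ?_⟩
      ext
      show ((⟨ρ ^ k * a, hZl hk⟩ : CH) : CH ⧸ W) = a
      rw [eq_comm, hmk]
      show ρ ^ k * (a : H) * (a : H)⁻¹ ∈ _
      rw [mul_inv_cancel_right]
      exact ⟨k, rfl⟩
  have hcc : Nat.card (Subgroup.center P) = 3 := by
    rw [← hF.cardZ]
    exact (Nat.card_congr (Equiv.ofBijective _ hbij)).symm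
  have hex : IsExtraspecial 3 P := by
    apply exsp
    · rintro ⟨x, hx⟩
      obtain ⟨a, rfl⟩ := QuotientGroup.mk_surjective x
      ext
      have h3 : a ^ 3 = 1 := Subtype.ext (hF.cube a ((hPm a).1 hx))
      show (a : CH ⧸ W) ^ 3 = 1
      rw [← QuotientGroup.mk_pow, h3]; rfl
    · exact hcc
    · rintro ⟨x, hx⟩ ⟨x', hx'⟩
      obtain ⟨a, rfl⟩ := QuotientGroup.mk_surjective x
      obtain ⟨b, rfl⟩ := QuotientGroup.mk_surjective x'
      exact hZc ⟨_, hF.cQ a ((hPm a).1 hx) b ((hPm b).1 hx')⟩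
    · by_contra! hcon
      have : Subgroup.center P = ⊤ := by
        rw [eq_top_iff]
        intro x _
        rw [Subgroup.mem_center_iff]
        exact fun g => hcon g x
      rw [this, Subgroup.card_top, hcP] at hcc
      norm_num at hcc
  refine ⟨P, hOp, hex, hcP, ?_⟩
  have hDP : Subgroup.centralizer (P : Set (CH ⧸ W)) ≤ P := by
    rw [← hOp]
    apply le_sSup
    rw [hOp]
    refine ⟨inferInstance, ?_⟩
    rintro ⟨x, hx⟩
    obtain ⟨a, rfl⟩ := QuotientGroup.mk_surjective x
    have h27 : (a : H) ^ 27 = 1 := by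
      apply pow27 hF hρ (mem_cent.1 a.2)
      intro u hu huρ
      have huC : u ∈ CH := mem_cent.2 huρ
      have huP : ((⟨u, huC⟩ : CH) : CH ⧸ W) ∈ P := (hPm _).2 hu
      have h2 : ((⟨u, huC⟩ * a : CH) : CH ⧸ W) = ((a * ⟨u, huC⟩ : CH) : CH ⧸ W) :=
        Subgroup.mem_centralizer_iff.1 hx _ huP
      rw [hmk] at h2
      have e : (a : H) * u * (a : H)⁻¹ * u⁻¹ = (a * u) * (u * a : H)⁻¹ := by group
      rw [e]
      exact h2
    refine ⟨3, ?_⟩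
    ext
    have h3 : a ^ 27 = 1 := Subtype.ext h27
    show (a : CH ⧸ W) ^ 27 = 1
    rw [← QuotientGroup.mk_pow, h3]; rfl
  ext x
  constructor
  · intro hx
    refine ⟨⟨x, hDP hx⟩, ?_, rfl⟩
    rw [SetLike.mem_coe, Subgroup.mem_center_iff]
    intro g
    ext
    exact Subgroup.mem_centralizer_iff.1 hx g g.2
  · rintro ⟨p, hp, rfl⟩
    rw [Subgroup.mem_centralizer_iff]
    intro g hg
    exact congrArg Subtype.val (Subgroup.mem_center_iff.1 hp ⟨g, hg⟩)

end F2Aux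

/-- **Lemma 4.8(ii).** Let `H` be similar to a 3-centralizer in a group of type `F₂` with
`Q = O₃(H)`, let `r ∈ H` be an involution whose image in `H/Q` lies in
`O₂(H/Q) ∖ Z(O₂(H/Q))`, and let `ρ ∈ C_Q(r) ∖ Z`.  Then `|C_H(ρ)| = 2⁸·3¹⁰`, the
centralizer `C_H(ρ)` splits as a direct product `⟨ρ⟩ × C`, and
`O₃(C_H(ρ)/⟨ρ⟩)` is extraspecial of order 3⁷ and self-centralizing (its centralizer in
`C_H(ρ)/⟨ρ⟩` is its own center). -/
theorem stmt_18 {H : Type*} [Group H] [Finite H] (Q : Subgroup H) [Q.Normal]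
    (hH : SimilarToF2Centralizer H Q) (r : H) (hr : orderOf r = 2)
    (hrO2 : (r : H ⧸ Q) ∈ Op 2 (H ⧸ Q))
    (hrnc : (r : H ⧸ Q) ∉ Subgroup.centralizer ((Op 2 (H ⧸ Q)) : Set (H ⧸ Q)))
    (ρ : H) (hρQ : ρ ∈ Q) (hρr : ρ ∈ Subgroup.centralizer {r})
    (hρZ : ρ ∉ Subgroup.center H) :
    Nat.card (Subgroup.centralizer ({ρ} : Set H)) = 2 ^ 8 * 3 ^ 10 ∧
    (∃ C : Subgroup H, C ≤ Subgroup.centralizer {ρ} ∧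
      (∀ g ∈ Subgroup.centralizer ({ρ} : Set H), ∀ c ∈ C, g * c * g⁻¹ ∈ C) ∧
      Subgroup.zpowers ρ ⊔ C = Subgroup.centralizer {ρ} ∧
      Subgroup.zpowers ρ ⊓ C = ⊥) ∧
    IsExtraspecial 3
      (Op 3 (Subgroup.centralizer ({ρ} : Set H) ⧸
        (Subgroup.zpowers ρ).subgroupOf (Subgroup.centralizer {ρ}))) ∧
    Nat.card
      (Op 3 (Subgroup.centralizer ({ρ} : Set H) ⧸
        (Subgroup.zpowers ρ).subgroupOf (Subgroup.centralizer {ρ}))) = 3 ^ 7 ∧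
    Subgroup.centralizer
        ((Op 3 (Subgroup.centralizer ({ρ} : Set H) ⧸
          (Subgroup.zpowers ρ).subgroupOf (Subgroup.centralizer {ρ}))) :
            Set (Subgroup.centralizer ({ρ} : Set H) ⧸
              (Subgroup.zpowers ρ).subgroupOf (Subgroup.centralizer {ρ}))) =
      Subgroup.map
        (Op 3 (Subgroup.centralizer ({ρ} : Set H) ⧸
          (Subgroup.zpowers ρ).subgroupOf (Subgroup.centralizer {ρ}))).subtype
        (Subgroup.center
          (Op 3 (Subgroup.centralizer ({ρ} : Set H) ⧸
            (Subgroup.zpowers ρ).subgroupOf (Subgroup.centralizer {ρ})))) := by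
  have hF := F2Aux.hf_of hH
  obtain ⟨h1, ⟨y, hy, hyρ, hyy⟩, hR⟩ := F2Aux.facts Q hH r hr hrO2 hrnc ρ hρQ hρr hρZ
  obtain ⟨P, hOp, hex, hcP, hcen⟩ := F2Aux.final hF hρQ hρZ hy hyρ hR
  refine ⟨h1, F2Aux.splitting hF hρQ hρZ hy hyρ hyy, ?_⟩
  rw [hOp]
  exact ⟨hex, hcP, hcen⟩
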